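/- Let R be an unramified hypersurface and let M and N be finitely generated R-modules with M nonzero. Let i be an integer with i ≤ grade(M) and assume that Ext_R^j(M,N) has finite length for all j ≤ i. If Ext_R^i(M,N) = 0, then Ext_R^j(M,N) = 0 for all j ≤ i. -/

import Mathlib

open CategoryTheory IsLocalRing

universe u

/-- `extMod S n A B` is the `n`-th Ext module `Ext_S^n(A, B)` of `S`-modules `A` and `B`,
realized as an object of `ModuleCat S`. -/
noncomputable def extMod (S : Type u) [CommRing S] (n : ℕ)
    (A : Type u) [AddCommGroup A] [Module S A] (B : Type u) [AddCommGroup B] [Module S B] :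
    ModuleCat.{u} S :=
  ((Ext S (ModuleCat.{u} S) n).obj (Opposite.op (ModuleCat.of S A))).obj (ModuleCat.of S B)

/-- `moduleGrade S M = inf { n | Ext_S^n(M, S) ≠ 0 }`. -/
noncomputable def moduleGrade (S : Type u) [CommRing S]
    (M : Type u) [AddCommGroup M] [Module S M] : ℕ :=
  sInf {n : ℕ | ¬ Subsingleton (extMod S n M S)}

/-- A Noetherian local ring is regular if its maximal ideal can be generated by
`dim R` many elements. -/
def IsRegularLocal (R : Type u) [CommRing R] [IsLocalRing R] : Prop :=
  IsNoetherianRing R ∧ ∃ s : Finset R, Ideal.span (s : Set R) = maximalIdeal R ∧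
    ((s.card : ℕ∞) : WithBot ℕ∞) = ringKrullDim R

/-- A local ring `(R, m, k)` is unramified if it is equicharacteristic
(`char R = char k`), or it has mixed characteristic (`char R ≠ char k`) and
`char k ∉ m²`. -/
def IsUnramifiedLocal (R : Type u) [CommRing R] [IsLocalRing R] : Prop :=
  ringChar R = ringChar (ResidueField R) ∨
    (ringChar R ≠ ringChar (ResidueField R) ∧
      ((ringChar (ResidueField R) : R) ∉ (maximalIdeal R) ^ 2))

/-- A presentation of the `m`-adic completion of a local ring `R` as `Q/(x)` with
`(Q, n)` a regular local ring and `x ∈ n²` a nonzerodivisor. -/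
structure HypersurfacePresentation (R : Type u) [CommRing R] [IsLocalRing R] :
    Type (u + 1) where
  Q : Type u
  [commRing : CommRing Q]
  [localRing : IsLocalRing Q]
  regular : IsRegularLocal Q
  x : Q
  mem_sq : x ∈ (maximalIdeal Q) ^ 2
  nonzerodivisor : x ∈ nonZeroDivisors Q
  equiv : AdicCompletion (maximalIdeal R) R ≃+* Q ⧸ Ideal.span {x}

/-- A local ring `R` is a hypersurface if it is not regular and its `m`-adic completion
is isomorphic to `Q/(x)` for a regular local ring `(Q, n)` and a nonzerodivisor `x ∈ n²`. -/
def IsHypersurface (R : Type u) [CommRing R] [IsLocalRing R] : Prop :=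
  ¬ IsRegularLocal R ∧ Nonempty (HypersurfacePresentation R)

namespace ExtRigid

universe v w

open TensorProduct RingTheory.Sequence
open scoped Pointwise

set_option linter.unusedSectionVars false

section Homology

variable {S : Type*} [CommRing S]
variable {X : ℕ → Type*} [∀ j, AddCommGroup (X j)] [∀ j, Module S (X j)]
variable {X' : ℕ → Type*} [∀ j, AddCommGroup (X' j)] [∀ j, Module S (X' j)]
variable {X'' : ℕ → Type*} [∀ j, AddCommGroup (X'' j)] [∀ j, Module S (X'' j)]

/-- The homology at `X (j + 1)` of a sequence of linear maps. -/
def Hm (d : ∀ j, X j →ₗ[S] X (j + 1)) (j : ℕ) : Type _ :=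
  ↥(LinearMap.ker (d (j + 1))) ⧸
    (LinearMap.range (d j)).comap (LinearMap.ker (d (j + 1))).subtype

instance (d : ∀ j, X j →ₗ[S] X (j + 1)) (j : ℕ) : AddCommGroup (Hm d j) :=
  inferInstanceAs (AddCommGroup (↥(LinearMap.ker (d (j + 1))) ⧸
    (LinearMap.range (d j)).comap (LinearMap.ker (d (j + 1))).subtype))

instance (d : ∀ j, X j →ₗ[S] X (j + 1)) (j : ℕ) : Module S (Hm d j) :=
  inferInstanceAs (Module S (↥(LinearMap.ker (d (j + 1))) ⧸
    (LinearMap.range (d j)).comap (LinearMap.ker (d (j + 1))).subtype))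

instance [IsNoetherianRing S] (d : ∀ j, X j →ₗ[S] X (j + 1)) (j : ℕ)
    [Module.Finite S (X (j + 1))] : Module.Finite S (Hm d j) :=
  inferInstanceAs (Module.Finite S (↥(LinearMap.ker (d (j + 1))) ⧸
    (LinearMap.range (d j)).comap (LinearMap.ker (d (j + 1))).subtype))

/-- The homology class of a cycle. -/
def Hm.mk (d : ∀ j, X j →ₗ[S] X (j + 1)) (j : ℕ) (x : X (j + 1)) (hx : d (j + 1) x = 0) :
    Hm d j :=
  Submodule.Quotient.mk ⟨x, hx⟩

section API

variable {d : ∀ j, X j →ₗ[S] X (j + 1)} {j : ℕ}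

theorem Hm.exists_mk (z : Hm d j) : ∃ x hx, z = Hm.mk d j x hx := by
  obtain ⟨⟨x, hx⟩, rfl⟩ := Submodule.Quotient.mk_surjective _ z
  exact ⟨x, hx, rfl⟩

theorem Hm.mk_eq_zero {x : X (j + 1)} {hx : d (j + 1) x = 0} :
    Hm.mk d j x hx = 0 ↔ ∃ y, d j y = x := by
  refine (Submodule.Quotient.mk_eq_zero _).trans ?_
  simp

theorem Hm.mk_eq_mk {x x' : X (j + 1)} {hx : d (j + 1) x = 0} {hx' : d (j + 1) x' = 0} :
    Hm.mk d j x hx = Hm.mk d j x' hx' ↔ ∃ y, d j y = x - x' := by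
  refine (Submodule.Quotient.eq _).trans ?_
  simp

theorem Hm.mk_add {x x' : X (j + 1)} (hx : d (j + 1) x = 0) (hx' : d (j + 1) x' = 0) :
    Hm.mk d j (x + x') (by simp [hx, hx']) = Hm.mk d j x hx + Hm.mk d j x' hx' := rfl

theorem Hm.mk_smul (s : S) {x : X (j + 1)} (hx : d (j + 1) x = 0) :
    Hm.mk d j (s • x) (by simp [hx]) = s • Hm.mk d j x hx := rfl

theorem Hm.subsingleton_iff :
    Subsingleton (Hm d j) ↔ ∀ x, d (j + 1) x = 0 → ∃ y, d j y = x := by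
  constructor
  · intro h x hx
    exact Hm.mk_eq_zero.1 (Subsingleton.elim (Hm.mk d j x hx) 0)
  · intro h
    refine ⟨fun a b => ?_⟩
    have key : ∀ a : Hm d j, a = 0 := by
      intro a
      obtain ⟨x, hx, rfl⟩ := Hm.exists_mk a
      exact Hm.mk_eq_zero.2 (h x hx)
    rw [key a, key b]

/-- A linear map out of the cycles vanishing on boundaries. -/
def Hm.lift {Y : Type*} [AddCommGroup Y] [Module S Y] (φ : ↥(LinearMap.ker (d (j + 1))) →ₗ[S] Y)
    (hφ : ∀ y (h : d (j + 1) (d j y) = 0), φ ⟨d j y, h⟩ = 0) : Hm d j →ₗ[S] Y :=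
  Submodule.liftQ _ φ (by
    rintro ⟨x, hx⟩ ⟨y, hy⟩
    subst hy
    exact hφ y hx)

end API

/-- The map on homology induced by a map of complexes. -/
def Hm.map {d' : ∀ j, X' j →ₗ[S] X' (j + 1)} {d : ∀ j, X j →ₗ[S] X (j + 1)}
    (f : ∀ j, X' j →ₗ[S] X j) (hf : ∀ j x, d j (f j x) = f (j + 1) (d' j x)) (j : ℕ) :
    Hm d' j →ₗ[S] Hm d j :=
  Hm.lift
    ((Submodule.mkQ _).comp
      (((f (j + 1)).comp (LinearMap.ker (d' (j + 1))).subtype).codRestrict _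
        (fun x => by
          have := x.2
          rw [LinearMap.mem_ker] at this ⊢
          simp [hf, this])))
    (by
      intro y h
      exact (Hm.mk_eq_zero (hx := (hf _ _).trans
        ((congrArg (f (j + 2)) h).trans (map_zero _)))).2 ⟨f j y, hf j y⟩)

theorem Hm.map_mk {d' : ∀ j, X' j →ₗ[S] X' (j + 1)} {d : ∀ j, X j →ₗ[S] X (j + 1)}
    (f : ∀ j, X' j →ₗ[S] X j) (hf : ∀ j x, d j (f j x) = f (j + 1) (d' j x)) (j : ℕ)
    (x : X' (j + 1)) (hx : d' (j + 1) x = 0) :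
    Hm.map f hf j (Hm.mk d' j x hx) = Hm.mk d j (f (j + 1) x) (by rw [hf, hx, map_zero]) := rfl

/-- The long exact homology sequence. -/
theorem Hm.exists_connecting
    {d' : ∀ j, X' j →ₗ[S] X' (j + 1)} {d : ∀ j, X j →ₗ[S] X (j + 1)}
    {d'' : ∀ j, X'' j →ₗ[S] X'' (j + 1)}
    (hd : ∀ j x, d (j + 1) (d j x) = 0)
    (f : ∀ j, X' j →ₗ[S] X j) (hf : ∀ j x, d j (f j x) = f (j + 1) (d' j x))
    (g : ∀ j, X j →ₗ[S] X'' j) (hg : ∀ j x, d'' j (g j x) = g (j + 1) (d j x))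
    (hinj : ∀ j, Function.Injective (f j)) (hex : ∀ j, Function.Exact (f j) (g j))
    (hsurj : ∀ j, Function.Surjective (g j)) (j : ℕ) :
    Function.Exact (Hm.map f hf j) (Hm.map g hg j) ∧
    ∃ δ : Hm d'' j →ₗ[S] Hm d' (j + 1),
      Function.Exact (Hm.map g hg j) δ ∧ Function.Exact δ (Hm.map f hf (j + 1)) := by
  have hgf : ∀ j x, g j (f j x) = 0 := fun j x => (hex j _).2 ⟨x, rfl⟩
  constructor
  · intro z
    obtain ⟨x, hx, rfl⟩ := Hm.exists_mk z
    rw [Hm.map_mk, Hm.mk_eq_zero]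
    constructor
    · rintro ⟨y, hy⟩
      obtain ⟨w, rfl⟩ := hsurj j y
      rw [hg] at hy
      have : g (j + 1) (x - d j w) = 0 := by rw [map_sub, hy, sub_self]
      obtain ⟨v, hv⟩ := (hex _ _).1 this
      have hv0 : d' (j + 1) v = 0 := by
        apply hinj
        rw [← hf, hv, map_sub, hx, hd, map_zero, sub_self]
      refine ⟨Hm.mk d' j v hv0, ?_⟩
      rw [Hm.map_mk, Hm.mk_eq_mk]
      exact ⟨-w, by rw [hv, map_neg]; abel⟩
    · rintro ⟨y, hy⟩
      obtain ⟨v, hv, rfl⟩ := Hm.exists_mk y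
      rw [Hm.map_mk, Hm.mk_eq_mk] at hy
      obtain ⟨w, hw⟩ := hy
      refine ⟨- g j w, ?_⟩
      rw [map_neg, hg, hw, map_sub, hgf, zero_sub, neg_neg]
  · have hlift : ∀ z : LinearMap.ker (d'' (j + 1)), ∃ x y, g (j + 1) x = z ∧
        f (j + 2) y = d (j + 1) x := by
      rintro ⟨z, hz⟩
      obtain ⟨x, rfl⟩ := hsurj _ z
      have : g (j + 2) (d (j + 1) x) = 0 := by rw [← hg]; exact hz
      obtain ⟨y, hy⟩ := (hex _ _).1 this
      exact ⟨x, y, rfl, hy⟩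
    have hcyc : ∀ x y, f (j + 2) y = d (j + 1) x → d' (j + 2) y = 0 := by
      intro x y h
      apply hinj
      rw [← hf, h, hd, map_zero]
    have huniq : ∀ x y, f (j + 2) y = d (j + 1) x → (∃ w, g (j + 1) x = d'' j w) →
        ∃ v, d' (j + 1) v = y := by
      rintro x y h ⟨w, hw⟩
      obtain ⟨w, rfl⟩ := hsurj _ w
      have : g (j + 1) (x - d j w) = 0 := by rw [map_sub, hw, hg, sub_self]
      obtain ⟨v, hv⟩ := (hex _ _).1 this
      refine ⟨v, hinj _ ?_⟩
      rw [← hf, hv, map_sub, hd, sub_zero, h]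
    choose px py hpx hpy using hlift
    have hval : ∀ (z : LinearMap.ker (d'' (j + 1))) x y (h : f (j + 2) y = d (j + 1) x),
        g (j + 1) x = z →
        Hm.mk d' (j + 1) (py z) (hcyc _ _ (hpy z)) = Hm.mk d' (j + 1) y (hcyc _ _ h) := by
      intro z x y h hz
      rw [Hm.mk_eq_mk]
      refine huniq (px z - x) _ (by rw [map_sub, map_sub, hpy, h]) ⟨0, ?_⟩
      rw [map_sub, hpx, hz, sub_self, map_zero]
    let φ : LinearMap.ker (d'' (j + 1)) →ₗ[S] Hm d' (j + 1) :=
      { toFun := fun z => Hm.mk d' (j + 1) (py z) (hcyc _ _ (hpy z))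
        map_add' := by
          intro a b
          rw [← Hm.mk_add]
          exact hval _ (px a + px b) _ (by rw [map_add, map_add, hpy, hpy])
            (by rw [map_add, hpx, hpx]; rfl)
        map_smul' := by
          intro s a
          rw [RingHom.id_apply, ← Hm.mk_smul]
          exact hval _ (s • px a) _ (by rw [map_smul, map_smul, hpy])
            (by rw [map_smul, hpx]; rfl) }
    have hφ : ∀ y (h : d'' (j + 1) (d'' j y) = 0), φ ⟨d'' j y, h⟩ = 0 := by
      intro y h
      change Hm.mk _ _ _ _ = 0
      rw [Hm.mk_eq_zero]
      exact huniq _ _ (hpy _) ⟨y, hpx _⟩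
    have hδ : ∀ x y (h : f (j + 2) y = d (j + 1) x) (h' : d'' (j + 1) (g (j + 1) x) = 0),
        Hm.lift φ hφ (Hm.mk d'' j (g (j + 1) x) h') = Hm.mk d' (j + 1) y (hcyc _ _ h) := by
      intro x y h h'
      exact hval ⟨_, h'⟩ x y h rfl
    refine ⟨Hm.lift φ hφ, ?_, ?_⟩
    · intro z
      obtain ⟨z, hz, rfl⟩ := Hm.exists_mk z
      obtain ⟨x, rfl⟩ := hsurj _ z
      obtain ⟨y, hy⟩ := (hex _ _).1 (show g (j + 2) (d (j + 1) x) = 0 by rw [← hg, hz])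
      rw [hδ x y hy, Hm.mk_eq_zero]
      constructor
      · rintro ⟨v, rfl⟩
        refine ⟨Hm.mk d j (x - f (j + 1) v) (by rw [map_sub, hf, hy, sub_self]), ?_⟩
        rw [Hm.map_mk, Hm.mk_eq_mk]
        exact ⟨0, by rw [map_sub, hgf, map_zero]; abel⟩
      · rintro ⟨v, hv⟩
        obtain ⟨v, hv0, rfl⟩ := Hm.exists_mk v
        rw [Hm.map_mk, Hm.mk_eq_mk] at hv
        obtain ⟨w, hw⟩ := hv
        exact huniq (x - v) y (by rw [map_sub, hv0, sub_zero, hy]) ⟨-w, by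
          rw [map_neg, hw, map_sub]; abel⟩
    · intro z
      obtain ⟨y, hy0, rfl⟩ := Hm.exists_mk z
      rw [Hm.map_mk, Hm.mk_eq_zero]
      constructor
      · rintro ⟨x, hx⟩
        have h0 : d'' (j + 1) (g (j + 1) x) = 0 := by rw [hg, hx, hgf]
        exact ⟨Hm.mk d'' j (g (j + 1) x) h0, hδ x y hx.symm h0⟩
      · rintro ⟨w, hw⟩
        obtain ⟨w, hw0, rfl⟩ := Hm.exists_mk w
        obtain ⟨x, rfl⟩ := hsurj _ w
        obtain ⟨y', hy'⟩ := (hex _ _).1 (show g (j + 2) (d (j + 1) x) = 0 by rw [← hg, hw0])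
        rw [hδ x y' hy', Hm.mk_eq_mk] at hw
        obtain ⟨v, hv⟩ := hw
        refine ⟨x - f (j + 1) v, ?_⟩
        rw [map_sub, hf, hv, map_sub, hy']; abel

end Homology

section Length

variable {S : Type*} [CommRing S]
variable {A B C : Type*} [AddCommGroup A] [Module S A] [AddCommGroup B] [Module S B]
  [AddCommGroup C] [Module S C]

variable (S) in
/-- The length of a module as an integer (zero for modules of infinite length). -/
noncomputable def ell (Z : Type*) [AddCommGroup Z] [Module S Z] : ℤ :=
  ((Module.length S Z).toNat : ℤ)

theorem ell_nonneg (Z : Type*) [AddCommGroup Z] [Module S Z] : 0 ≤ ell S Z := by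
  simp [ell]

theorem ell_eq_zero_iff {Z : Type*} [AddCommGroup Z] [Module S Z] (h : IsFiniteLength S Z) :
    ell S Z = 0 ↔ Subsingleton Z := by
  rw [← Module.length_ne_top_iff] at h
  rw [← Module.length_eq_zero_iff (R := S), ell]
  simp [h]

theorem ell_of_subsingleton (Z : Type*) [AddCommGroup Z] [Module S Z] [Subsingleton Z] :
    ell S Z = 0 := by
  simp [ell, Module.length_eq_zero]

theorem ell_congr (e : A ≃ₗ[S] B) : ell S A = ell S B := by
  rw [ell, ell, e.length_eq]

theorem ell_add_of_exact (f : A →ₗ[S] B) (g : B →ₗ[S] C) (hf : Function.Injective f)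
    (hg : Function.Surjective g) (h : Function.Exact f g) (hB : IsFiniteLength S B) :
    ell S B = ell S A + ell S C := by
  have hA := Module.length_ne_top_iff.2 (hB.of_injective hf)
  have hC := Module.length_ne_top_iff.2 (hB.of_surjective hg)
  rw [ell, ell, ell, Module.length_eq_add_of_exact f g hf hg h, ENat.toNat_add hA hC]
  push_cast
  rfl

theorem isFiniteLength_of_exact (f : A →ₗ[S] B) (g : B →ₗ[S] C) (h : Function.Exact f g)
    (hA : IsFiniteLength S A) (hC : IsFiniteLength S C) : IsFiniteLength S B := by
  have h1 : IsFiniteLength S (LinearMap.range f) :=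
    hA.of_surjective f.surjective_rangeRestrict
  have h2 : IsFiniteLength S (LinearMap.range g) :=
    hC.of_injective (LinearMap.range g).injective_subtype
  rw [← Module.length_ne_top_iff] at h1 h2 ⊢
  rw [Module.length_eq_add_of_exact (LinearMap.range f).subtype g.rangeRestrict
    (LinearMap.range f).injective_subtype g.surjective_rangeRestrict]
  · simp [h1, h2]
  · intro b
    rw [Subtype.ext_iff]
    simpa using h b

/-- Multiplication by `y` on `Z`. -/
abbrev smulMap (y : S) (Z : Type*) [AddCommGroup Z] [Module S Z] : Z →ₗ[S] Z :=
  LinearMap.lsmul S Z y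

theorem smulMap_apply (y : S) (z : A) : smulMap y A z = y • z := rfl

variable [IsLocalRing S] [IsNoetherianRing S]

omit [IsNoetherianRing S] in
theorem exists_pow_smul_of_isFiniteLength {Z : Type*} [AddCommGroup Z] [Module S Z]
    (h : IsFiniteLength S Z) : ∃ k, ∀ a ∈ maximalIdeal S ^ k, ∀ z : Z, a • z = 0 := by
  induction h with
  | of_subsingleton => exact ⟨0, fun a _ z => Subsingleton.elim _ _⟩
  | @of_simple_quotient Z _ _ N _ hN ih =>
    obtain ⟨k, hk⟩ := ih
    refine ⟨k + 1, fun a ha z => ?_⟩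
    have hmax : Module.annihilator S (Z ⧸ N) = maximalIdeal S :=
      IsLocalRing.eq_maximalIdeal IsSimpleModule.annihilator_isMaximal
    have hm : ∀ b ∈ maximalIdeal S, b • z ∈ N := by
      intro b hb
      rw [← hmax, Module.mem_annihilator] at hb
      rw [← Submodule.Quotient.mk_eq_zero, Submodule.Quotient.mk_smul]
      exact hb _
    rw [pow_succ] at ha
    refine Submodule.mul_induction_on ha ?_ ?_
    · intro b hb c hc
      rw [mul_smul]
      exact congrArg Subtype.val (hk b hb ⟨c • z, hm c hc⟩)
    · intro x y hx hy
      rw [add_smul, hx, hy, add_zero]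

omit [IsNoetherianRing S] in
theorem eq_maximalIdeal_of_mem_support {Z : Type*} [AddCommGroup Z] [Module S Z]
    (h : IsFiniteLength S Z) (p : PrimeSpectrum S) (hp : p ∈ Module.support S Z) :
    p.asIdeal = maximalIdeal S := by
  obtain ⟨k, hk⟩ := exists_pow_smul_of_isFiniteLength h
  obtain ⟨z, hz⟩ := Module.mem_support_iff_exists_annihilator.1 hp
  have h1 : maximalIdeal S ^ k ≤ p.asIdeal := by
    intro a ha
    apply hz
    rw [Submodule.mem_annihilator_span_singleton]
    exact hk a ha z
  exact (IsLocalRing.le_maximalIdeal p.2.ne_top).antisymm (p.2.le_of_pow_le h1)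

theorem isFiniteLength_of_support {Z : Type u} [AddCommGroup Z] [Module S Z] [Module.Finite S Z]
    (h : ∀ p ∈ Module.support S Z, p.asIdeal = maximalIdeal S) : IsFiniteLength S Z := by
  revert h
  refine IsNoetherianRing.induction_on_isQuotientEquivQuotientPrime (A := S) (M := Z) ‹_›
    (motive := fun N _ _ _ => (∀ p ∈ Module.support S N, p.asIdeal = maximalIdeal S) →
      IsFiniteLength S N) ?_ ?_ ?_
  · intro N _ _ _ _ _
    exact .of_subsingleton
  · intro N _ _ _ p e h
    have : IsSimpleModule S (S ⧸ p.asIdeal) := by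
      rw [h p ?_]
      · exact isSimpleModule_iff_isCoatom.2 (IsLocalRing.maximalIdeal.isMaximal S).out
      · rw [e.support_eq, Module.mem_support_iff_of_finite, Ideal.annihilator_quotient]
    exact (isFiniteLength_iff_isNoetherian_isArtinian (R := S) (M := S ⧸ p.asIdeal)).2
      ⟨inferInstance, inferInstance⟩ |>.of_injective e.injective
  · intro N₁ _ _ _ N₂ _ _ _ N₃ _ _ _ f g hf hg hfg h1 h3 h
    rw [Module.support_of_exact hfg hf hg] at h
    exact isFiniteLength_of_exact f g hfg (h1 fun p hp => h p (Or.inl hp))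
      (h3 fun p hp => h p (Or.inr hp))

theorem isFiniteLength_of_pow {Z : Type u} [AddCommGroup Z] [Module S Z] [Module.Finite S Z]
    (k : ℕ) (h : ∀ a ∈ maximalIdeal S ^ k, ∀ z : Z, a • z = 0) : IsFiniteLength S Z := by
  refine isFiniteLength_of_support fun p hp => ?_
  obtain ⟨z, hz⟩ := Module.mem_support_iff_exists_annihilator.1 hp
  have h1 : maximalIdeal S ^ k ≤ p.asIdeal := by
    intro a ha
    apply hz
    rw [Submodule.mem_annihilator_span_singleton]
    exact h a ha z
  exact (IsLocalRing.le_maximalIdeal p.2.ne_top).antisymm (p.2.le_of_pow_le h1)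

variable (S) in
/-- `p` is a prime which is exactly the annihilator of an element of `Z`. -/
def IsAsc (Z : Type*) [AddCommGroup Z] [Module S Z] (p : Ideal S) : Prop :=
  p.IsPrime ∧ ∃ z : Z, ∀ a, a ∈ p ↔ a • z = 0

omit [IsLocalRing S] in
theorem isAsc_iff {Z : Type*} [AddCommGroup Z] [Module S Z] (p : Ideal S) :
    IsAsc S Z p ↔ IsAssociatedPrime p Z := by
  rw [isAssociatedPrime_iff, IsAsc]
  refine and_congr_right fun _ => exists_congr fun z => ?_
  rw [Ideal.ext_iff]
  simp [Submodule.mem_colon_singleton]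

omit [IsLocalRing S] in
theorem exists_isAsc_of_ne_zero {Z : Type*} [AddCommGroup Z] [Module S Z] (z : Z) (hz : z ≠ 0) :
    ∃ p, IsAsc S Z p ∧ ∀ a : S, a • z = 0 → a ∈ p := by
  obtain ⟨p, hp, h⟩ := exists_le_isAssociatedPrime_of_isNoetherianRing S z hz
  exact ⟨p, (isAsc_iff p).2 hp, fun a ha => h (by simp [Submodule.mem_colon_singleton, ha])⟩

omit [IsLocalRing S] [IsNoetherianRing S] in
theorem IsAsc.of_injective {p : Ideal S} (h : IsAsc S A p) (f : A →ₗ[S] B)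
    (hf : Function.Injective f) : IsAsc S B p := by
  obtain ⟨hp, z, hz⟩ := h
  exact ⟨hp, f z, fun a => by rw [hz, ← map_smul, map_eq_zero_iff f hf]⟩

omit [IsLocalRing S] [IsNoetherianRing S] in
theorem IsAsc.mem_support {p : Ideal S} (h : IsAsc S A p) :
    (⟨p, h.1⟩ : PrimeSpectrum S) ∈ Module.support S A := by
  obtain ⟨hp, z, hz⟩ := h
  refine Module.mem_support_iff_exists_annihilator.2 ⟨z, fun a ha => ?_⟩
  rw [Submodule.mem_annihilator_span_singleton] at ha
  exact (hz a).2 ha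

omit [IsLocalRing S] in
theorem exists_isAsc_le_of_mem_support {Z : Type*} [AddCommGroup Z] [Module S Z]
    (p : PrimeSpectrum S) (hp : p ∈ Module.support S Z) : ∃ q ≤ p.asIdeal, IsAsc S Z q := by
  obtain ⟨z, hz⟩ := Module.mem_support_iff_exists_annihilator.1 hp
  obtain ⟨q, hq, hqp⟩ := Ideal.exists_minimalPrimes_le hz
  refine ⟨q, hqp, ?_⟩
  have := Module.associatedPrimes.minimalPrimes_annihilator_subset_associatedPrimes S (S ∙ z) hq
  exact ((isAsc_iff q).2 this).of_injective _ (Submodule.injective_subtype _)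

theorem isFiniteLength_of_isAsc {Z : Type u} [AddCommGroup Z] [Module S Z] [Module.Finite S Z]
    (h : ∀ p, IsAsc S Z p → p = maximalIdeal S) : IsFiniteLength S Z := by
  refine isFiniteLength_of_support fun p hp => ?_
  obtain ⟨q, hq, hq'⟩ := exists_isAsc_le_of_mem_support p hp
  exact (IsLocalRing.le_maximalIdeal p.2.ne_top).antisymm (h q hq' ▸ hq)

theorem eq_bot_of_smulMap {Z : Type*} [AddCommGroup Z] [Module S Z] [Module.Finite S Z]
    (N : Submodule S Z) (y : S) (hy : y ∈ maximalIdeal S) (h : ∀ z ∈ N, ∃ w ∈ N, y • w = z) :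
    N = ⊥ := by
  apply Submodule.eq_bot_of_le_smul_of_le_jacobson_bot (Ideal.span {y}) N
    (IsNoetherian.noetherian N)
  · intro z hz
    obtain ⟨w, hw, rfl⟩ := h z hz
    exact Submodule.smul_mem_smul (Ideal.mem_span_singleton_self y) hw
  · rw [IsLocalRing.jacobson_eq_maximalIdeal _ bot_ne_top, Ideal.span_singleton_le_iff_mem]
    exact hy

/-- Comparison of the lengths of the kernel and the cokernel of multiplication by `y`. -/
theorem ell_ker_le_ell_coker {Z : Type*} [AddCommGroup Z] [Module S Z] [Module.Finite S Z]
    (y : S) (hy : y ∈ maximalIdeal S)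
    (hK : IsFiniteLength S (LinearMap.ker (smulMap y Z)))
    (hC : IsFiniteLength S (Z ⧸ LinearMap.range (smulMap y Z))) :
    ell S (LinearMap.ker (smulMap y Z)) ≤ ell S (Z ⧸ LinearMap.range (smulMap y Z)) ∧
    (ell S (LinearMap.ker (smulMap y Z)) = ell S (Z ⧸ LinearMap.range (smulMap y Z)) →
      IsFiniteLength S Z) := by
  obtain ⟨n, hn⟩ := monotone_stabilizes_iff_noetherian.2 (inferInstance : IsNoetherian S Z)
    (⟨fun n => LinearMap.ker (smulMap (y ^ n) Z), by
      intro a b hab z hz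
      rw [LinearMap.mem_ker, smulMap_apply] at hz ⊢
      rw [← Nat.sub_add_cancel hab, pow_add, mul_smul, hz, smul_zero]⟩ : ℕ →o Submodule S Z)
  replace hn : ∀ m, n ≤ m → LinearMap.ker (smulMap (y ^ n) Z) =
      LinearMap.ker (smulMap (y ^ m) Z) := hn
  set W := LinearMap.ker (smulMap (y ^ n) Z) with hW
  have hWsat : ∀ z, y • z ∈ W → z ∈ W := by
    intro z hz
    rw [hn (n + 1) n.le_succ, LinearMap.mem_ker, smulMap_apply, pow_succ, mul_smul]
    exact hz
  have hflk : ∀ k, IsFiniteLength S (LinearMap.ker (smulMap (y ^ k) Z)) := by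
    intro k
    induction k with
    | zero =>
      have : Subsingleton (LinearMap.ker (smulMap (y ^ 0) Z)) := by
        refine ⟨fun a b => ?_⟩
        have ha : y ^ 0 • (a : Z) = 0 := a.2
        have hb : y ^ 0 • (b : Z) = 0 := b.2
        exact Subtype.ext (by simpa using (show (a : Z) = b by simpa using ha.trans hb.symm))
      exact .of_subsingleton
    | succ k ih =>
      let f : LinearMap.ker (smulMap (y ^ k) Z) →ₗ[S] LinearMap.ker (smulMap (y ^ (k + 1)) Z) :=
        Submodule.inclusion (by
          intro z hz
          rw [LinearMap.mem_ker, smulMap_apply] at hz ⊢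
          rw [pow_succ', mul_smul, hz, smul_zero])
      let g : LinearMap.ker (smulMap (y ^ (k + 1)) Z) →ₗ[S] LinearMap.ker (smulMap y Z) :=
        ((smulMap (y ^ k) Z).comp (Submodule.subtype _)).codRestrict _ (by
          rintro ⟨z, hz⟩
          rw [LinearMap.mem_ker, smulMap_apply] at hz
          rw [LinearMap.mem_ker, smulMap_apply, LinearMap.comp_apply, smulMap_apply, ← mul_smul,
            ← pow_succ']
          exact hz)
      refine isFiniteLength_of_exact f g ?_ ih hK
      rintro ⟨z, hz⟩
      constructor
      · intro h
        have h' : y ^ k • z = 0 := congrArg Subtype.val h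
        exact ⟨⟨z, h'⟩, rfl⟩
      · rintro ⟨⟨w, hw⟩, h⟩
        have : w = z := congrArg Subtype.val h
        subst this
        exact Subtype.ext hw
  have hWfl : IsFiniteLength S W := hflk n
  -- multiplication by `y` on `W`
  have hyW : ∀ z ∈ W, y • z ∈ W := fun z hz => W.smul_mem y hz
  have hKW : LinearMap.ker (smulMap y Z) ≤ W := by
    intro z hz
    apply hWsat
    rw [LinearMap.mem_ker, smulMap_apply] at hz
    rw [hz]; exact W.zero_mem
  let i : LinearMap.ker (smulMap y Z) →ₗ[S] W := Submodule.inclusion hKW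
  let r := LinearMap.range (smulMap y W)
  have e1 : ell S W = ell S (LinearMap.ker (smulMap y Z)) + ell S r := by
    refine ell_add_of_exact i (smulMap y W).rangeRestrict (Submodule.inclusion_injective _)
      (LinearMap.surjective_rangeRestrict _) ?_ hWfl
    rintro ⟨z, hz⟩
    constructor
    · intro h
      have h' : y • z = 0 := congrArg (fun t => ((t : W) : Z)) (congrArg Subtype.val h)
      exact ⟨⟨z, h'⟩, rfl⟩
    · rintro ⟨⟨w, hw⟩, h⟩
      have : w = z := congrArg Subtype.val h
      subst this
      exact Subtype.ext (Subtype.ext hw)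
  have e2 : ell S W = ell S r + ell S (W ⧸ r) :=
    ell_add_of_exact r.subtype r.mkQ r.injective_subtype r.mkQ_surjective
      (LinearMap.exact_subtype_mkQ r) hWfl
  let R := LinearMap.range (smulMap y Z)
  let f : (W ⧸ r) →ₗ[S] Z ⧸ R := Submodule.mapQ r R W.subtype (by
    rintro _ ⟨w, rfl⟩
    exact ⟨w, rfl⟩)
  let g : (Z ⧸ R) →ₗ[S] Z ⧸ (W ⊔ R) := Submodule.mapQ R (W ⊔ R) LinearMap.id le_sup_right
  have hf : Function.Injective f := by
    rw [injective_iff_map_eq_zero]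
    intro a ha
    obtain ⟨⟨w, hw⟩, rfl⟩ := Submodule.Quotient.mk_surjective _ a
    rw [Submodule.mapQ_apply, Submodule.Quotient.mk_eq_zero] at ha
    obtain ⟨z, hz⟩ := ha
    have hz' : y • z = w := hz
    rw [Submodule.Quotient.mk_eq_zero]
    exact ⟨⟨z, hWsat z (hz' ▸ hw)⟩, Subtype.ext hz'⟩
  have hg : Function.Surjective g := by
    intro a
    obtain ⟨z, rfl⟩ := Submodule.Quotient.mk_surjective _ a
    exact ⟨Submodule.Quotient.mk z, rfl⟩
  have hfg : Function.Exact f g := by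
    intro a
    obtain ⟨z, rfl⟩ := Submodule.Quotient.mk_surjective _ a
    rw [Submodule.mapQ_apply, LinearMap.id_apply, Submodule.Quotient.mk_eq_zero,
      Submodule.mem_sup]
    constructor
    · rintro ⟨w, hw, t, ht, rfl⟩
      refine ⟨Submodule.Quotient.mk ⟨w, hw⟩, ?_⟩
      rw [Submodule.mapQ_apply, Submodule.Quotient.eq]
      simpa using R.neg_mem ht
    · rintro ⟨a, ha⟩
      obtain ⟨⟨w, hw⟩, rfl⟩ := Submodule.Quotient.mk_surjective _ a
      rw [Submodule.mapQ_apply, Submodule.Quotient.eq] at ha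
      exact ⟨w, hw, z - w, by simpa using R.neg_mem ha, by simp⟩
  have e3 := ell_add_of_exact f g hf hg hfg hC
  have h0 := ell_nonneg (S := S) (Z ⧸ (W ⊔ R))
  refine ⟨by change _ ≤ ell S (Z ⧸ R); linarith, fun heq => ?_⟩
  have h1 : ell S (Z ⧸ (W ⊔ R)) = 0 := by
    change _ = ell S (Z ⧸ R) at heq
    linarith
  rw [ell_eq_zero_iff (hC.of_surjective hg), Submodule.Quotient.subsingleton_iff] at h1
  have hWtop : W = ⊤ := by
    have : Subsingleton (Z ⧸ W) := by
      have hb : (⊤ : Submodule S (Z ⧸ W)) = ⊥ := by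
        refine eq_bot_of_smulMap _ y hy fun a _ => ?_
        obtain ⟨z, rfl⟩ := Submodule.Quotient.mk_surjective _ a
        have : z ∈ W ⊔ R := h1 ▸ Submodule.mem_top
        obtain ⟨w, hw, t, ⟨s, rfl⟩, rfl⟩ := Submodule.mem_sup.1 this
        refine ⟨Submodule.Quotient.mk s, trivial, ?_⟩
        rw [← Submodule.Quotient.mk_smul, Submodule.Quotient.eq]
        simpa [smulMap_apply] using hw
      exact ⟨fun a b => ((Submodule.mem_bot S).1 (hb ▸ Submodule.mem_top : a ∈ ⊥)).trans
        ((Submodule.mem_bot S).1 (hb ▸ Submodule.mem_top : b ∈ ⊥)).symm⟩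
    rwa [Submodule.Quotient.subsingleton_iff] at this
  rw [hWtop] at hWfl
  exact hWfl.of_surjective (Submodule.topEquiv (R := S) (M := Z)).surjective

end Length

section MatrixComplex

variable {S : Type*} [CommRing S]

section mv

variable {ι κ ρ : Type} [Fintype ι] [Fintype κ]
variable {B : Type*} [AddCommGroup B] [Module S B] {B' : Type*} [AddCommGroup B'] [Module S B']

/-- A matrix acting on tuples of elements of a module. -/
def mv (M : Matrix κ ι S) (B : Type*) [AddCommGroup B] [Module S B] :
    (ι → B) →ₗ[S] (κ → B) where
  toFun x k := ∑ i, M k i • x i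
  map_add' x y := by
    ext k
    simp [Finset.sum_add_distrib]
  map_smul' s x := by
    ext k
    simp [Finset.smul_sum, smul_comm s]

omit [Fintype κ] in
theorem mv_apply (M : Matrix κ ι S) (x : ι → B) (k : κ) : mv M B x k = ∑ i, M k i • x i := rfl

omit [Fintype κ] in
theorem mv_map (M : Matrix κ ι S) (f : B' →ₗ[S] B) (x : ι → B') :
    mv M B (f.compLeft ι x) = f.compLeft κ (mv M B' x) := by
  ext k
  simp [mv_apply]

theorem mv_mul (M : Matrix ρ κ S) (N : Matrix κ ι S) (x : ι → B) :
    mv (M * N) B x = mv M B (mv N B x) := by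
  ext k
  simp only [mv_apply, Matrix.mul_apply, Finset.sum_smul, Finset.smul_sum, mul_smul]
  rw [Finset.sum_comm]

omit [Fintype κ] in
@[simp] theorem mv_zero (x : ι → B) : mv (0 : Matrix κ ι S) B x = 0 := by
  ext k
  simp [mv_apply]

omit [Fintype κ] in
theorem mv_add (M N : Matrix κ ι S) (x : ι → B) : mv (M + N) B x = mv M B x + mv N B x := by
  ext k
  simp [mv_apply, add_smul, Finset.sum_add_distrib]

omit [Fintype κ] in
theorem mv_smul (s : S) (M : Matrix κ ι S) (x : ι → B) : mv (s • M) B x = s • mv M B x := by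
  ext k
  simp [mv_apply, mul_smul, Finset.smul_sum]

end mv

variable {ι : ℕ → Type} [∀ j, Fintype (ι j)]

/-- The homology of a complex of matrices acting on a module. -/
abbrev hq (d : ∀ j, Matrix (ι (j + 1)) (ι j) S) (B : Type*) [AddCommGroup B] [Module S B]
    (j : ℕ) : Type _ :=
  Hm (fun j => mv (d j) B) j

variable (d : ∀ j, Matrix (ι (j + 1)) (ι j) S)
variable {B : Type*} [AddCommGroup B] [Module S B]
variable {B' : Type*} [AddCommGroup B'] [Module S B']
variable {B'' : Type*} [AddCommGroup B''] [Module S B'']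

/-- The map on homology induced by a linear map of modules. -/
abbrev hqMap (f : B' →ₗ[S] B) (j : ℕ) : hq d B' j →ₗ[S] hq d B j :=
  Hm.map (fun j => f.compLeft (ι j)) (fun _ _ => mv_map _ _ _) j

theorem hqMap_comp (f : B' →ₗ[S] B) (g : B →ₗ[S] B'') (j : ℕ) (x : hq d B' j) :
    hqMap d g j (hqMap d f j x) = hqMap d (g.comp f) j x := by
  obtain ⟨x, hx, rfl⟩ := Hm.exists_mk x
  rfl

theorem hqMap_id (j : ℕ) (x : hq d B j) : hqMap d LinearMap.id j x = x := by
  obtain ⟨x, hx, rfl⟩ := Hm.exists_mk x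
  rfl

theorem hqMap_smul (y : S) (j : ℕ) (x : hq d B j) : hqMap d (smulMap y B) j x = y • x := by
  obtain ⟨x, hx, rfl⟩ := Hm.exists_mk x
  rfl

/-- Isomorphic modules have isomorphic homology. -/
def hqCongr (e : B' ≃ₗ[S] B) (j : ℕ) : hq d B' j ≃ₗ[S] hq d B j :=
  LinearEquiv.ofLinearMap (hqMap d e.toLinearMap j) (hqMap d e.symm.toLinearMap j)
    (by
      ext x
      simp only [LinearMap.comp_apply, hqMap_comp]
      simp [hqMap_id])
    (by
      ext x
      simp only [LinearMap.comp_apply, hqMap_comp]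
      simp [hqMap_id])

theorem hq_exact (hd : ∀ j, d (j + 1) * d j = 0) (f : B' →ₗ[S] B) (g : B →ₗ[S] B'')
    (hf : Function.Injective f) (hg : Function.Surjective g) (h : Function.Exact f g) (j : ℕ) :
    Function.Exact (hqMap d f j) (hqMap d g j) ∧
    ∃ δ : hq d B'' j →ₗ[S] hq d B' (j + 1),
      Function.Exact (hqMap d g j) δ ∧ Function.Exact δ (hqMap d f (j + 1)) := by
  refine Hm.exists_connecting (fun j x => ?_) _ _ _ _ (fun j => ?_) (fun j => ?_) (fun j => ?_) j
  · change mv _ _ (mv _ _ x) = 0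
    rw [← mv_mul, hd, mv_zero]
  · exact fun x y hxy => funext fun i => hf (congrFun hxy i)
  · intro x
    constructor
    · intro hx
      choose y hy using fun i => (h (x i)).1 (congrFun hx i)
      exact ⟨y, funext hy⟩
    · rintro ⟨y, rfl⟩
      exact funext fun i => (h _).2 ⟨_, rfl⟩
  · intro x
    choose y hy using fun i => hg (x i)
    exact ⟨y, funext hy⟩

theorem subsingleton_hq [Subsingleton B] (j : ℕ) : Subsingleton (hq d B j) :=
  Hm.subsingleton_iff.2 fun _ _ => ⟨0, Subsingleton.elim _ _⟩

instance [IsNoetherianRing S] [Module.Finite S B] (j : ℕ) : Module.Finite S (hq d B j) :=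
  inferInstance

theorem range_smulMap (y : S) : LinearMap.range (smulMap y B) = y • (⊤ : Submodule S B) := by
  ext z
  simp [Submodule.mem_smul_pointwise_iff_exists]

/-- The long exact sequence for multiplication by a regular element, in terms of kernels and
cokernels. -/
theorem hq_smul_exact (hd : ∀ j, d (j + 1) * d j = 0) (y : S) (hy : IsSMulRegular B y) (j : ℕ) :
    ∃ (f : (hq d B j ⧸ LinearMap.range (smulMap y (hq d B j))) →ₗ[S] hq d (QuotSMulTop y B) j)
      (g : hq d (QuotSMulTop y B) j →ₗ[S] LinearMap.ker (smulMap y (hq d B (j + 1)))),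
      Function.Injective f ∧ Function.Surjective g ∧ Function.Exact f g ∧
      ∀ z, f (Submodule.Quotient.mk z) = hqMap d (Submodule.mkQ (y • ⊤)) j z := by
  obtain ⟨h1, δ, h2, h3⟩ := hq_exact d hd (smulMap y B) (Submodule.mkQ (y • ⊤))
    hy (Submodule.mkQ_surjective _) (by
      intro x
      rw [Submodule.mkQ_apply, Submodule.Quotient.mk_eq_zero, ← range_smulMap]
      rfl) j
  have e1 : ∀ z, hqMap d (smulMap y B) j z = smulMap y _ z := fun z => hqMap_smul d y j z
  have e2 : ∀ z, hqMap d (smulMap y B) (j + 1) z = smulMap y _ z :=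
    fun z => hqMap_smul d y (j + 1) z
  refine ⟨Submodule.liftQ _ (hqMap d (Submodule.mkQ (y • ⊤)) j) ?_, δ.codRestrict _ ?_, ?_, ?_,
    ?_, fun z => rfl⟩
  · rintro _ ⟨z, rfl⟩
    exact (h1 _).2 ⟨z, e1 z⟩
  · intro z
    exact (e2 _).symm.trans ((h3 _).2 ⟨z, rfl⟩)
  · rw [injective_iff_map_eq_zero]
    intro a ha
    obtain ⟨z, rfl⟩ := Submodule.Quotient.mk_surjective _ a
    obtain ⟨w, hw⟩ := (h1 z).1 ha
    rw [Submodule.Quotient.mk_eq_zero]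
    exact ⟨w, (e1 w).symm.trans hw⟩
  · rintro ⟨z, hz⟩
    obtain ⟨w, hw⟩ := (h3 z).1 ((e2 z).trans hz)
    exact ⟨w, Subtype.ext hw⟩
  · intro z
    constructor
    · intro hz
      obtain ⟨w, hw⟩ := (h2 z).1 (congrArg Subtype.val hz)
      exact ⟨Submodule.Quotient.mk w, hw⟩
    · rintro ⟨a, rfl⟩
      obtain ⟨w, rfl⟩ := Submodule.Quotient.mk_surjective _ a
      exact Subtype.ext ((h2 _).2 ⟨w, rfl⟩)

/-- The alternating partial sums `q (n - 1) - q (n - 2) + ⋯`. -/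
def altSum (q : ℕ → ℤ) : ℕ → ℤ
  | 0 => 0
  | n + 1 => q n - altSum q n

theorem altSum_congr {q q' : ℕ → ℤ} {n : ℕ} (h : ∀ j < n, q j = q' j) :
    altSum q n = altSum q' n := by
  induction n with
  | zero => rfl
  | succ n ih =>
    rw [altSum, altSum, h n n.lt_succ_self, ih fun j hj => h j (hj.trans n.lt_succ_self)]

end MatrixComplex

section RegularSequences

variable {S : Type*} [CommRing S] [IsLocalRing S] [IsNoetherianRing S]

/-- A minimal generator of an ideal generated by a weakly regular sequence can be taken as
the first element of such a sequence. -/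
theorem exists_isWeaklyRegular_cons (l : List S) :
    ∀ (B : Type u) [AddCommGroup B] [Module S B] [Module.Finite S B] (y : S),
      (∀ a ∈ l, a ∈ maximalIdeal S) → IsWeaklyRegular B l → y ∈ Ideal.ofList l →
      y ∉ maximalIdeal S * Ideal.ofList l →
      ∃ l', l'.length + 1 = l.length ∧ Ideal.ofList (y :: l') = Ideal.ofList l ∧
        IsWeaklyRegular B (y :: l') := by
  induction l with
  | nil =>
    intro B _ _ _ y _ _ hy hy'
    rw [Ideal.ofList_nil, Ideal.mem_bot] at hy
    exact absurd (hy ▸ Ideal.zero_mem _) hy'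
  | cons a t ih =>
    intro B _ _ _ y hl hB hy hy'
    have hat : ∀ x ∈ t, x ∈ maximalIdeal S := fun x hx => hl x (List.mem_cons_of_mem _ hx)
    have ha : a ∈ maximalIdeal S := hl a List.mem_cons_self
    rw [Ideal.ofList_cons] at hy
    obtain ⟨b, hb, z, hz, rfl⟩ := Submodule.mem_sup.1 hy
    obtain ⟨c, rfl⟩ := Ideal.mem_span_singleton'.1 hb
    by_cases hc : IsUnit c
    · have hspan : Ideal.ofList ((c * a + z) :: t) = Ideal.ofList (a :: t) := by
        rw [Ideal.ofList_cons, Ideal.ofList_cons]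
        apply le_antisymm
        · refine sup_le ?_ le_sup_right
          rw [Ideal.span_singleton_le_iff_mem]
          exact hy
        · refine sup_le ?_ le_sup_right
          rw [Ideal.span_singleton_le_iff_mem]
          obtain ⟨e, he⟩ := hc.exists_left_inv
          have : a = e * (c * a + z) + -(e * z) := by linear_combination (-a) * he
          have h : e * (c * a + z) + -(e * z) ∈ Ideal.span {c * a + z} ⊔ Ideal.ofList t :=
            Submodule.add_mem_sup (Ideal.mul_mem_left _ _ (Ideal.mem_span_singleton_self _))
              (neg_mem (Ideal.mul_mem_left _ _ hz))
          rwa [← this] at h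
      refine ⟨t, rfl, hspan, ?_⟩
      have h1 : IsWeaklyRegular B (t ++ [a]) :=
        IsLocalRing.isWeaklyRegular_of_perm_of_subset_maximalIdeal hB
          (List.perm_append_singleton a t).symm hl
      rw [isWeaklyRegular_append_iff, isWeaklyRegular_singleton_iff] at h1
      have h2 : IsWeaklyRegular B (t ++ [c * a + z]) := by
        rw [isWeaklyRegular_append_iff, isWeaklyRegular_singleton_iff]
        refine ⟨h1.1, ?_⟩
        have hz0 : ∀ x : B ⧸ (Ideal.ofList t • ⊤ : Submodule S B), z • x = 0 := by
          intro x
          obtain ⟨x, rfl⟩ := Submodule.Quotient.mk_surjective _ x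
          rw [← Submodule.Quotient.mk_smul, Submodule.Quotient.mk_eq_zero]
          exact Submodule.smul_mem_smul hz trivial
        have : IsSMulRegular (B ⧸ (Ideal.ofList t • ⊤ : Submodule S B)) (c * a) :=
          (IsUnit.isSMulRegular _ hc).mul h1.2
        intro x x' hx
        simp only [add_smul, hz0, add_zero] at hx
        exact this hx
      refine IsLocalRing.isWeaklyRegular_of_perm_of_subset_maximalIdeal h2
        (List.perm_append_singleton _ t) fun x hx => ?_
      rcases List.mem_append.1 hx with hx | hx
      · exact hat x hx
      · rw [List.mem_singleton.1 hx]
        refine add_mem (Ideal.mul_mem_left _ _ ha) ?_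
        exact (Ideal.span_le.2 hat : Ideal.ofList t ≤ _) hz
    · rw [isWeaklyRegular_cons_iff] at hB
      have hz' : z ∉ maximalIdeal S * Ideal.ofList t := by
        intro h
        apply hy'
        refine add_mem ?_ ?_
        · refine Ideal.mul_mem_mul ((IsLocalRing.mem_maximalIdeal _).2 hc) ?_
          rw [Ideal.ofList_cons]
          exact Ideal.mem_sup_left (Ideal.mem_span_singleton_self a)
        · refine Ideal.mul_mono_right ?_ h
          rw [Ideal.ofList_cons]
          exact le_sup_right
      obtain ⟨l', hlen, hspan, hreg⟩ := ih (QuotSMulTop a B) z hat hB.2 hz hz'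
      have hml' : ∀ x ∈ (z :: l'), x ∈ maximalIdeal S := by
        intro x hx
        have : x ∈ Ideal.ofList (z :: l') := Ideal.subset_span hx
        rw [hspan] at this
        exact (Ideal.span_le.2 hat : Ideal.ofList t ≤ _) this
      have hca : ∀ x : QuotSMulTop a B, a • x = 0 := by
        intro x
        obtain ⟨x, rfl⟩ := Submodule.Quotient.mk_surjective _ x
        rw [← Submodule.Quotient.mk_smul, Submodule.Quotient.mk_eq_zero]
        exact Submodule.smul_mem_pointwise_smul _ _ _ trivial
      have h1 : IsWeaklyRegular B (a :: (c * a + z) :: l') := by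
        rw [isWeaklyRegular_cons_iff]
        refine ⟨hB.1, ?_⟩
        refine ((AddEquiv.refl (QuotSMulTop a B)).isWeaklyRegular_congr (as := z :: l')
          (bs := (c * a + z) :: l') (List.Forall₂.cons (fun x => ?_)
            (List.forall₂_same.2 fun r _ x => rfl))).1 hreg
        change z • x = (c * a + z) • x
        rw [add_smul, mul_smul, hca, smul_zero, zero_add]
      refine ⟨a :: l', by simpa using hlen, ?_, ?_⟩
      · rw [Ideal.ofList_cons, Ideal.ofList_cons, Ideal.ofList_cons, ← hspan, Ideal.ofList_cons]
        rw [← sup_assoc, ← sup_assoc]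
        congr 1
        rw [← Ideal.span_insert, ← Ideal.span_insert]
        apply le_antisymm <;> rw [Ideal.span_le, Set.insert_subset_iff, Set.singleton_subset_iff]
        · exact ⟨Ideal.mem_span_pair.2 ⟨c, 1, by ring⟩, Ideal.subset_span (by simp)⟩
        · exact ⟨Ideal.subset_span (by simp), Ideal.mem_span_pair.2 ⟨1, -c, by ring⟩⟩
      · refine IsLocalRing.isWeaklyRegular_of_perm_of_subset_maximalIdeal h1
          (List.Perm.swap _ _ _) fun x hx => ?_
        rcases List.mem_cons.1 hx with rfl | hx
        · exact ha
        rcases List.mem_cons.1 hx with rfl | hx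
        · exact add_mem (Ideal.mul_mem_left _ _ ha) (hml' z List.mem_cons_self)
        · exact hml' x (List.mem_cons_of_mem _ hx)

end RegularSequences

section Chi

variable {S : Type*} [CommRing S] [IsLocalRing S] [IsNoetherianRing S]
variable {ι : ℕ → Type} [∀ j, Fintype (ι j)]
variable (d : ∀ j, Matrix (ι (j + 1)) (ι j) S)

/-- The properties of the alternating sum of lengths of homology of a complex with coefficients
in a quotient `C` of `B` by a regular sequence. -/
def ChiGood (K : ℕ) (B C : Type u) [AddCommGroup B] [Module S B] [AddCommGroup C] [Module S C] :
    Prop :=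
  0 ≤ altSum (fun j => ell S (hq d C j)) (K + 1) ∧
  (altSum (fun j => ell S (hq d C j)) (K + 1) = 0 →
    ¬ IsAsc S (hq d B (K + 1)) (maximalIdeal S) ∧
    (∀ p, IsAsc S (hq d B (K + 1)) p → ∀ hp : p.IsPrime,
      (⟨p, hp⟩ : PrimeSpectrum S) ∉ Module.support S (hq d B K)) ∧
    ((∀ j ≤ K, Subsingleton (hq d B j)) → ∀ j ≤ K, Subsingleton (hq d C j)))

variable {d}

omit [IsLocalRing S] [IsNoetherianRing S] in
theorem altSum_ell_congr {C C' : Type u} [AddCommGroup C] [Module S C]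
    [AddCommGroup C'] [Module S C'] (e : C ≃ₗ[S] C') (n : ℕ) :
    altSum (fun j => ell S (hq d C j)) n = altSum (fun j => ell S (hq d C' j)) n :=
  altSum_congr fun j _ => ell_congr (hqCongr d e j)

omit [IsNoetherianRing S] in
theorem ChiGood.congr {K : ℕ} {B C C' : Type u} [AddCommGroup B] [Module S B] [AddCommGroup C]
    [Module S C] [AddCommGroup C'] [Module S C'] (h : ChiGood d K B C) (e : C ≃ₗ[S] C') :
    ChiGood d K B C' := by
  rw [ChiGood, altSum_ell_congr e] at h
  refine ⟨h.1, fun h0 => ⟨(h.2 h0).1, (h.2 h0).2.1, fun hB j hj => ?_⟩⟩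
  have := (h.2 h0).2.2 hB j hj
  exact (hqCongr d e j).symm.injective.subsingleton

omit [IsLocalRing S] in
theorem eq_maximalIdeal_of_mem_support_hq [IsLocalRing S] (hd : ∀ j, d (j + 1) * d j = 0)
    (l : List S) :
    ∀ (B : Type u) [AddCommGroup B] [Module S B] [Module.Finite S B], IsWeaklyRegular B l →
      ∀ j, IsFiniteLength S (hq d (B ⧸ (Ideal.ofList l • ⊤ : Submodule S B)) j) →
      ∀ p : PrimeSpectrum S, Ideal.ofList l ≤ p.asIdeal → p ∈ Module.support S (hq d B j) →
        p.asIdeal = maximalIdeal S := by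
  induction l with
  | nil =>
    intro B _ _ _ _ j hfl p _ hp
    have e : (B ⧸ (Ideal.ofList ([] : List S) • ⊤ : Submodule S B)) ≃ₗ[S] B :=
      Submodule.quotEquivOfEqBot _ (by simp)
    exact eq_maximalIdeal_of_mem_support
      (hfl.of_injective (hqCongr d e.symm j).injective) p hp
  | cons y l ih =>
    intro B _ _ _ hB j hfl p hlp hp
    rw [isWeaklyRegular_cons_iff] at hB
    rw [Ideal.ofList_cons, sup_le_iff, Ideal.span_singleton_le_iff_mem] at hlp
    refine ih (QuotSMulTop y B) hB.2 j (hfl.of_injective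
      (hqCongr d (Submodule.quotOfListConsSMulTopEquivQuotSMulTopInner B y l).symm j).injective)
      p hlp.2 ?_
    obtain ⟨f, g, hf, -, -, -⟩ := hq_smul_exact d hd y hB.1 j
    refine Module.support_subset_of_injective f hf ?_
    rw [range_smulMap]
    have := Module.support_quotSMulTop (R := S) (M := hq d B j) y
    exact this ▸ ⟨hp, by simpa using hlp.1⟩

theorem eq_maximalIdeal_of_isAsc_hq (hd : ∀ j, d (j + 1) * d j = 0) (y : S)
    (l : List S) (B : Type u) [AddCommGroup B] [Module S B] [Module.Finite S B]
    (hB : IsWeaklyRegular B (y :: l)) (j : ℕ)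
    (hfl : IsFiniteLength S (hq d (B ⧸ (Ideal.ofList (y :: l) • ⊤ : Submodule S B)) j))
    (p : Ideal S) (hlp : Ideal.ofList (y :: l) ≤ p) (hp : IsAsc S (hq d B (j + 1)) p) :
    p = maximalIdeal S := by
  rw [isWeaklyRegular_cons_iff] at hB
  rw [Ideal.ofList_cons, sup_le_iff, Ideal.span_singleton_le_iff_mem] at hlp
  refine eq_maximalIdeal_of_mem_support_hq hd l (QuotSMulTop y B) hB.2 j (hfl.of_injective
      (hqCongr d (Submodule.quotOfListConsSMulTopEquivQuotSMulTopInner B y l).symm j).injective)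
      ⟨p, hp.1⟩ hlp.2 ?_
  obtain ⟨f, g, -, hg, -, -⟩ := hq_smul_exact d hd y hB.1 j
  apply Module.support_subset_of_surjective g hg
  obtain ⟨hpp, z, hz⟩ := hp
  have h1 : IsAsc S (LinearMap.ker (smulMap y (hq d B (j + 1)))) p :=
    ⟨hpp, ⟨z, (hz y).1 hlp.1⟩, fun a =>
      (hz a).trans ⟨fun h => Subtype.ext h, fun h => congrArg Subtype.val h⟩⟩
  exact h1.mem_support

/-- Two consequences of the absence of associated primes on `Z / y Z`. -/
theorem smul_injective_of_not_isAsc {Z : Type u} [AddCommGroup Z] [Module S Z] [Module.Finite S Z]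
    (y : S) (hy : y ∈ maximalIdeal S) (hK : IsFiniteLength S (LinearMap.ker (smulMap y Z)))
    (hZ : ¬ IsAsc S (Z ⧸ LinearMap.range (smulMap y Z)) (maximalIdeal S)) :
    Function.Injective (smulMap y Z) ∧ ¬ IsAsc S Z (maximalIdeal S) := by
  obtain ⟨r, hr⟩ := exists_pow_smul_of_isFiniteLength hK
  let G : Submodule S Z :=
    { carrier := {z | ∃ k, ∀ a ∈ maximalIdeal S ^ k, a • z = 0}
      add_mem' := by
        rintro z z' ⟨k, hk⟩ ⟨k', hk'⟩
        refine ⟨max k k', fun a ha => ?_⟩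
        rw [smul_add, hk a (Ideal.pow_le_pow_right (le_max_left _ _) ha),
          hk' a (Ideal.pow_le_pow_right (le_max_right _ _) ha), add_zero]
      zero_mem' := ⟨0, fun a _ => smul_zero a⟩
      smul_mem' := by
        rintro c z ⟨k, hk⟩
        exact ⟨k, fun a ha => by rw [smul_comm, hk a ha, smul_zero]⟩ }
  have hG : G = ⊥ := by
    refine eq_bot_of_smulMap G y hy ?_
    rintro z ⟨k, hk⟩
    have hz : (Submodule.Quotient.mk z : Z ⧸ LinearMap.range (smulMap y Z)) = 0 := by
      by_contra hne
      obtain ⟨p, hp, hp'⟩ := exists_isAsc_of_ne_zero (S := S) _ hne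
      have : maximalIdeal S ^ k ≤ p := fun a ha => hp' a (by
        rw [← Submodule.Quotient.mk_smul, hk a ha, Submodule.Quotient.mk_zero])
      have : p = maximalIdeal S :=
        (IsLocalRing.le_maximalIdeal hp.1.ne_top).antisymm (hp.1.le_of_pow_le this)
      exact hZ (this ▸ hp)
    rw [Submodule.Quotient.mk_eq_zero] at hz
    obtain ⟨w, rfl⟩ := hz
    refine ⟨w, ⟨r + k, fun a ha => ?_⟩, rfl⟩
    rw [pow_add] at ha
    refine Submodule.mul_induction_on ha ?_ ?_
    · intro a ha b hb
      rw [mul_smul]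
      refine congrArg Subtype.val (hr a ha ⟨b • w, ?_⟩)
      have := hk b hb
      rw [smulMap_apply, smul_comm] at this
      exact this
    · intro a b ha hb
      rw [add_smul, ha, hb, add_zero]
  constructor
  · rw [← LinearMap.ker_eq_bot, eq_bot_iff, ← hG]
    exact fun z hz => ⟨r, fun a ha => congrArg Subtype.val (hr a ha ⟨z, hz⟩)⟩
  · rintro ⟨hm, z, hz⟩
    have hzG : z ∈ G := ⟨1, fun a ha => (hz a).1 (by simpa using ha)⟩
    rw [hG, Submodule.mem_bot] at hzG
    have := (hz 1).2 (by rw [hzG, smul_zero])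
    exact hm.ne_top ((Ideal.eq_top_iff_one _).2 this)

theorem exists_isAsc_quotient {Z : Type u} [AddCommGroup Z] [Module S Z] [Module.Finite S Z]
    (y : S) (hy : y ∈ maximalIdeal S) (hinj : Function.Injective (smulMap y Z))
    (p : Ideal S) (hp : IsAsc S Z p) :
    ∃ p', p ≤ p' ∧ y ∈ p' ∧ IsAsc S (Z ⧸ LinearMap.range (smulMap y Z)) p' := by
  obtain ⟨hpp, z, hz⟩ := hp
  let N : Submodule S Z :=
    { carrier := {z | ∀ a ∈ p, a • z = 0}
      add_mem' := fun {z z'} h h' a ha => by rw [smul_add, h a ha, h' a ha, add_zero]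
      zero_mem' := fun a _ => smul_zero a
      smul_mem' := fun c z h a ha => by rw [smul_comm, h a ha, smul_zero] }
  have hN : N ≠ ⊥ := by
    intro h
    have hz0 : z ∈ N := fun a ha => (hz a).1 ha
    rw [h, Submodule.mem_bot] at hz0
    exact hpp.ne_top ((Ideal.eq_top_iff_one _).2 ((hz 1).2 (by rw [hz0, smul_zero])))
  have : ∃ w ∈ N, w ∉ LinearMap.range (smulMap y Z) := by
    by_contra! hcon
    refine hN (eq_bot_of_smulMap N y hy fun w hw => ?_)
    obtain ⟨v, rfl⟩ := hcon w hw
    refine ⟨v, fun a ha => hinj ?_, rfl⟩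
    rw [map_smul, map_zero]
    exact hw a ha
  obtain ⟨w, hw, hw'⟩ := this
  have hne : (Submodule.Quotient.mk w : Z ⧸ LinearMap.range (smulMap y Z)) ≠ 0 := by
    rwa [Ne, Submodule.Quotient.mk_eq_zero]
  obtain ⟨p', hp', h⟩ := exists_isAsc_of_ne_zero (S := S) _ hne
  refine ⟨p', fun a ha => h a ?_, h y ?_, hp'⟩
  · rw [← Submodule.Quotient.mk_smul, hw a ha, Submodule.Quotient.mk_zero]
  · rw [← Submodule.Quotient.mk_smul, Submodule.Quotient.mk_eq_zero]
    exact ⟨w, rfl⟩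

end Chi

section Chi

variable {S : Type*} [CommRing S] [IsLocalRing S] [IsNoetherianRing S]
variable {ι : ℕ → Type} [∀ j, Fintype (ι j)]
variable {d : ∀ j, Matrix (ι (j + 1)) (ι j) S}

omit [IsLocalRing S] [IsNoetherianRing S] in
theorem ell_ker_eq_ell_coker {Z : Type*} [AddCommGroup Z] [Module S Z] (y : S)
    (hZ : IsFiniteLength S Z) :
    ell S (LinearMap.ker (smulMap y Z)) = ell S (Z ⧸ LinearMap.range (smulMap y Z)) := by
  have e1 := ell_add_of_exact (LinearMap.ker (smulMap y Z)).subtype (smulMap y Z).rangeRestrict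
    (Submodule.injective_subtype _) (LinearMap.surjective_rangeRestrict _) (by
      intro z
      rw [Subtype.ext_iff]
      simp [LinearMap.mem_ker]) hZ
  have e2 := ell_add_of_exact (LinearMap.range (smulMap y Z)).subtype
    (LinearMap.range (smulMap y Z)).mkQ
    (Submodule.injective_subtype _) (Submodule.mkQ_surjective _)
      (LinearMap.exact_subtype_mkQ _) hZ
  linarith

omit [IsNoetherianRing S] in
theorem chiGood_of_subsingleton (K : ℕ) (B C : Type u) [AddCommGroup B] [Module S B]
    [AddCommGroup C] [Module S C] [Subsingleton B] [Subsingleton C] : ChiGood d K B C := by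
  have h0 : ∀ n, altSum (fun j => ell S (hq d C j)) n = 0 := by
    intro n
    induction n with
    | zero => rfl
    | succ n ih =>
      have := subsingleton_hq (S := S) d (B := C) n
      rw [altSum, ih, ell_of_subsingleton, sub_zero]
  have hB := fun j => subsingleton_hq (S := S) d (B := B) j
  have hasc : ∀ p j, ¬ IsAsc S (hq d B j) p := by
    rintro p j ⟨hp, z, hz⟩
    exact hp.ne_top ((Ideal.eq_top_iff_one _).2 ((hz 1).2 ((hB j).elim _ _)))
  exact ⟨(h0 _).ge, fun _ => ⟨hasc _ _, fun p hp => absurd hp (hasc _ _),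
    fun _ j _ => subsingleton_hq d j⟩⟩

omit [IsLocalRing S] [IsNoetherianRing S] in
theorem ker_smulMap_hq_zero [IsEmpty (ι 0)] {B : Type u} [AddCommGroup B] [Module S B] (y : S)
    (hy : IsSMulRegular B y) : Subsingleton (LinearMap.ker (smulMap y (hq d B 0))) := by
  refine ⟨fun a b => ?_⟩
  have key : ∀ a : LinearMap.ker (smulMap y (hq d B 0)), a = 0 := by
    rintro ⟨z, hz⟩
    obtain ⟨x, hx, rfl⟩ := Hm.exists_mk z
    rw [LinearMap.mem_ker, smulMap_apply, ← Hm.mk_smul, Hm.mk_eq_zero] at hz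
    obtain ⟨w, hw⟩ := hz
    have hw0 : w = 0 := funext fun i => isEmptyElim i
    rw [hw0, map_zero] at hw
    have hx0 : x = 0 := by
      funext i
      apply hy
      have := congrFun hw i
      simpa using this.symm
    have : Hm.mk (fun j => mv (d j) B) 0 x hx = 0 :=
      Hm.mk_eq_zero.2 ⟨0, by rw [map_zero, hx0]⟩
    exact Subtype.ext this
  rw [key a, key b]

theorem chiGood_singleton (hd : ∀ j, d (j + 1) * d j = 0) [IsEmpty (ι 0)] (K : ℕ)
    {B : Type u} [AddCommGroup B] [Module S B] [Module.Finite S B] (y : S)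
    (hy : y ∈ maximalIdeal S) (hreg : IsSMulRegular B y)
    (h1 : ∀ j < K, IsFiniteLength S (hq d B j))
    (h2 : ∀ j ≤ K, IsFiniteLength S (hq d (QuotSMulTop y B) j)) :
    ChiGood d K B (QuotSMulTop y B) := by
  choose f g hf hg hfg hfe using hq_smul_exact d hd y hreg
  have hcok : ∀ j ≤ K, IsFiniteLength S (hq d B j ⧸ LinearMap.range (smulMap y (hq d B j))) :=
    fun j hj => (h2 j hj).of_injective (hf j)
  have hker : ∀ j ≤ K, IsFiniteLength S (LinearMap.ker (smulMap y (hq d B (j + 1)))) :=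
    fun j hj => (h2 j hj).of_surjective (hg j)
  have hsum : ∀ j ≤ K, ell S (hq d (QuotSMulTop y B) j) =
      ell S (hq d B j ⧸ LinearMap.range (smulMap y (hq d B j))) +
      ell S (LinearMap.ker (smulMap y (hq d B (j + 1)))) :=
    fun j hj => ell_add_of_exact _ _ (hf j) (hg j) (hfg j) (h2 j hj)
  have h0 := ker_smulMap_hq_zero (d := d) y hreg
  have key : ∀ n ≤ K, altSum (fun j => ell S (hq d (QuotSMulTop y B) j)) n =
      ell S (LinearMap.ker (smulMap y (hq d B n))) := by
    intro n hn
    induction n with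
    | zero => rw [ell_of_subsingleton]; rfl
    | succ n ih =>
      rw [altSum, ih (by omega), hsum n (by omega), ell_ker_eq_ell_coker y (h1 n (by omega))]
      ring
  have hkerK : IsFiniteLength S (LinearMap.ker (smulMap y (hq d B K))) := by
    rcases K with _ | K
    · exact .of_subsingleton
    · exact hker K (Nat.le_succ K)
  obtain ⟨hle, heq⟩ := ell_ker_le_ell_coker y hy hkerK (hcok K le_rfl)
  have htot : altSum (fun j => ell S (hq d (QuotSMulTop y B) j)) (K + 1) =
      (ell S (hq d B K ⧸ LinearMap.range (smulMap y (hq d B K))) -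
        ell S (LinearMap.ker (smulMap y (hq d B K)))) +
      ell S (LinearMap.ker (smulMap y (hq d B (K + 1)))) := by
    rw [altSum, key K le_rfl, hsum K le_rfl]
    ring
  have hnn := ell_nonneg (S := S) (LinearMap.ker (smulMap y (hq d B (K + 1))))
  refine ⟨by rw [htot]; linarith, fun hz => ?_⟩
  rw [htot] at hz
  have hk0 : ell S (LinearMap.ker (smulMap y (hq d B (K + 1)))) = 0 := by linarith
  have hKfl : IsFiniteLength S (hq d B K) := heq (by linarith)
  rw [ell_eq_zero_iff (hker K le_rfl)] at hk0
  have hasc : ¬ IsAsc S (hq d B (K + 1)) (maximalIdeal S) := by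
    rintro ⟨hp, z, hz⟩
    have : z = 0 := congrArg Subtype.val (hk0.elim ⟨z, (hz y).1 hy⟩ 0)
    exact hp.ne_top ((Ideal.eq_top_iff_one _).2 ((hz 1).2 (by rw [this, smul_zero])))
  refine ⟨hasc, fun p hp hpp hsupp => ?_, fun hB j hj => ?_⟩
  · have := eq_maximalIdeal_of_mem_support hKfl _ hsupp
    exact hasc (this ▸ hp)
  · have hk : Subsingleton (LinearMap.ker (smulMap y (hq d B (j + 1)))) := by
      rcases Nat.lt_or_ge j K with h | h
      · have := hB (j + 1) h
        infer_instance
      · obtain rfl : j = K := le_antisymm hj h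
        exact hk0
    have hc : Subsingleton (hq d B j ⧸ LinearMap.range (smulMap y (hq d B j))) := by
      have := hB j hj
      infer_instance
    rw [← ell_eq_zero_iff (h2 j hj), hsum j hj, ell_of_subsingleton, ell_of_subsingleton,
      add_zero]

theorem isFiniteLength_ker_smulMap {Z : Type u} [AddCommGroup Z] [Module S Z] [Module.Finite S Z]
    (y : S) (h : ∀ p, IsAsc S Z p → y ∈ p → p = maximalIdeal S) :
    IsFiniteLength S (LinearMap.ker (smulMap y Z)) := by
  refine isFiniteLength_of_isAsc fun p hp => h p (hp.of_injective _
    (Submodule.injective_subtype _)) ?_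
  obtain ⟨_, z, hz⟩ := hp
  exact (hz y).2 (Subtype.ext z.2)

theorem chiGood_step (hd : ∀ j, d (j + 1) * d j = 0) (K : ℕ) (htop : d (K + 2) = 0)
    {B C : Type u} [AddCommGroup B] [Module S B] [Module.Finite S B] [AddCommGroup C] [Module S C]
    (y : S) (hy : y ∈ maximalIdeal S) (hreg : IsSMulRegular B y)
    (hasc : ∀ p, IsAsc S (hq d B (K + 1)) p → y ∈ p → p = maximalIdeal S)
    (h : ChiGood d K (QuotSMulTop y B) C) : ChiGood d K B C := by
  refine ⟨h.1, fun h0 => ?_⟩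
  obtain ⟨ha, hb, hc⟩ := h.2 h0
  choose f g hf hg hfg hfe using hq_smul_exact d hd y hreg
  have hfK : Function.Surjective (f (K + 1)) := by
    intro z
    obtain ⟨x, hx, rfl⟩ := Hm.exists_mk z
    choose w hw using fun i => Submodule.mkQ_surjective _ (x i)
    refine ⟨Submodule.Quotient.mk (Hm.mk _ _ w (by rw [htop, mv_zero])), ?_⟩
    rw [hfe, Hm.map_mk, Hm.mk_eq_mk]
    refine ⟨0, ?_⟩
    rw [map_zero, eq_comm, sub_eq_zero]
    exact funext hw
  let e : (hq d B (K + 1) ⧸ LinearMap.range (smulMap y (hq d B (K + 1)))) ≃ₗ[S]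
      hq d (QuotSMulTop y B) (K + 1) := LinearEquiv.ofBijective (f (K + 1)) ⟨hf _, hfK⟩
  obtain ⟨hinj, hm⟩ := smul_injective_of_not_isAsc y hy (isFiniteLength_ker_smulMap y hasc)
    (fun h => ha (h.of_injective e.toLinearMap e.injective))
  refine ⟨hm, fun p hp hpp hsupp => ?_, fun hB => hc fun j hj => ?_⟩
  · obtain ⟨p', hpp', hyp', hp'⟩ := exists_isAsc_quotient y hy hinj p hp
    refine hb p' (hp'.of_injective e.toLinearMap e.injective) hp'.1 ?_
    refine Module.support_subset_of_injective (f K) (hf K) ?_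
    rw [range_smulMap]
    have := Module.support_quotSMulTop (R := S) (M := hq d B K) y
    refine this ▸ ⟨Module.mem_support_mono ?_ hsupp, by simpa using hyp'⟩
    exact hpp'
  · have hk : Subsingleton (LinearMap.ker (smulMap y (hq d B (j + 1)))) := by
      rcases Nat.lt_or_ge j K with h | h
      · have := hB (j + 1) h
        infer_instance
      · obtain rfl : j = K := le_antisymm hj h
        rw [LinearMap.ker_eq_bot.2 hinj]
        infer_instance
    have := hB j hj
    refine ⟨fun a b => ?_⟩
    have key : ∀ a : hq d (QuotSMulTop y B) j, a = 0 := fun a => by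
      obtain ⟨w, rfl⟩ := (hfg j a).1 (Subsingleton.elim _ _)
      rw [Subsingleton.elim w 0, map_zero]
    rw [key a, key b]

theorem chiGood (hd : ∀ j, d (j + 1) * d j = 0) [IsEmpty (ι 0)] (K : ℕ) (htop : d (K + 2) = 0)
    (n : ℕ) :
    ∀ (l : List S), l.length = n + 1 → (∀ a ∈ l, a ∈ maximalIdeal S) →
      ∀ (B : Type u) [AddCommGroup B] [Module S B] [Module.Finite S B], IsWeaklyRegular B l →
      (∀ j < K, IsFiniteLength S (hq d B j)) →
      (∀ j ≤ K, IsFiniteLength S (hq d (B ⧸ (Ideal.ofList l • ⊤ : Submodule S B)) j)) →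
      ChiGood d K B (B ⧸ (Ideal.ofList l • ⊤ : Submodule S B)) := by
  induction n with
  | zero =>
    intro l hlen hl B _ _ _ hB h1 h2
    obtain ⟨y, rfl⟩ := List.length_eq_one_iff.1 hlen
    have e : (B ⧸ (Ideal.ofList [y] • ⊤ : Submodule S B)) ≃ₗ[S] QuotSMulTop y B :=
      Submodule.quotEquivOfEq _ _ (by
        rw [Ideal.ofList_singleton, Submodule.ideal_span_singleton_smul])
    refine ChiGood.congr (chiGood_singleton hd K y (hl y (by simp))
      ((isWeaklyRegular_singleton_iff _ _).1 hB) h1 fun j hj => ?_) e.symm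
    exact (h2 j hj).of_injective (hqCongr d e.symm j).injective
  | succ n ih =>
    intro l hlen hl B _ _ _ hB h1 h2
    rcases subsingleton_or_nontrivial B with hsub | hnt
    · exact chiGood_of_subsingleton _ _ _
    set J := Ideal.ofList l with hJ
    have hJm : J ≤ maximalIdeal S := Ideal.span_le.2 hl
    obtain ⟨y, l', hyJ, hyb, hlen', hspan, hreg⟩ : ∃ y l', y ∈ J ∧
        (∀ p, IsAsc S (hq d B (K + 1)) p ∨ IsAsc S (hq d B K) p → y ∈ p →
          p = maximalIdeal S) ∧ l'.length = n + 1 ∧ Ideal.ofList (y :: l') = J ∧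
        IsWeaklyRegular B (y :: l') := by
      obtain ⟨a, t, rfl⟩ : ∃ a t, l = a :: t := List.exists_cons_of_length_eq_add_one hlen
      let s : Set (Ideal S) := insert (maximalIdeal S * J)
        {p | (IsAsc S (hq d B (K + 1)) p ∨ IsAsc S (hq d B K) p) ∧ p ≠ maximalIdeal S}
      have hs : s.Finite := by
        refine Set.Finite.insert _ (Set.Finite.subset (Set.Finite.union
          (associatedPrimes.finite S (hq d B (K + 1))) (associatedPrimes.finite S (hq d B K))) ?_)
        rintro p ⟨hp | hp, -⟩
        · exact Or.inl ((isAsc_iff p).1 hp)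
        · exact Or.inr ((isAsc_iff p).1 hp)
      have hnot : ¬ ((J : Set S) ⊆ ⋃ p ∈ s, ((fun p => p) p : Ideal S)) := by
        rw [Ideal.subset_union_prime_finite hs (maximalIdeal S * J) (maximalIdeal S * J)]
        · rintro ⟨p, hp | ⟨hp, hpm⟩, hle⟩
          · subst hp
            have hJ0 : J = ⊥ := by
              refine Submodule.eq_bot_of_le_smul_of_le_jacobson_bot (maximalIdeal S) J
                (IsNoetherian.noetherian J) hle ?_
              rw [IsLocalRing.jacobson_eq_maximalIdeal _ bot_ne_top]
            have ha : a ∈ J := Ideal.subset_span (by simp)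
            rw [hJ0, Ideal.mem_bot] at ha
            subst ha
            exact not_subsingleton B
              ((isWeaklyRegular_cons_iff _ _ _).1 hB).1.subsingleton
          · rcases hp with hp | hp
            · exact hpm (eq_maximalIdeal_of_isAsc_hq hd a t B hB K (h2 K le_rfl) p hle hp)
            · exact hpm (eq_maximalIdeal_of_mem_support_hq hd (a :: t) B hB K (h2 K le_rfl)
                ⟨p, hp.1⟩ hle hp.mem_support)
        · rintro p (hp | ⟨hp | hp, -⟩) hne -
          · exact absurd hp hne
          · exact hp.1
          · exact hp.1
      obtain ⟨y, hyJ, hy⟩ := Set.not_subset.1 hnot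
      simp only [Set.mem_iUnion, not_exists] at hy
      obtain ⟨l', hlen', hspan, hreg⟩ := exists_isWeaklyRegular_cons (a :: t) B y hl hB hyJ
        (hy _ (Set.mem_insert _ _))
      refine ⟨y, l', hyJ, fun p hp hyp => ?_, by omega, hspan, hreg⟩
      by_contra hne
      exact hy p (Set.mem_insert_of_mem _ ⟨hp, hne⟩) hyp
    rw [← hspan] at h2 ⊢
    have e := Submodule.quotOfListConsSMulTopEquivQuotSMulTopInner B y l'
    have hreg' := (isWeaklyRegular_cons_iff _ _ _).1 hreg
    refine ChiGood.congr (chiGood_step hd K htop y (hJm hyJ) hreg'.1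
      (fun p hp => hyb p (Or.inl hp)) (ih l' hlen' ?_ (QuotSMulTop y B) hreg'.2 ?_ ?_)) e.symm
    · intro x hx
      apply hJm
      rw [← hspan]
      exact Ideal.subset_span (List.mem_cons_of_mem _ hx)
    · intro j hj
      obtain ⟨f, g, hf, hg, hfg, -⟩ := hq_smul_exact d hd y hreg'.1 j
      refine isFiniteLength_of_exact f g hfg
        ((h1 j hj).of_surjective (Submodule.mkQ_surjective _)) ?_
      rcases Nat.lt_or_ge (j + 1) K with h | h
      · exact (h1 _ h).of_injective (Submodule.injective_subtype _)
      · obtain rfl : j + 1 = K := by omega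
        exact isFiniteLength_ker_smulMap y fun p hp => hyb p (Or.inr hp)
    · intro j hj
      exact (h2 j hj).of_injective (hqCongr d e.symm j).injective

end Chi

section Flatness

variable {Q : Type u} [CommRing Q]

/-- Tensoring with `B` preserves injections of finitely generated modules killed by `I`. -/
def Fl (I : Ideal Q) (B : Type v) [AddCommGroup B] [Module Q B] : Prop :=
  ∀ (E' E : Type u) [AddCommGroup E'] [Module Q E'] [AddCommGroup E] [Module Q E]
    [Module.Finite Q E'] [Module.Finite Q E] (f : E' →ₗ[Q] E),
    Function.Injective f → (∀ a ∈ I, ∀ e : E, a • e = 0) → Function.Injective (f.lTensor B)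

variable {B : Type v} [AddCommGroup B] [Module Q B]

theorem fl_of_isMaximal (I : Ideal Q) (hI : I.IsMaximal) : Fl I B := by
  intro E' E _ _ _ _ _ _ f hf hE
  have hE' : Module.IsTorsionBySet Q E I := fun e a => hE a a.2 e
  have hss : IsSemisimpleModule Q E := by
    let _ := hE'.module
    let _ := Ideal.Quotient.field I
    exact hE'.isSemisimpleModule_iff.1 inferInstance
  obtain ⟨r, hr⟩ := IsSemisimpleModule.extension_property f hf LinearMap.id
  have : (r.lTensor B).comp (f.lTensor B) = LinearMap.id := by
    rw [← LinearMap.lTensor_comp, hr, LinearMap.lTensor_id]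
  exact Function.LeftInverse.injective (g := r.lTensor B) fun x => DFunLike.congr_fun this x

theorem Fl.flat (h : Fl (⊥ : Ideal Q) B) [IsNoetherianRing Q] : Module.Flat Q B := by
  refine Module.Flat.iff_lTensor_injective.2 fun I _ => h _ _ _ (Submodule.injective_subtype _) ?_
  intro a ha e
  rw [(Submodule.mem_bot Q).1 ha, zero_smul]

/-- It is enough to test submodules of free modules over the quotient ring. -/
theorem fl_of_pi (I : Ideal Q)
    (h : ∀ (n : ℕ) (K : Submodule Q (Fin n → Q ⧸ I)), Function.Injective (K.subtype.lTensor B)) :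
    Fl I B := by
  intro E' E _ _ _ _ _ _ f hf hE
  obtain ⟨n, g, hg⟩ : ∃ (n : ℕ) (g : (Fin n → Q ⧸ I) →ₗ[Q] E), Function.Surjective g := by
    obtain ⟨n, g, hg⟩ := Module.Finite.exists_fin' Q E
    let e : Fin n → (Q ⧸ I) →ₗ[Q] E := fun i =>
      Submodule.liftQ I (LinearMap.toSpanSingleton Q E (g (Pi.single i 1)))
        (fun a ha => hE a ha _)
    refine ⟨n, LinearMap.lsum Q (fun _ => Q ⧸ I) Q e, fun x => ?_⟩
    obtain ⟨y, rfl⟩ := hg x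
    refine ⟨fun i => Submodule.Quotient.mk (y i), ?_⟩
    rw [LinearMap.lsum_apply]
    simp only [LinearMap.coe_sum, Finset.sum_apply, LinearMap.coe_comp, Function.comp_apply,
      LinearMap.proj_apply]
    have : ∀ i, e i (Submodule.Quotient.mk (y i)) = y i • g (Pi.single i 1) := fun i => rfl
    simp only [this, ← map_smul, ← map_sum]
    congr 1
    ext j
    simp [Finset.sum_apply, Pi.single_apply]
  let K : Submodule Q (Fin n → Q ⧸ I) := (LinearMap.range f).comap g
  let K₀ : Submodule Q (Fin n → Q ⧸ I) := LinearMap.ker g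
  let e' := LinearEquiv.ofInjective f hf
  let q : K →ₗ[Q] E' := e'.symm.toLinearMap.comp
    ((g.comp K.subtype).codRestrict (LinearMap.range f) (fun x => x.2))
  have hfq : ∀ x : K, f (q x) = g x := fun x => by
    have := e'.apply_symm_apply ⟨g x, x.2⟩
    exact congrArg Subtype.val this
  have hq : Function.Surjective q := by
    intro x
    obtain ⟨y, hy⟩ := hg (f x)
    refine ⟨⟨y, ⟨x, hy.symm⟩⟩, hf ?_⟩
    rw [hfq]
    exact hy
  have hK₀ : K₀ ≤ K := fun x hx => ⟨0, by rw [map_zero]; exact (LinearMap.mem_ker.1 hx).symm⟩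
  let i := Submodule.inclusion hK₀
  have hqi : q.comp i = 0 := by
    ext x
    apply hf
    rw [LinearMap.comp_apply, hfq]
    rw [LinearMap.zero_apply, map_zero]
    exact (x.2 : g x = 0)
  have hex : Function.Exact (K₀.subtype.lTensor B) (g.lTensor B) :=
    lTensor_exact B (LinearMap.exact_subtype_ker_map g) hg
  rw [injective_iff_map_eq_zero]
  intro b hb
  obtain ⟨c, rfl⟩ := LinearMap.lTensor_surjective B hq b
  have h1 : g.lTensor B (K.subtype.lTensor B c) = 0 := by
    rw [← LinearMap.lTensor_comp_apply] at hb ⊢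
    have : g.comp K.subtype = f.comp q := LinearMap.ext fun x => (hfq x).symm
    rw [this, hb]
  obtain ⟨t, ht⟩ := (hex _).1 h1
  have h2 : c = i.lTensor B t := by
    apply h n K
    rw [← ht, ← LinearMap.lTensor_comp_apply]
    rfl
  rw [h2, ← LinearMap.lTensor_comp_apply, hqi]
  simp

end Flatness

section LocalStep

variable {Q : Type u} [CommRing Q] [IsNoetherianRing Q]
variable {S : Type w} [CommRing S] [IsLocalRing S] [IsNoetherianRing S] [Algebra Q S]
variable {B : Type v} [AddCommGroup B] [Module Q B] [Module S B] [IsScalarTower Q S B]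
  [Module.Finite S B]

omit [IsNoetherianRing Q] [IsLocalRing S] [IsNoetherianRing S] in
theorem finite_tensor (E : Type u) [AddCommGroup E] [Module Q E] [Module.Finite Q E] :
    Module.Finite S (B ⊗[Q] E) := by
  obtain ⟨n, g, hg⟩ := Module.Finite.exists_fin' Q E
  have : Module.Finite S (B ⊗[Q] (Fin n → Q)) :=
    Module.Finite.equiv (TensorProduct.piScalarRight Q S B (Fin n)).symm
  exact Module.Finite.of_surjective (TensorProduct.AlgebraTensorModule.lTensor S B g)
    (LinearMap.lTensor_surjective B hg)

theorem fl_of_regular (I : Ideal Q) (w : Q) (hw : algebraMap Q S w ∈ maximalIdeal S)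
    (hwQ : IsSMulRegular (Q ⧸ I) w) (hwB : IsSMulRegular (B ⊗[Q] (Q ⧸ I)) w)
    (h : Fl (I ⊔ Ideal.span {w}) B) : Fl I B := by
  refine fl_of_pi I fun n => ?_
  have hFw : ∀ x : Fin n → Q ⧸ I, w • x = 0 → x = 0 := fun x hx => funext fun i =>
    hwQ ((congrFun hx i).trans (smul_zero w).symm)
  have hFB : ∀ x : B ⊗[Q] (Fin n → Q ⧸ I), w • x = 0 → x = 0 := by
    intro x hx
    apply (TensorProduct.piRight Q Q B (fun _ : Fin n => Q ⧸ I)).injective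
    rw [map_zero]
    refine funext fun i => hwB ?_
    have := congrArg (fun y => TensorProduct.piRight Q Q B (fun _ : Fin n => Q ⧸ I) y i) hx
    rw [map_smul, map_zero] at this
    exact this.trans (smul_zero w).symm
  have hFI : ∀ a ∈ I, ∀ x : Fin n → Q ⧸ I, a • x = 0 := by
    intro a ha x
    funext i
    obtain ⟨c, hc⟩ := Ideal.Quotient.mk_surjective (x i)
    rw [Pi.smul_apply, Pi.zero_apply, ← hc, Algebra.smul_def, Ideal.Quotient.algebraMap_eq,
      Ideal.Quotient.eq_zero_iff_mem.2 ha, zero_mul]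
  intro K
  induction K using (wellFounded_gt (α := Submodule Q (Fin n → Q ⧸ I))).induction with
  | _ K ih =>
  let K' : Submodule Q (Fin n → Q ⧸ I) := K.comap (smulMap w _)
  have hKK' : K ≤ K' := fun x hx => K.smul_mem w hx
  rcases hKK'.eq_or_lt with heq | hlt
  · -- `K` is saturated with respect to `w`
    let F := Fin n → Q ⧸ I
    let W : Submodule Q F := LinearMap.range (smulMap w F)
    let WK : Submodule Q K := LinearMap.range (smulMap w K)
    let j : (K ⧸ WK) →ₗ[Q] F ⧸ W := Submodule.mapQ WK W K.subtype (by
      rintro _ ⟨x, rfl⟩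
      exact ⟨x, rfl⟩)
    have hj : Function.Injective j := by
      rw [injective_iff_map_eq_zero]
      intro a ha
      obtain ⟨⟨x, hx⟩, rfl⟩ := Submodule.Quotient.mk_surjective _ a
      rw [Submodule.mapQ_apply, Submodule.Quotient.mk_eq_zero] at ha
      obtain ⟨y, hy⟩ := ha
      have hy' : w • y = x := hy
      have hyK : y ∈ K := heq ▸ (show w • y ∈ K from hy' ▸ hx)
      rw [Submodule.Quotient.mk_eq_zero]
      exact ⟨⟨y, hyK⟩, Subtype.ext hy'⟩
    have hjB : Function.Injective (j.lTensor B) := by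
      refine h _ _ j hj fun a ha e => ?_
      obtain ⟨x, rfl⟩ := Submodule.Quotient.mk_surjective _ e
      obtain ⟨b, hb, c, hc, rfl⟩ := Submodule.mem_sup.1 ha
      obtain ⟨r, rfl⟩ := Ideal.mem_span_singleton'.1 hc
      rw [← Submodule.Quotient.mk_smul, Submodule.Quotient.mk_eq_zero, add_smul, hFI b hb,
        zero_add, mul_smul]
      exact W.smul_mem r ⟨x, rfl⟩
    have hexK : Function.Exact ((smulMap w K).lTensor B) (WK.mkQ.lTensor B) :=
      lTensor_exact B (LinearMap.exact_map_mkQ_range _) (Submodule.mkQ_surjective _)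
    let T : Submodule S (B ⊗[Q] K) :=
      LinearMap.ker (TensorProduct.AlgebraTensorModule.lTensor S B K.subtype)
    have hsm : ∀ x : B ⊗[Q] K, (smulMap w K).lTensor B x = w • x := by
      intro x
      have : smulMap w K = w • LinearMap.id := rfl
      rw [this, LinearMap.lTensor_smul, LinearMap.lTensor_id]
      rfl
    have : Module.Finite S (B ⊗[Q] K) := finite_tensor (Q := Q) (S := S) (B := B) K
    have hT : T = ⊥ := by
      refine eq_bot_of_smulMap T _ hw fun t ht => ?_
      have ht' : K.subtype.lTensor B t = 0 := ht
      have h1 : WK.mkQ.lTensor B t = 0 := by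
        apply hjB
        rw [← LinearMap.lTensor_comp_apply, map_zero]
        have : j.comp WK.mkQ = W.mkQ.comp K.subtype := by ext x; rfl
        rw [this, LinearMap.lTensor_comp_apply, ht', map_zero]
      obtain ⟨s, rfl⟩ := (hexK t).1 h1
      rw [hsm] at ht' ⊢
      refine ⟨s, hFB _ ?_, algebraMap_smul S w s⟩
      rw [← ht', map_smul]
      rfl
    rw [injective_iff_map_eq_zero]
    intro t ht
    have : t ∈ T := ht
    rwa [hT, Submodule.mem_bot] at this
  · have hK' := ih K' hlt
    let i : K →ₗ[Q] K' := Submodule.inclusion hKK'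
    let μ : K' →ₗ[Q] K := ((smulMap w _).comp K'.subtype).codRestrict K (fun x => x.2)
    let V := LinearMap.range μ
    let V' := LinearMap.range (smulMap w K')
    let j : (K ⧸ V) →ₗ[Q] (K' ⧸ V') := Submodule.mapQ V V' i (by
      rintro _ ⟨x, rfl⟩
      exact ⟨x, rfl⟩)
    have hj : Function.Injective j := by
      rw [injective_iff_map_eq_zero]
      intro a ha
      obtain ⟨x, rfl⟩ := Submodule.Quotient.mk_surjective _ a
      rw [Submodule.mapQ_apply, Submodule.Quotient.mk_eq_zero] at ha
      obtain ⟨y, hy⟩ := ha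
      rw [Submodule.Quotient.mk_eq_zero]
      have h2 : w • (y : Fin n → Q ⧸ I) = x := congrArg Subtype.val hy
      exact ⟨y, Subtype.ext h2⟩
    have hjB : Function.Injective (j.lTensor B) := by
      refine h _ _ j hj fun a ha e => ?_
      obtain ⟨x, rfl⟩ := Submodule.Quotient.mk_surjective _ e
      obtain ⟨b, hb, c, hc, rfl⟩ := Submodule.mem_sup.1 ha
      obtain ⟨r, rfl⟩ := Ideal.mem_span_singleton'.1 hc
      have hbx : b • x = 0 := Subtype.ext (hFI b hb x)
      rw [← Submodule.Quotient.mk_smul, Submodule.Quotient.mk_eq_zero, add_smul, hbx,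
        zero_add, mul_smul]
      exact V'.smul_mem r ⟨x, rfl⟩
    have hexK : Function.Exact (μ.lTensor B) (V.mkQ.lTensor B) :=
      lTensor_exact B (LinearMap.exact_map_mkQ_range _) (Submodule.mkQ_surjective _)
    rw [injective_iff_map_eq_zero]
    intro t ht
    have hti : i.lTensor B t = 0 := by
      apply hK'
      rw [← LinearMap.lTensor_comp_apply, map_zero]
      exact ht
    have h1 : V.mkQ.lTensor B t = 0 := by
      apply hjB
      rw [← LinearMap.lTensor_comp_apply, map_zero]
      have : j.comp V.mkQ = V'.mkQ.comp i := by ext x; rfl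
      rw [this, LinearMap.lTensor_comp_apply, hti, map_zero]
    obtain ⟨s, rfl⟩ := (hexK t).1 h1
    have hs : s = 0 := by
      apply hK'
      rw [map_zero]
      apply hFB
      rw [← ht, ← LinearMap.lTensor_comp_apply]
      have : K.subtype.comp μ = w • K'.subtype := by ext x; rfl
      rw [this, LinearMap.lTensor_smul]
      rfl
    rw [hs, map_zero]

end LocalStep

section Chain

variable {Q : Type u} [CommRing Q] [IsNoetherianRing Q]
variable {S : Type w} [CommRing S] [IsLocalRing S] [IsNoetherianRing S] [Algebra Q S]
variable {B : Type v} [AddCommGroup B] [Module Q B] [Module S B] [IsScalarTower Q S B]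
  [Module.Finite S B]

theorem fl_of_chain (l : List Q) (hl : ∀ a ∈ l, algebraMap Q S a ∈ maximalIdeal S)
    (hmax : (Ideal.ofList l).IsMaximal) (k : ℕ) (hk : k ≤ l.length)
    (hQ : ∀ (i : ℕ) (h : i < l.length), IsSMulRegular (Q ⧸ Ideal.ofList (l.take i)) l[i])
    (hB : ∀ (i : ℕ) (h : i < l.length), k ≤ i →
      IsSMulRegular (B ⧸ (Ideal.ofList (l.take i) • ⊤ : Submodule Q B)) l[i]) :
    Fl (Ideal.ofList (l.take k)) B := by
  obtain ⟨n, hn⟩ := Nat.le.dest hk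
  induction n generalizing k with
  | zero =>
    rw [Nat.add_zero] at hn
    rw [hn, List.take_length]
    exact fl_of_isMaximal _ hmax
  | succ n ih =>
    have hk' : k < l.length := by omega
    refine fl_of_regular (S := S) _ l[k] (hl _ (List.getElem_mem _)) (hQ k hk') ?_ ?_
    · exact (LinearEquiv.isSMulRegular_congr
        (TensorProduct.tensorQuotEquivQuotSMul B (Ideal.ofList (l.take k))) _).2 (hB k hk' le_rfl)
    · have := ih (k + 1) hk' (fun i h h' => hB i h (by omega)) (by omega)
      rwa [← List.take_concat_get' _ _ hk', Ideal.ofList_append, Ideal.ofList_singleton] at this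

omit [IsNoetherianRing Q] in
theorem isSMulRegular_of_isWeaklyRegular {l : List Q} (h : IsWeaklyRegular Q l) (i : ℕ)
    (hi : i < l.length) : IsSMulRegular (Q ⧸ Ideal.ofList (l.take i)) l[i] := by
  have := h.regular_mod_prev i hi
  have e : (Ideal.ofList (l.take i) • ⊤ : Submodule Q Q) = Ideal.ofList (l.take i) := by
    rw [smul_eq_mul, Ideal.mul_top]
  rwa [e] at this

theorem fl_bot (l : List Q) (hl : ∀ a ∈ l, algebraMap Q S a ∈ maximalIdeal S)
    (hmax : (Ideal.ofList l).IsMaximal) (hQ : IsWeaklyRegular Q l)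
    (hB : IsWeaklyRegular B (l.map (algebraMap Q S))) : Fl (⊥ : Ideal Q) B := by
  have hB' := (isWeaklyRegular_map_algebraMap_iff (R := Q) S B l).1 hB
  have := fl_of_chain (S := S) (B := B) l hl hmax 0 (Nat.zero_le _)
    (fun i hi => isSMulRegular_of_isWeaklyRegular hQ i hi) (fun i hi _ => hB'.regular_mod_prev i hi)
  rwa [List.take_zero, Ideal.ofList_nil] at this

theorem fl_span (w : Q) (l : List Q) (hl : ∀ a ∈ w :: l, algebraMap Q S a ∈ maximalIdeal S)
    (hmax : (Ideal.ofList (w :: l)).IsMaximal) (hQ : IsWeaklyRegular Q (w :: l))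
    (hB : IsWeaklyRegular B (l.map (algebraMap Q S))) (hw : ∀ b : B, w • b = 0) :
    Fl (Ideal.span {w}) B := by
  have hB' := (isWeaklyRegular_map_algebraMap_iff (R := Q) S B l).1 hB
  have := fl_of_chain (S := S) (B := B) (w :: l) hl hmax 1 (by simp)
    (fun i hi => isSMulRegular_of_isWeaklyRegular hQ i hi) (fun i hi h1 => by
      obtain ⟨i, rfl⟩ : ∃ j, i = j + 1 := ⟨i - 1, by omega⟩
      have h2 := hB'.regular_mod_prev i (by simpa using hi)
      have e : (Ideal.ofList ((w :: l).take (i + 1)) • ⊤ : Submodule Q B) =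
          Ideal.ofList (l.take i) • ⊤ := by
        rw [List.take_succ_cons, Ideal.ofList_cons, Submodule.sup_smul]
        refine sup_eq_right.2 (le_trans (Submodule.smul_le.2 fun a ha b _ => ?_) bot_le)
        obtain ⟨c, rfl⟩ := Ideal.mem_span_singleton'.1 ha
        rw [Submodule.mem_bot, mul_smul, hw, smul_zero]
      rw [e]
      exact h2)
  simpa using this

end Chain

section MatrixForm

variable {Q : Type u} [CommRing Q]
variable {S : Type w} [CommRing S] {B : Type v} [AddCommGroup B] [Module S B]
variable {ι κ τ : Type} [Fintype ι] [Fintype κ] [Fintype τ]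

theorem Fl.exact_of_surjective [Module Q B] {I : Ideal Q} (h : Fl I B)
    {A : Type u} [CommRing A] [Algebra Q A] [Module A B] [IsScalarTower Q A B]
    (hA : Function.Surjective (algebraMap Q A)) (hI : ∀ a, algebraMap Q A a = 0 ↔ a ∈ I)
    (M : Matrix κ ι Q) (ρ : Matrix ι τ Q)
    (hM : ∀ x : ι → Q, (∀ k, mv M Q x k ∈ I) → ∃ u : τ → Q, ∀ i, x i - mv ρ Q u i ∈ I)
    (hMρ : ∀ u k, mv M Q (mv ρ Q u) k ∈ I)
    (y : ι → B) (hy : mv M B y = 0) : ∃ v : τ → B, mv ρ B v = y := by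
  classical
  have : Module.Finite Q A := Module.Finite.of_surjective (Algebra.linearMap Q A) hA
  let pr (σ : Type) : B ⊗[Q] (σ → A) →ₗ[Q] (σ → B) :=
    TensorProduct.lift (LinearMap.mk₂ Q (fun b x i => x i • b)
      (fun b b' x => by ext i; simp)
      (fun c b x => by
        ext i
        rw [Pi.smul_apply, ← algebraMap_smul A c b, ← algebraMap_smul A c (x i • b), smul_smul,
          smul_smul, mul_comm])
      (fun b x x' => by ext i; simp [add_smul]) (fun c b x => by ext i; simp))
  have pr_tmul : ∀ (σ : Type) (b : B) (x : σ → A), pr σ (b ⊗ₜ x) = fun i => x i • b :=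
    fun σ b x => rfl
  have nat : ∀ {σ σ' : Type} [Fintype σ] (R : Matrix σ' σ Q) (t : B ⊗[Q] (σ → A)),
      pr σ' ((mv R A).lTensor B t) = mv R B (pr σ t) := by
    intro σ σ' _ R t
    induction t using TensorProduct.induction_on with
    | zero => simp
    | add a b ha hb => simp only [map_add, ha, hb]
    | tmul b x =>
      rw [LinearMap.lTensor_tmul, pr_tmul, pr_tmul]
      ext k
      simp only [mv_apply, Finset.sum_smul, smul_assoc]
  let G := (ι → A) ⧸ LinearMap.range (mv ρ A)
  have lift : ∀ {σ : Type} (x : σ → A), ∃ y : σ → Q, x = fun i => (algebraMap Q A (y i)) := by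
    intro σ x
    choose y hy using fun i => hA (x i)
    exact ⟨y, funext fun i => (hy i).symm⟩
  have mvA : ∀ {σ σ' : Type} [Fintype σ] (R : Matrix σ' σ Q) (x : σ → Q),
      mv R A (fun i => algebraMap Q A (x i)) = fun i => algebraMap Q A (mv R Q x i) := by
    intro σ σ' _ R x
    exact mv_map R (Algebra.linearMap Q A) x
  let f : G →ₗ[Q] (κ → A) := Submodule.liftQ _ (mv M A) (by
    rintro _ ⟨u, rfl⟩
    obtain ⟨u, rfl⟩ := lift u
    rw [LinearMap.mem_ker, mvA, mvA]
    exact funext fun k => (hI _).2 (hMρ u k))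
  have hf : Function.Injective f := by
    rw [injective_iff_map_eq_zero]
    intro a ha
    obtain ⟨x, rfl⟩ := Submodule.Quotient.mk_surjective _ a
    obtain ⟨x, rfl⟩ := lift x
    rw [Submodule.liftQ_apply, mvA] at ha
    obtain ⟨u, hu⟩ := hM x fun k => (hI _).1 (congrFun ha k)
    rw [Submodule.Quotient.mk_eq_zero]
    refine ⟨fun i => algebraMap Q A (u i), ?_⟩
    rw [mvA]
    refine funext fun i => ?_
    have := (hI _).2 (hu i)
    rw [map_sub, sub_eq_zero] at this
    exact this.symm
  have hfB := h G (κ → A) f hf (fun a ha e => by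
    funext i
    rw [Pi.smul_apply, Algebra.smul_def, (hI a).2 ha, zero_mul, Pi.zero_apply])
  have hex : Function.Exact ((mv ρ A).lTensor B)
      ((Submodule.mkQ (LinearMap.range (mv ρ A))).lTensor B) :=
    lTensor_exact B (LinearMap.exact_map_mkQ_range _) (Submodule.mkQ_surjective _)
  let t : B ⊗[Q] (ι → A) := ∑ i, y i ⊗ₜ Pi.single i (1 : A)
  have ht : pr ι t = y := by
    ext i
    simp only [t, map_sum, pr_tmul, Finset.sum_apply, Pi.single_apply, ite_smul, one_smul,
      zero_smul, Finset.sum_ite_eq, Finset.mem_univ, if_true]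
  have hMt : (mv M A).lTensor B t = 0 := by
    have e1 : ∀ i, mv M A (Pi.single i 1) = ∑ k, M k i • Pi.single k (1 : A) := by
      intro i
      ext k
      simp [mv_apply, Pi.single_apply, Finset.sum_apply]
    simp only [t, map_sum, LinearMap.lTensor_tmul, e1, TensorProduct.tmul_sum]
    rw [Finset.sum_comm]
    refine Finset.sum_eq_zero fun k _ => ?_
    have e2 : ∀ i, y i ⊗ₜ[Q] (M k i • Pi.single k (1 : A) : κ → A) =
        (M k i • y i) ⊗ₜ[Q] (Pi.single k (1 : A) : κ → A) := fun i =>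
      (TensorProduct.smul_tmul _ _ _).symm
    rw [Finset.sum_congr rfl fun i _ => e2 i, ← TensorProduct.sum_tmul]
    have := congrFun hy k
    rw [mv_apply] at this
    rw [this, Pi.zero_apply, TensorProduct.zero_tmul]
  obtain ⟨s, hs⟩ := (hex t).1 (by
    apply hfB
    rw [← LinearMap.lTensor_comp_apply, map_zero]
    exact hMt)
  exact ⟨pr τ s, by rw [← nat, hs, ht]⟩

theorem Fl.exact [Module Q B] {I : Ideal Q} (h : Fl I B) (hI : ∀ a ∈ I, ∀ b : B, a • b = 0)
    (M : Matrix κ ι Q) (ρ : Matrix ι τ Q)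
    (hM : ∀ x : ι → Q, (∀ k, mv M Q x k ∈ I) → ∃ u : τ → Q, ∀ i, x i - mv ρ Q u i ∈ I)
    (hMρ : ∀ u k, mv M Q (mv ρ Q u) k ∈ I)
    (y : ι → B) (hy : mv M B y = 0) : ∃ v : τ → B, mv ρ B v = y := by
  have hB : Module.IsTorsionBySet Q B I := fun b a => hI a a.2 b
  let _ : Module (Q ⧸ I) B := hB.module
  have hst : IsScalarTower Q (Q ⧸ I) B := hB.isScalarTower
  exact h.exact_of_surjective (A := Q ⧸ I) Ideal.Quotient.mk_surjective
    (fun a => Ideal.Quotient.eq_zero_iff_mem) M ρ hM hMρ y hy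

omit [Fintype κ] in
theorem mv_compHom (φ : Q →+* S) [Module Q B] (h : ∀ (q : Q) (b : B), q • b = φ q • b)
    (M : Matrix κ ι Q) (x : ι → B) : mv (M.map φ) B x = mv M B x := by
  ext k
  simp [mv_apply, h]

variable [IsNoetherianRing Q] [IsLocalRing S] [IsNoetherianRing S] [Module.Finite S B]

/-- Exactness over `Q` is inherited by a module on which a regular system of parameters of `Q`
acts as a regular sequence. -/
theorem exact_of_isWeaklyRegular (φ : Q →+* S) (l : List Q) (hl : ∀ a ∈ l, φ a ∈ maximalIdeal S)
    (hmax : (Ideal.ofList l).IsMaximal) (hQ : IsWeaklyRegular Q l)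
    (hB : IsWeaklyRegular B (l.map φ)) (M : Matrix κ ι Q) (ρ : Matrix ι τ Q)
    (hM : ∀ x : ι → Q, mv M Q x = 0 → ∃ u : τ → Q, mv ρ Q u = x)
    (hMρ : ∀ u, mv M Q (mv ρ Q u) = 0)
    (y : ι → B) (hy : mv (M.map φ) B y = 0) : ∃ v : τ → B, mv (ρ.map φ) B v = y := by
  let _ : Algebra Q S := φ.toAlgebra
  let _ : Module Q B := Module.compHom B φ
  have : IsScalarTower Q S B := ⟨fun a s b => mul_smul (φ a) s b⟩
  have h : Fl (⊥ : Ideal Q) B := fl_bot (S := S) l hl hmax hQ hB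
  have hsm : ∀ (q : Q) (b : B), q • b = φ q • b := fun _ _ => rfl
  simp only [mv_compHom φ hsm] at hy ⊢
  refine h.exact ?_ M ρ ?_ ?_ y hy
  · intro a ha b
    rw [(Submodule.mem_bot Q).1 ha, zero_smul]
  · intro x hx
    obtain ⟨u, rfl⟩ := hM x (funext hx)
    exact ⟨u, fun i => by simp⟩
  · intro u k
    rw [hMρ]
    exact zero_mem _

omit [Fintype τ] in
/-- A module killed by `w` on which the rest of a regular system of parameters acts as a regular
sequence: relations with coefficients in `Q / w` come from those of `Q / w`. -/
theorem exists_of_isWeaklyRegular (φ : Q →+* S) (w : Q) (l : List Q)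
    (hl : ∀ a ∈ w :: l, φ a ∈ maximalIdeal S)
    (hmax : (Ideal.ofList (w :: l)).IsMaximal) (hQ : IsWeaklyRegular Q (w :: l))
    (hB : IsWeaklyRegular B (l.map φ)) (hw : ∀ b : B, φ w • b = 0) (M : Matrix κ ι Q) :
    ∃ (n : ℕ) (ρ : Matrix ι (Fin n) Q), (∀ u, ∃ z, mv M Q (mv ρ Q u) = w • z) ∧
      ∀ y : ι → B, mv (M.map φ) B y = 0 → ∃ v : Fin n → B, mv (ρ.map φ) B v = y := by
  classical
  let I : Ideal Q := Ideal.span {w}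
  let N : Submodule Q (ι → Q) := LinearMap.ker ((I.mkQ.compLeft κ).comp (mv M Q))
  have hN : ∀ x, x ∈ N ↔ ∀ k, mv M Q x k ∈ I := by
    intro x
    rw [LinearMap.mem_ker, funext_iff]
    exact forall_congr' fun k => Submodule.Quotient.mk_eq_zero _
  obtain ⟨n, g, hg⟩ := Module.Finite.exists_fin' Q N
  let ρ : Matrix ι (Fin n) Q := fun i j => (g (Pi.single j 1) : ι → Q) i
  have hρ : ∀ u, mv ρ Q u = g u := by
    intro u
    have h1 : u = ∑ j, u j • Pi.single j (1 : Q) := by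
      ext i
      simp [Finset.sum_apply, Pi.single_apply]
    conv_rhs => rw [h1, map_sum]
    ext i
    rw [mv_apply]
    simp [ρ, Finset.sum_apply, mul_comm]
  have hρI : ∀ u k, mv M Q (mv ρ Q u) k ∈ I := fun u => by
    rw [hρ]
    exact (hN _).1 (g u).2
  refine ⟨n, ρ, fun u => ?_, fun y hy => ?_⟩
  · choose z hz using fun k => Ideal.mem_span_singleton'.1 (hρI u k)
    exact ⟨z, funext fun k => by rw [← hz k, Pi.smul_apply, smul_eq_mul, mul_comm]⟩
  · let _ : Algebra Q S := φ.toAlgebra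
    let _ : Module Q B := Module.compHom B φ
    have : IsScalarTower Q S B := ⟨fun a s b => mul_smul (φ a) s b⟩
    have h : Fl I B := fl_span (S := S) w l hl hmax hQ hB hw
    have hsm : ∀ (q : Q) (b : B), q • b = φ q • b := fun _ _ => rfl
    simp only [mv_compHom φ hsm] at hy ⊢
    refine h.exact ?_ M ρ ?_ hρI y hy
    · intro a ha b
      obtain ⟨c, rfl⟩ := Ideal.mem_span_singleton'.1 ha
      have : w • b = 0 := hw b
      rw [mul_smul, this, smul_zero]
    · intro x hx
      obtain ⟨u, hu⟩ := hg ⟨x, (hN x).2 hx⟩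
      exact ⟨u, fun i => by rw [hρ, hu]; simp⟩

end MatrixForm

section Aux

theorem exists_smul_ker_of_pow_smul {A Z : Type*} [CommRing A] [AddCommGroup Z] [Module A Z]
    {P : Ideal A} (hP : P.IsPrime) (w : A) (s : ℕ) (z : Z) (hs : w ^ s • z = 0)
    (hz : ∀ a : A, a • z = 0 → a ∈ P) :
    ∃ c : A, w • c • z = 0 ∧ ∀ a : A, a • c • z = 0 → a ∈ P := by
  induction s generalizing z with
  | zero =>
    refine absurd (hz 1 (by simpa using hs)) fun h => hP.ne_top ((Ideal.eq_top_iff_one _).2 h)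
  | succ s ih =>
    by_cases h : ∀ a : A, a • w • z = 0 → a ∈ P
    · obtain ⟨c, hc1, hc2⟩ := ih (w • z) (by rw [smul_smul, ← pow_succ, hs]) h
      refine ⟨c * w, by rwa [mul_smul], fun a ha => hc2 a (by rwa [← mul_smul c])⟩
    · push Not at h
      obtain ⟨a, ha, haP⟩ := h
      refine ⟨a, by rwa [smul_comm], fun b hb => ?_⟩
      rw [smul_smul] at hb
      exact (hP.mem_or_mem (hz _ hb)).resolve_right haP

variable {S : Type u} [CommRing S] {ι : ℕ → Type} [∀ j, Fintype (ι j)]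

/-- A vector of scalars which becomes a cycle after multiplication with every element of `B`
defines a map from `B` to homology. -/
def cycleMap (d : ∀ j, Matrix (ι (j + 1)) (ι j) S) (B : Type*) [AddCommGroup B] [Module S B] (j : ℕ)
    (x : ι (j + 1) → S) (hx : ∀ t : B, mv (d (j + 1)) B (fun i => x i • t) = 0) :
    B →ₗ[S] hq d B j where
  toFun t := Hm.mk (fun j => mv (d j) B) j (fun i => x i • t) (hx t)
  map_add' s t := by
    rw [← Hm.mk_add]
    congr 1
    ext i
    simp
  map_smul' s t := by
    rw [RingHom.id_apply, ← Hm.mk_smul]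
    congr 1
    ext i
    simp [smul_comm s]

theorem cycleMap_eq_zero {d : ∀ j, Matrix (ι (j + 1)) (ι j) S} {B : Type*} [AddCommGroup B]
    [Module S B] {j : ℕ}
    {x : ι (j + 1) → S} {hx : ∀ t : B, mv (d (j + 1)) B (fun i => x i • t) = 0} (t : B) :
    cycleMap d B j x hx t = 0 ↔ ∃ y, mv (d j) B y = fun i => x i • t :=
  Hm.mk_eq_zero (d := fun j => mv (d j) B)

theorem mv_single {κ ι : Type} [Fintype ι] [DecidableEq ι] (R : Matrix κ ι S) (j : ι) :
    mv R S (Pi.single j 1) = fun i => R i j := by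
  ext i
  rw [mv_apply, Finset.sum_eq_single j]
  · simp
  · intro k _ hk
    simp [hk]
  · simp

end Aux

section DiagonalPair

variable {Q S : Type u} [CommRing Q] [IsLocalRing Q] [IsNoetherianRing Q]
  [CommRing S] [IsLocalRing S] [IsNoetherianRing S] [Algebra Q S]

/-- `S` is a two-sided flat extension of `Q` as in reduction to the diagonal: modules extended along
the first map inherit regularity along `φ`. -/
structure DiagonalPair (φ : Q →+* S) (w : Q) (z : List Q) : Prop where
  flat : Module.Flat Q S
  mem : ∀ a ∈ w :: z, φ a ∈ maximalIdeal S
  span : Ideal.ofList (w :: z) = maximalIdeal Q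
  regular : IsWeaklyRegular Q (w :: z)
  map_eq : φ w = algebraMap Q S w
  weaklyRegular : ∀ (N : Type u) [AddCommGroup N] [Module Q N] [Module.Finite Q N],
    IsWeaklyRegular (S ⊗[Q] N) (z.map φ)
  weaklyRegular_cons : ∀ (N : Type u) [AddCommGroup N] [Module Q N] [Module.Finite Q N],
    IsSMulRegular N w → IsWeaklyRegular (S ⊗[Q] N) ((w :: z).map φ)

namespace DiagonalPair

variable {φ : Q →+* S} {w : Q} {z : List Q} (D : DiagonalPair φ w z)
include D

theorem isMaximal : (Ideal.ofList (w :: z)).IsMaximal := by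
  rw [D.span]
  infer_instance

theorem map_mem (a : Q) (ha : a ∈ maximalIdeal Q) : φ a ∈ maximalIdeal S := by
  rw [← D.span] at ha
  have : Ideal.ofList (w :: z) ≤ (maximalIdeal S).comap φ := Ideal.span_le.2 D.mem
  exact this ha

theorem isSMulRegular : IsSMulRegular Q w := ((isWeaklyRegular_cons_iff _ _ _).1 D.regular).1

/-- Relations over a module killed by `w`. -/
theorem mem_of_relation {κ ι : Type} [Fintype κ] [Fintype ι]
    (N : Type u) [AddCommGroup N] [Module Q N] [Module.Finite Q N] (hN : ∀ n : N, w • n = 0)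
    (M : Matrix κ ι Q) (x : κ → Q) (J : Ideal Q)
    (hJ : ∀ (u : ι → Q) (a : Q), (∃ y, mv M Q u + a • x = w • y) → a ∈ J)
    (y : ι → S ⊗[Q] N) (t : S ⊗[Q] N)
    (hyt : mv (M.map φ) _ y + (fun k => φ (x k) • t) = 0) :
    t ∈ (J.map φ • ⊤ : Submodule S (S ⊗[Q] N)) := by
  have hw : ∀ b : S ⊗[Q] N, φ w • b = 0 := by
    intro b
    rw [D.map_eq, algebraMap_smul]
    induction b using TensorProduct.induction_on with
    | zero => simp
    | add a b ha hb => rw [smul_add, ha, hb, add_zero]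
    | tmul s n => rw [← TensorProduct.tmul_smul, hN, tmul_zero]
  let M' : Matrix κ (ι ⊕ Unit) Q := Matrix.of fun k => Sum.elim (M k) (fun _ => x k)
  have hM' : ∀ u : ι ⊕ Unit → Q,
      mv M' Q u = mv M Q (fun i => u (Sum.inl i)) + u (Sum.inr ()) • x := by
    intro u
    ext k
    simp [mv_apply, M', mul_comm]
  obtain ⟨n, ρ, hρ, h⟩ := exists_of_isWeaklyRegular φ w z D.mem D.isMaximal D.regular
    (D.weaklyRegular N) hw M'
  obtain ⟨v, hv⟩ := h (Sum.elim y fun _ => t) (by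
    rw [← hyt]
    ext k
    simp [mv_apply, M'])
  have h1 := congrFun hv (Sum.inr ())
  rw [mv_apply, Sum.elim_inr] at h1
  rw [← h1]
  refine Submodule.sum_mem _ fun j _ => Submodule.smul_mem_smul (Ideal.mem_map_of_mem φ ?_)
    Submodule.mem_top
  classical
  obtain ⟨y, hy⟩ := hρ (Pi.single j 1)
  refine hJ (fun i => ρ (Sum.inl i) j) _ ⟨y, ?_⟩
  rw [← hy, hM', mv_single]

variable {ι : ℕ → Type} [∀ j, Fintype (ι j)] (d : ∀ j, Matrix (ι (j + 1)) (ι j) Q)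

omit D in
variable (S) in
theorem lTensor_exact_of_flat [Module.Flat Q S] {A B C : Type u} [AddCommGroup A] [Module Q A]
    [AddCommGroup B] [Module Q B] [AddCommGroup C] [Module Q C] (f : A →ₗ[Q] B) (g : B →ₗ[Q] C)
    (hf : Function.Injective f) (hg : Function.Surjective g) (h : Function.Exact f g) :
    Function.Injective (AlgebraTensorModule.lTensor S S f) ∧
    Function.Surjective (AlgebraTensorModule.lTensor S S g) ∧
    Function.Exact (AlgebraTensorModule.lTensor S S f) (AlgebraTensorModule.lTensor S S g) :=
  ⟨Module.Flat.lTensor_preserves_injective_linearMap f hf, LinearMap.lTensor_surjective S hg,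
    lTensor_exact S h hg⟩

theorem subsingleton_of_isSMulRegular (hd : ∀ j, d (j + 1) * d j = 0)
    (N : Type u) [AddCommGroup N] [Module Q N] [Module.Finite Q N]
    (hN : IsSMulRegular N w) (j : ℕ) (hj : Subsingleton (hq d Q j)) :
    Subsingleton (hq (fun j => (d j).map φ) (S ⊗[Q] N) j) := by
  refine Hm.subsingleton_iff.2 fun y hy => ?_
  refine exact_of_isWeaklyRegular φ (w :: z) D.mem D.isMaximal D.regular
    (D.weaklyRegular_cons N hN) (d (j + 1)) (d j) ?_ ?_ y hy
  · exact fun x hx => Hm.subsingleton_iff.1 hj x hx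
  · intro u
    rw [← mv_mul, hd, mv_zero]

omit D [IsLocalRing Q] [IsNoetherianRing Q] [IsLocalRing S] [IsNoetherianRing S] [Algebra Q S] in
theorem map_comp_zero {d : ∀ j, Matrix (ι (j + 1)) (ι j) Q} (hd : ∀ j, d (j + 1) * d j = 0)
    (j : ℕ) : (d (j + 1)).map φ * (d j).map φ = 0 := by
  rw [← Matrix.map_mul, hd, Matrix.map_zero _ (map_zero φ)]

theorem subsingleton_of_succ (hd : ∀ j, d (j + 1) * d j = 0)
    (N : Type u) [AddCommGroup N] [Module Q N] [Module.Finite Q N]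
    (j : ℕ) (hj : Subsingleton (hq d Q j)) (hj' : Subsingleton (hq d Q (j + 1))) :
    Subsingleton (hq (fun j => (d j).map φ) (S ⊗[Q] N) j) := by
  have := D.flat
  obtain ⟨n, g, hg⟩ := Module.Finite.exists_fin' Q N
  obtain ⟨h1, h2, h3⟩ := lTensor_exact_of_flat S (LinearMap.ker g).subtype g
    (Submodule.injective_subtype _) hg (LinearMap.exact_subtype_ker_map g)
  have hreg : IsSMulRegular (Fin n → Q) w := IsSMulRegular.pi fun _ => D.isSMulRegular
  have hreg' : IsSMulRegular (LinearMap.ker g) w := fun a b hab =>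
    Subtype.ext (hreg (congrArg Subtype.val hab))
  have s1 := D.subsingleton_of_isSMulRegular d hd _ hreg j hj
  have s2 := D.subsingleton_of_isSMulRegular d hd (LinearMap.ker g) hreg' (j + 1) hj'
  obtain ⟨_, δ, hδ, -⟩ := hq_exact (fun j => (d j).map φ) (map_comp_zero hd) _ _ h1 h2 h3 j
  refine subsingleton_of_forall_eq 0 fun a => ?_
  obtain ⟨b, rfl⟩ := (hδ a).1 (Subsingleton.elim _ _)
  rw [Subsingleton.elim b 0, map_zero]

variable [IsEmpty (ι 0)] (hd : ∀ j, d (j + 1) * d j = 0) (K : ℕ)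
  (hQ : ∀ j ≤ K, Subsingleton (hq d Q j))
include hd hQ

theorem hqMap_injective {N' N : Type u} [AddCommGroup N'] [Module Q N'] [Module.Finite Q N']
    [AddCommGroup N] [Module Q N] [Module.Finite Q N] (f : N' →ₗ[Q] N)
    (hf : Function.Injective f) :
    Function.Injective (hqMap (fun j => (d j).map φ) (AlgebraTensorModule.lTensor S S f) K) := by
  have := D.flat
  obtain ⟨h1, h2, h3⟩ := lTensor_exact_of_flat S f (LinearMap.range f).mkQ hf
    (Submodule.mkQ_surjective _) (LinearMap.exact_map_mkQ_range _)
  rw [injective_iff_map_eq_zero]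
  intro a ha
  cases K with
  | zero =>
    obtain ⟨x, hx, rfl⟩ := Hm.exists_mk a
    rw [Hm.map_mk, Hm.mk_eq_zero] at ha
    obtain ⟨y, hy⟩ := ha
    rw [Hm.mk_eq_zero]
    refine ⟨0, ?_⟩
    rw [map_zero]
    refine funext fun i => (h1 ?_ : (0 : ι 1 → _) i = x i)
    have := congrFun hy i
    rw [mv_apply, Finset.univ_eq_empty, Finset.sum_empty] at this
    exact (map_zero _).trans this
  | succ k =>
    obtain ⟨_, δ, -, hδ⟩ := hq_exact (fun j => (d j).map φ) (map_comp_zero hd) _ _ h1 h2 h3 k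
    have := D.subsingleton_of_succ d hd (N ⧸ LinearMap.range f) k (hQ k (by omega))
      (hQ (k + 1) le_rfl)
    obtain ⟨b, rfl⟩ := (hδ a).1 ha
    rw [Subsingleton.elim b 0, map_zero]

theorem subsingleton_of_saturated
    (hno : ∀ x : ι (K + 2) → Q, (∃ u, mv (d (K + 1)) Q u = w • x) → ∃ u, mv (d (K + 1)) Q u = x)
    (s : ℕ) : ∀ (N : Type u) [AddCommGroup N] [Module Q N] [Module.Finite Q N],
      (∀ n : N, w ^ s • n = 0) → Subsingleton (hq (fun j => (d j).map φ) (S ⊗[Q] N) K) := by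
  have := D.flat
  have base : ∀ (N : Type u) [AddCommGroup N] [Module Q N] [Module.Finite Q N],
      (∀ n : N, w • n = 0) → Subsingleton (hq (fun j => (d j).map φ) (S ⊗[Q] N) K) := by
    intro N _ _ _ hN
    have hw : ∀ b : S ⊗[Q] N, φ w • b = 0 := by
      intro b
      rw [D.map_eq, algebraMap_smul]
      induction b using TensorProduct.induction_on with
      | zero => simp
      | add a b ha hb => rw [smul_add, ha, hb, add_zero]
      | tmul s n => rw [← TensorProduct.tmul_smul, hN, tmul_zero]
    obtain ⟨n, ρ, hρ, h⟩ := exists_of_isWeaklyRegular φ w z D.mem D.isMaximal D.regular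
      (D.weaklyRegular N) hw (d (K + 1))
    refine Hm.subsingleton_iff.2 fun y hy => ?_
    obtain ⟨v, rfl⟩ := h y hy
    classical
    have hcol : ∀ j, ∃ (a : ι K → Q) (b : ι (K + 1) → Q),
        mv ρ Q (Pi.single j 1) = mv (d K) Q a + w • b := by
      intro j
      obtain ⟨x, hx⟩ := hρ (Pi.single j 1)
      obtain ⟨b, rfl⟩ := hno x ⟨_, hx⟩
      obtain ⟨a, ha⟩ := Hm.subsingleton_iff.1 (hQ K le_rfl) (mv ρ Q (Pi.single j 1) - w • b)
        (by rw [map_sub, map_smul, hx, sub_self])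
      exact ⟨a, b, by rw [ha, sub_add_cancel]⟩
    choose a b hab using hcol
    have hρ' : ρ = d K * Matrix.of (fun i j => a j i) + w • Matrix.of (fun i j => b j i) := by
      ext i j
      have := congrFun (hab j) i
      rw [mv_single] at this
      simpa [mv_apply, Matrix.mul_apply] using this
    refine ⟨mv ((Matrix.of (fun i j => a j i)).map φ) _ v, ?_⟩
    have e : ρ.map φ = (d K).map φ * (Matrix.of (fun i j => a j i)).map φ +
        φ w • (Matrix.of (fun i j => b j i)).map φ := by
      conv_lhs => rw [hρ']
      rw [← Matrix.map_mul]
      ext i j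
      simp only [Matrix.map_apply, Matrix.add_apply, Matrix.smul_apply, smul_eq_mul, map_add,
        map_mul]
    rw [e, mv_add, mv_mul, mv_smul]
    rw [show φ w • mv ((Matrix.of (fun i j => b j i)).map φ) (S ⊗[Q] N) v = 0 from
      funext fun i => hw _, add_zero]
  induction s with
  | zero =>
    intro N _ _ _ hN
    exact base N fun n => by
      have := hN n
      rw [pow_zero, one_smul] at this
      rw [this, smul_zero]
  | succ s ih =>
    intro N _ _ _ hN
    let f : LinearMap.ker (smulMap w N) →ₗ[Q] N := (LinearMap.ker (smulMap w N)).subtype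
    let g : N →ₗ[Q] N ⧸ LinearMap.ker (smulMap w N) := Submodule.mkQ _
    obtain ⟨h1, h2, h3⟩ := lTensor_exact_of_flat S f g (Submodule.injective_subtype _)
      (Submodule.mkQ_surjective _) (LinearMap.exact_subtype_mkQ _)
    have s1 := base (LinearMap.ker (smulMap w N)) fun n => Subtype.ext n.2
    have s2 := ih (N ⧸ LinearMap.ker (smulMap w N)) fun n => by
      obtain ⟨n, rfl⟩ := Submodule.Quotient.mk_surjective _ n
      rw [← Submodule.Quotient.mk_smul, Submodule.Quotient.mk_eq_zero, LinearMap.mem_ker,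
        smulMap_apply, smul_smul, ← pow_succ', hN]
    obtain ⟨h4, -⟩ := hq_exact (fun j => (d j).map φ) (map_comp_zero hd) _ _ h1 h2 h3 K
    refine subsingleton_of_forall_eq 0 fun a => ?_
    obtain ⟨b, rfl⟩ := (h4 a).1 (Subsingleton.elim _ _)
    rw [Subsingleton.elim b 0, map_zero]

end DiagonalPair

end DiagonalPair

namespace DiagonalPair

variable {Q S : Type u} [CommRing Q] [IsLocalRing Q] [IsNoetherianRing Q]
  [CommRing S] [IsLocalRing S] [IsNoetherianRing S] [Algebra Q S]
variable {φ : Q →+* S} {w : Q} {z : List Q} (D : DiagonalPair φ w z)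
include D

variable {ι : ℕ → Type} [∀ j, Fintype (ι j)] (d : ∀ j, Matrix (ι (j + 1)) (ι j) Q)

omit D in
theorem smul_ker_smulMap (w : Q) {T : Type*} [AddCommGroup T] [Module Q T]
    (n : LinearMap.ker (smulMap w T)) : w • n = 0 := by
  ext
  exact n.2

theorem mem_torsion_notMem {V : Type*} [AddCommGroup V] [Module Q V] [Module.Finite Q V]
    (I : Submodule Q V) (x : V) (hx : x ∉ I) (hwx : w • x ∈ I) :
    ∃ (x : V) (s : ℕ), w ^ s • x ∈ I ∧ ∀ i ∈ I, ∀ y, x ≠ i + w • y := by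
  by_contra hcon
  push Not at hcon
  let T : Submodule Q (V ⧸ I) :=
    { carrier := {a | ∃ s : ℕ, w ^ s • a = 0}
      add_mem' := by
        rintro a b ⟨s, hs⟩ ⟨t, ht⟩
        refine ⟨s + t, ?_⟩
        rw [smul_add, pow_add, mul_smul _ _ b, ht, smul_zero, mul_comm, mul_smul, hs, smul_zero,
          add_zero]
      zero_mem' := ⟨0, smul_zero _⟩
      smul_mem' := by
        rintro c a ⟨s, hs⟩
        exact ⟨s, by rw [smul_comm, hs, smul_zero]⟩ }
  have hw : w ∈ maximalIdeal Q := D.span ▸ Ideal.subset_span (List.mem_cons_self ..)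
  have hT : T = ⊥ := by
    refine eq_bot_of_smulMap T w hw fun a ha => ?_
    obtain ⟨s, hs⟩ := ha
    obtain ⟨v, rfl⟩ := Submodule.Quotient.mk_surjective _ a
    rw [← Submodule.Quotient.mk_smul, Submodule.Quotient.mk_eq_zero] at hs
    obtain ⟨i, hi, y, rfl⟩ := hcon v s hs
    have e : (Submodule.Quotient.mk (i + w • y) : V ⧸ I) = w • Submodule.Quotient.mk y := by
      rw [← Submodule.Quotient.mk_smul, Submodule.Quotient.eq, add_sub_cancel_right]
      exact hi
    refine ⟨Submodule.Quotient.mk y, ⟨s + 1, ?_⟩, e.symm⟩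
    rw [pow_succ, mul_smul, ← e, ← Submodule.Quotient.mk_smul, Submodule.Quotient.mk_eq_zero]
    exact hs
  have : (Submodule.Quotient.mk x : V ⧸ I) ∈ T := ⟨1, by
    rw [pow_one, ← Submodule.Quotient.mk_smul, Submodule.Quotient.mk_eq_zero]
    exact hwx⟩
  rw [hT, Submodule.mem_bot, Submodule.Quotient.mk_eq_zero] at this
  exact hx this

variable [IsEmpty (ι 0)] (hd : ∀ j, d (j + 1) * d j = 0) (K : ℕ) (htop : d (K + 2) = 0)
  (hQ : ∀ j ≤ K, Subsingleton (hq d Q j))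
include hd hQ htop

/-- The key point: nonzero homology in degree `K` forces an associated prime of the next homology
module in its support. -/
theorem exists_isAsc_of_torsion (s : ℕ) (T : Type u) [AddCommGroup T] [Module Q T]
    [Module.Finite Q T] (hT : ∀ t : T, w ^ s • t = 0)
    (hne : ¬ Subsingleton (hq (fun j => (d j).map φ) (S ⊗[Q] T) K)) :
    ∃ (P : Ideal S) (hP : P.IsPrime),
      IsAsc S (hq (fun j => (d j).map φ) (S ⊗[Q] T) (K + 1)) P ∧
      (⟨P, hP⟩ : PrimeSpectrum S) ∈ Module.support S
        (hq (fun j => (d j).map φ) (S ⊗[Q] (LinearMap.ker (smulMap w T))) K) := by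
  have := D.flat
  have hw : w ∈ maximalIdeal Q := D.span ▸ Ideal.subset_span (List.mem_cons_self ..)
  have hwS : algebraMap Q S w ∈ maximalIdeal S := D.map_eq ▸ D.map_mem w hw
  let I : Submodule Q (ι (K + 2) → Q) := LinearMap.range (mv (d (K + 1)) Q)
  have hVreg : IsSMulRegular (ι (K + 2) → Q) w := IsSMulRegular.pi fun _ => D.isSMulRegular
  -- a vector `x`, torsion modulo the image, but not in the image modulo `w`
  obtain ⟨x, r, hxr, hxI⟩ : ∃ (x : ι (K + 2) → Q) (r : ℕ), w ^ r • x ∈ I ∧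
      ∀ i ∈ I, ∀ y, x ≠ i + w • y := by
    by_contra hcon
    refine hne (D.subsingleton_of_saturated d hd K hQ (fun x hx => ?_) s T hT)
    by_contra hx'
    exact hcon (D.mem_torsion_notMem I x hx' hx)
  have htop' : ∀ (B : Type u) [AddCommGroup B] [Module S B] (y : ι (K + 2) → B),
      mv ((d (K + 2)).map φ) B y = 0 := by
    intro B _ _ y
    rw [htop, Matrix.map_zero _ (map_zero φ), mv_zero]
  let θ : (S ⊗[Q] T) →ₗ[S] hq (fun j => (d j).map φ) (S ⊗[Q] T) (K + 1) :=
    cycleMap (fun j => (d j).map φ) _ (K + 1) (fun k => φ (x k)) (fun t => htop' _ _)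
  have hTne : ¬ Subsingleton (S ⊗[Q] T) := fun h => hne (subsingleton_hq _ K)
  have hθ : θ ≠ 0 := by
    intro hθ
    let g : T →ₗ[Q] T ⧸ LinearMap.range (smulMap w T) := Submodule.mkQ _
    have hg : Function.Surjective (AlgebraTensorModule.lTensor S S g) :=
      LinearMap.lTensor_surjective S (Submodule.mkQ_surjective _)
    have hW : ∀ b : S ⊗[Q] (T ⧸ LinearMap.range (smulMap w T)),
        b ∈ (maximalIdeal S • ⊤ : Submodule S (S ⊗[Q] (T ⧸ LinearMap.range (smulMap w T)))) := by
      intro b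
      obtain ⟨t, rfl⟩ := hg b
      obtain ⟨y, hy⟩ := (cycleMap_eq_zero (d := fun j => (d j).map φ) (j := K + 1)
        (x := fun k => φ (x k)) (hx := fun t => htop' _ _) t).1
        (DFunLike.congr_fun hθ t)
      have h1 := D.mem_of_relation (T ⧸ LinearMap.range (smulMap w T)) (fun n => by
          obtain ⟨n, rfl⟩ := Submodule.Quotient.mk_surjective _ n
          rw [← Submodule.Quotient.mk_smul, Submodule.Quotient.mk_eq_zero]
          exact ⟨n, rfl⟩) (d (K + 1)) x (maximalIdeal Q) (fun u a hy => by
            obtain ⟨y, hy⟩ := hy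
            by_contra ha
            obtain ⟨a, rfl⟩ := (IsLocalRing.notMem_maximalIdeal.1 ha)
            refine hxI (mv (d (K + 1)) Q (-((↑a⁻¹ : Q) • u))) ⟨_, rfl⟩ ((↑a⁻¹ : Q) • y) ?_
            rw [smul_comm w, ← hy, smul_add, smul_smul, Units.inv_mul, one_smul, map_neg,
              map_smul, neg_add_cancel_left])
        ((AlgebraTensorModule.lTensor S S g).compLeft _ y)
        (-(AlgebraTensorModule.lTensor S S g t)) (by
          rw [mv_map, hy]
          ext k
          simp only [Pi.add_apply, LinearMap.compLeft_apply, Function.comp_apply, map_smul,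
            smul_neg]
          exact add_neg_cancel _)
      rw [neg_mem_iff] at h1
      exact Submodule.smul_mono_left (Ideal.map_le_iff_le_comap.2 D.map_mem) h1
    have hW' : Subsingleton (S ⊗[Q] (T ⧸ LinearMap.range (smulMap w T))) := by
      have h2 := Submodule.eq_bot_of_le_smul_of_le_jacobson_bot (maximalIdeal S)
        (⊤ : Submodule S (S ⊗[Q] (T ⧸ LinearMap.range (smulMap w T)))) Module.Finite.fg_top
        (fun b _ => hW b) (IsLocalRing.maximalIdeal_le_jacobson _)
      exact (Submodule.subsingleton_iff S).1 (subsingleton_of_top_le_bot h2.le)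
    have h3 : (⊤ : Submodule S (S ⊗[Q] T)) = ⊥ := by
      refine eq_bot_of_smulMap _ _ hwS fun b _ => ?_
      obtain ⟨c, rfl⟩ := (lTensor_exact S (LinearMap.exact_map_mkQ_range (smulMap w T))
        (Submodule.mkQ_surjective _) b).1 (hW'.elim _ _)
      refine ⟨c, Submodule.mem_top, ?_⟩
      rw [show smulMap w T = w • LinearMap.id from rfl, LinearMap.lTensor_smul,
        LinearMap.lTensor_id, algebraMap_smul]
      rfl
    exact hTne ((Submodule.subsingleton_iff S).1 (subsingleton_of_top_le_bot h3.le))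
  obtain ⟨t₀, ht₀⟩ : ∃ t, θ t ≠ 0 := by
    by_contra h
    push Not at h
    exact hθ (LinearMap.ext h)
  obtain ⟨P, hPasc, -⟩ := exists_isAsc_of_ne_zero (S := S)
    (⟨θ t₀, t₀, rfl⟩ : LinearMap.range θ) (fun h => ht₀ (congrArg Subtype.val h))
  obtain ⟨hP, ⟨_, t, rfl⟩, hz⟩ := hPasc
  have hzP : ∀ a : S, a • θ t = 0 → a ∈ P := fun a ha => (hz a).2 (Subtype.ext ha)
  refine ⟨P, hP, ⟨hP, θ t, fun a => (hz a).trans Subtype.ext_iff⟩, ?_⟩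
  -- elements of `S ⊗ T` and of the cokernel killed by `w`
  have hpowT : ∀ b : S ⊗[Q] T, w ^ s • b = 0 := by
    intro b
    induction b using TensorProduct.induction_on with
    | zero => simp
    | add a b ha hb => rw [smul_add, ha, hb, add_zero]
    | tmul s n => rw [← TensorProduct.tmul_smul, hT, tmul_zero]
  obtain ⟨c, hc1, hc2⟩ := exists_smul_ker_of_pow_smul hP (algebraMap Q S w) s t
    (by rw [← map_pow, algebraMap_smul, hpowT])
    (fun a ha => hzP a (by rw [← map_smul, ha, map_zero]))
  let N := LinearMap.ker (smulMap w T)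
  have hfN : Module.Finite Q N := inferInstance
  obtain ⟨t₁, ht₁⟩ : ∃ t₁ : S ⊗[Q] N, AlgebraTensorModule.lTensor S S N.subtype t₁ = c • t := by
    have hex : Function.Exact N.subtype (smulMap w T) := LinearMap.exact_subtype_ker_map _
    refine (Module.Flat.lTensor_exact S hex (c • t)).1 ?_
    rw [show smulMap w T = w • LinearMap.id from rfl, LinearMap.lTensor_smul, LinearMap.lTensor_id]
    rw [algebraMap_smul] at hc1
    exact hc1
  have hPN : (⟨P, hP⟩ : PrimeSpectrum S) ∈ Module.support S (S ⊗[Q] N) := by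
    refine Module.mem_support_iff_exists_annihilator.2 ⟨t₁, fun a ha => ?_⟩
    rw [Submodule.mem_annihilator_span_singleton] at ha
    refine hc2 a ?_
    rw [← ht₁, ← map_smul, ha, map_zero]
  obtain ⟨e, he1, he2⟩ := exists_smul_ker_of_pow_smul (hP.comap φ) w r
    (Submodule.Quotient.mk x : (ι (K + 2) → Q) ⧸ I)
    (by rwa [← Submodule.Quotient.mk_smul, Submodule.Quotient.mk_eq_zero])
    (fun a ha => by
      rw [← Submodule.Quotient.mk_smul, Submodule.Quotient.mk_eq_zero] at ha
      obtain ⟨u, hu⟩ := ha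
      refine hzP _ ?_
      rw [← map_smul]
      refine (cycleMap_eq_zero (d := fun j => (d j).map φ) (j := K + 1)
        (x := fun k => φ (x k)) (hx := fun t => htop' _ _) _).2 ⟨fun i => φ (u i) • t, ?_⟩
      ext k
      have := congrFun hu k
      rw [mv_apply, Pi.smul_apply, smul_eq_mul] at this
      rw [mv_apply, smul_smul, mul_comm (φ (x k)), ← map_mul, ← this, map_sum, Finset.sum_smul]
      simp [mul_smul])
  simp only [← Submodule.Quotient.mk_smul, Submodule.Quotient.mk_eq_zero] at he1 he2
  obtain ⟨u, hu⟩ := he1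
  have hwN : ∀ b : S ⊗[Q] N, φ w • b = 0 := by
    intro b
    rw [D.map_eq, algebraMap_smul]
    induction b using TensorProduct.induction_on with
    | zero => simp
    | add a b ha hb => rw [smul_add, ha, hb, add_zero]
    | tmul s n => rw [← TensorProduct.tmul_smul, smul_ker_smulMap, tmul_zero]
  have hcyc : ∀ b : S ⊗[Q] N, mv ((d (K + 1)).map φ) _ (fun i => φ (u i) • b) = 0 := by
    intro b
    ext k
    have := congrFun hu k
    rw [mv_apply, Pi.smul_apply, smul_eq_mul] at this
    rw [mv_apply]
    simp only [Matrix.map_apply, smul_smul, ← map_mul]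
    rw [← Finset.sum_smul, ← map_sum, show (∑ i, d (K + 1) k i * u i) = w * (e • x) k from this,
      map_mul, mul_comm, mul_smul, hwN, smul_zero, Pi.zero_apply]
  let θ' : (S ⊗[Q] N) →ₗ[S] hq (fun j => (d j).map φ) (S ⊗[Q] N) K :=
    cycleMap (fun j => (d j).map φ) _ K (fun k => φ (u k)) hcyc
  let J : Ideal Q := I.comap (LinearMap.toSpanSingleton Q _ (e • x))
  have hJ : ∀ a, a ∈ J ↔ a • e • x ∈ I := fun a => Iff.rfl
  have hNw : ∀ n : N, w • n = 0 := fun n => smul_ker_smulMap w n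
  have hker : LinearMap.ker θ' ≤ J.map φ • ⊤ := by
    intro b hb
    obtain ⟨y, hy⟩ := (cycleMap_eq_zero (d := fun j => (d j).map φ) (j := K)
      (x := fun k => φ (u k)) (hx := hcyc) b).1 hb
    have h1 := D.mem_of_relation N hNw (d K) u J (fun v a hv => by
        obtain ⟨y, hy⟩ := hv
        have h2 := congrArg (mv (d (K + 1)) Q) hy
        rw [map_add, map_smul, map_smul, ← mv_mul, hd, mv_zero, zero_add, hu, smul_comm] at h2
        exact ⟨y, (hVreg h2).symm⟩) y (-b) (by
          rw [hy]
          ext k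
          rw [Pi.add_apply, smul_neg, add_neg_cancel, Pi.zero_apply])
    rwa [neg_mem_iff] at h1
  have hfin : (⟨P, hP⟩ : PrimeSpectrum S) ∈
      Module.support S ((S ⊗[Q] N) ⧸ (J.map φ • ⊤ : Submodule S (S ⊗[Q] N))) := by
    rw [Module.support_quotient]
    refine ⟨hPN, ?_⟩
    have : J.map φ ≤ P := Ideal.map_le_iff_le_comap.2 fun a ha => he2 a ha
    exact this
  have hfin' := Module.support_subset_of_surjective _ (Submodule.factor_surjective hker) hfin
  refine Module.support_subset_of_injective (Submodule.liftQ _ θ' le_rfl) ?_ hfin'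
  rw [← LinearMap.ker_eq_bot, Submodule.ker_liftQ_eq_bot' _ _ rfl]

theorem exists_isAsc (N : Type u) [AddCommGroup N] [Module Q N] [Module.Finite Q N]
    (hne : ¬ Subsingleton (hq (fun j => (d j).map φ) (S ⊗[Q] N) K)) :
    ∃ (P : Ideal S) (hP : P.IsPrime),
      IsAsc S (hq (fun j => (d j).map φ) (S ⊗[Q] N) (K + 1)) P ∧
      (⟨P, hP⟩ : PrimeSpectrum S) ∈ Module.support S
        (hq (fun j => (d j).map φ) (S ⊗[Q] N) K) := by
  have := D.flat
  -- the torsion submodule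
  obtain ⟨s, hs⟩ : ∃ s : ℕ, ∀ (n : N) (m : ℕ), w ^ m • n = 0 → w ^ s • n = 0 := by
    let T : ℕ →o Submodule Q N :=
      ⟨fun m => LinearMap.ker (smulMap (w ^ m) N), fun a b hab n hn => by
        obtain ⟨c, rfl⟩ := Nat.exists_eq_add_of_le' hab
        rw [LinearMap.mem_ker, smulMap_apply] at hn ⊢
        rw [pow_add, mul_smul, hn, smul_zero]⟩
    obtain ⟨s, hs⟩ := monotone_stabilizes_iff_noetherian.2 (inferInstance : IsNoetherian Q N) T
    refine ⟨s, fun n m hn => ?_⟩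
    have h1 : n ∈ T (max s m) := T.2 (le_max_right s m) (LinearMap.mem_ker.2 hn)
    rw [← hs _ (le_max_left s m)] at h1
    exact h1
  let T := LinearMap.ker (smulMap (w ^ s) N)
  have hreg : IsSMulRegular (N ⧸ T) w := by
    rw [isSMulRegular_iff_right_eq_zero_of_smul]
    intro a ha
    obtain ⟨n, rfl⟩ := Submodule.Quotient.mk_surjective _ a
    rw [← Submodule.Quotient.mk_smul, Submodule.Quotient.mk_eq_zero, LinearMap.mem_ker,
      smulMap_apply, smul_smul, ← pow_succ] at ha
    rw [Submodule.Quotient.mk_eq_zero]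
    exact hs n _ ha
  obtain ⟨h1, h2, h3⟩ := lTensor_exact_of_flat S T.subtype T.mkQ (Submodule.injective_subtype _)
      (Submodule.mkQ_surjective _) (LinearMap.exact_subtype_mkQ _)
  obtain ⟨h4, δ, h5, h6⟩ := hq_exact (fun j => (d j).map φ) (map_comp_zero hd) _ _ h1 h2 h3 K
  have s1 := D.subsingleton_of_isSMulRegular d hd (N ⧸ T) hreg K (hQ K le_rfl)
  have hneT : ¬ Subsingleton (hq (fun j => (d j).map φ) (S ⊗[Q] T) K) := by
    intro hT
    refine hne (subsingleton_of_forall_eq 0 fun a => ?_)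
    obtain ⟨b, rfl⟩ := (h4 a).1 (s1.elim _ _)
    rw [hT.elim b 0, map_zero]
  obtain ⟨P, hP, hPa, hPs⟩ := D.exists_isAsc_of_torsion d hd K htop hQ s T
    (fun t => Subtype.ext t.2) hneT
  refine ⟨P, hP, hPa.of_injective (hqMap (fun j => (d j).map φ)
    (AlgebraTensorModule.lTensor S S T.subtype) (K + 1)) ?_, ?_⟩
  · rw [injective_iff_map_eq_zero]
    intro a ha
    obtain ⟨b, rfl⟩ := (h6 a).1 ha
    rw [s1.elim b 0, map_zero]
  · exact Module.support_subset_of_injective _ (D.hqMap_injective d hd K hQ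
      (T.subtype.comp (LinearMap.ker (smulMap w T)).subtype)
      ((Submodule.injective_subtype _).comp (Submodule.injective_subtype _))) hPs

/-- Rigidity for complexes over `Q` which are exact up to degree `K`. -/
theorem rigid (l : List S) (hl : ∀ a ∈ l, a ∈ maximalIdeal S) (N : Type u) [AddCommGroup N]
    [Module Q N] [Module.Finite Q N] (hreg : IsWeaklyRegular (S ⊗[Q] N) l)
    (hfl : ∀ j ≤ K, IsFiniteLength S (hq (fun j => (d j).map φ)
      ((S ⊗[Q] N) ⧸ (Ideal.ofList l • ⊤ : Submodule S (S ⊗[Q] N))) j))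
    (hsum : altSum (fun j => ell S (hq (fun j => (d j).map φ)
      ((S ⊗[Q] N) ⧸ (Ideal.ofList l • ⊤ : Submodule S (S ⊗[Q] N))) j)) (K + 1) ≤ 0) :
    ∀ j ≤ K, Subsingleton (hq (fun j => (d j).map φ)
      ((S ⊗[Q] N) ⧸ (Ideal.ofList l • ⊤ : Submodule S (S ⊗[Q] N))) j) := by
  have hlow : ∀ j < K, Subsingleton (hq (fun j => (d j).map φ) (S ⊗[Q] N) j) := fun j hj =>
    D.subsingleton_of_succ d hd N j (hQ j hj.le) (hQ (j + 1) hj)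
  rcases l.eq_nil_or_concat with rfl | ⟨l', a, hl'⟩
  · let e : ((S ⊗[Q] N) ⧸ (Ideal.ofList ([] : List S) • ⊤ : Submodule S (S ⊗[Q] N))) ≃ₗ[S]
        S ⊗[Q] N :=
      Submodule.quotEquivOfEqBot _ (by rw [Ideal.ofList_nil, Submodule.bot_smul])
    have hlow' : ∀ j < K, Subsingleton (hq (fun j => (d j).map φ)
      ((S ⊗[Q] N) ⧸ (Ideal.ofList ([] : List S) • ⊤ : Submodule S (S ⊗[Q] N))) j) := fun j hj =>
        have := hlow j hj
        (hqCongr _ e j).toEquiv.subsingleton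
    have h0 : altSum (fun j => ell S (hq (fun j => (d j).map φ)
      ((S ⊗[Q] N) ⧸ (Ideal.ofList ([] : List S) • ⊤ : Submodule S (S ⊗[Q] N))) j)) K =
        altSum (fun _ => (0 : ℤ)) K :=
      altSum_congr fun j hj => by
        have := hlow' j hj
        exact ell_of_subsingleton _
    have h00 : ∀ k, altSum (fun _ => (0 : ℤ)) k = 0 := by
      intro k
      induction k with
      | zero => rfl
      | succ k ih => rw [altSum, ih, sub_zero]
    rw [altSum, h0, h00, sub_zero] at hsum
    intro j hj
    rcases hj.lt_or_eq with hj | rfl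
    · exact hlow' j hj
    · exact (ell_eq_zero_iff (hfl j le_rfl)).1 (le_antisymm hsum (ell_nonneg _))
  · have hc := chiGood (d := fun j => (d j).map φ) (map_comp_zero hd) K
      (by rw [htop, Matrix.map_zero _ (map_zero φ)]) l'.length l (by simp [hl']) hl
      (S ⊗[Q] N) hreg (fun j hj => by
        have := hlow j hj
        exact IsFiniteLength.of_subsingleton) hfl
    obtain ⟨-, h2, h3⟩ := hc.2 (le_antisymm hsum hc.1)
    refine h3 fun j hj => ?_
    rcases hj.lt_or_eq with hj | rfl
    · exact hlow j hj
    · by_contra hne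
      obtain ⟨P, hP, hPa, hPs⟩ := D.exists_isAsc d hd j htop hQ N hne
      exact h2 P hPa hP hPs

end DiagonalPair

theorem rTensor_injective_of_flat_coker_aux {Q : Type u} [CommRing Q] {A B C K F N : Type u}
    [AddCommGroup A] [Module Q A] [AddCommGroup B] [Module Q B] [AddCommGroup C] [Module Q C]
    [AddCommGroup K] [Module Q K] [AddCommGroup F] [Module Q F] [AddCommGroup N] [Module Q N]
    [Module.Flat Q C] [Module.Flat Q F] (f : A →ₗ[Q] B) (g : B →ₗ[Q] C)
    (hf : Function.Injective f) (hg : Function.Surjective g) (h : Function.Exact f g)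
    (k : K →ₗ[Q] F) (p : F →ₗ[Q] N) (hk : Function.Injective k) (hp : Function.Surjective p)
    (hkp : Function.Exact k p) : Function.Injective (f.rTensor N) := by
  rw [injective_iff_map_eq_zero]
  intro x hx
  obtain ⟨y, rfl⟩ := LinearMap.lTensor_surjective A hp x
  have e1 : p.lTensor B (f.rTensor _ y) = 0 := by
    rw [← hx]
    exact LinearMap.congr_fun
      ((LinearMap.lTensor_comp_rTensor ..).trans (LinearMap.rTensor_comp_lTensor ..).symm) y
  obtain ⟨z, hz⟩ := (lTensor_exact B hkp hp _).1 e1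
  have e2 : g.rTensor _ z = 0 := by
    have hinj : Function.Injective (k.lTensor C) :=
      Module.Flat.lTensor_preserves_injective_linearMap k hk
    apply hinj
    rw [map_zero]
    have : k.lTensor C (g.rTensor _ z) = g.rTensor _ (k.lTensor B z) :=
      LinearMap.congr_fun
        ((LinearMap.lTensor_comp_rTensor ..).trans (LinearMap.rTensor_comp_lTensor ..).symm) z
    rw [this, hz]
    exact (rTensor_exact _ h hg).apply_apply_eq_zero y
  obtain ⟨v, rfl⟩ := (rTensor_exact _ h hg z).1 e2
  have e3 : f.rTensor F (y - k.lTensor A v) = 0 := by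
    rw [map_sub, ← hz, sub_eq_zero]
    exact LinearMap.congr_fun
      ((LinearMap.lTensor_comp_rTensor ..).trans (LinearMap.rTensor_comp_lTensor ..).symm) v
  have e4 := Module.Flat.rTensor_preserves_injective_linearMap (M := F) f hf
    (e3.trans (map_zero _).symm)
  rw [sub_eq_zero] at e4
  rw [e4]
  exact (lTensor_exact A hkp hp).apply_apply_eq_zero v

/-- Tensoring preserves injectivity of maps with flat cokernel. -/
theorem rTensor_injective_of_flat_coker {Q : Type u} [CommRing Q] {A B C : Type u}
    [AddCommGroup A] [Module Q A] [AddCommGroup B] [Module Q B] [AddCommGroup C] [Module Q C]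
    [Module.Flat Q C] (f : A →ₗ[Q] B) (g : B →ₗ[Q] C) (hf : Function.Injective f)
    (hg : Function.Surjective g) (h : Function.Exact f g)
    (N : Type u) [AddCommGroup N] [Module Q N] : Function.Injective (f.rTensor N) := by
  let p : (N →₀ Q) →ₗ[Q] N := Finsupp.linearCombination Q id
  have hp : Function.Surjective p := Finsupp.linearCombination_id_surjective Q N
  refine rTensor_injective_of_flat_coker_aux (K := LinearMap.ker p) (F := N →₀ Q) f g hf hg h
    (Submodule.subtype _) p (Submodule.injective_subtype _) hp ?_
  intro x
  constructor
  · intro hx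
    exact ⟨⟨x, hx⟩, rfl⟩
  · rintro ⟨y, rfl⟩
    exact y.2

section

variable {Q : Type u} [CommRing Q] [IsNoetherianRing Q]
variable {S : Type u} [CommRing S] [IsLocalRing S] [IsNoetherianRing S] [Algebra Q S]

section

variable {B : Type u} [AddCommGroup B] [Module Q B] [Module S B] [IsScalarTower Q S B] (c : S)

variable (Q B) in
/-- Multiplication by `c`, as a `Q`-linear map. -/
def smulRes : B →ₗ[Q] B := (smulMap c B).restrictScalars Q

variable (Q B) in
/-- The quotient map modulo `c`, as a `Q`-linear map. -/
def mkRes : B →ₗ[Q] QuotSMulTop c B :=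
  (Submodule.mkQ (c • (⊤ : Submodule S B))).restrictScalars Q

theorem mkRes_surjective : Function.Surjective (mkRes Q B c) :=
  fun x => Submodule.Quotient.mk_surjective (c • (⊤ : Submodule S B)) x

theorem exact_smulMap_mkQ : Function.Exact (smulRes Q B c) (mkRes Q B c) := by
  intro x
  change (Submodule.mkQ (c • (⊤ : Submodule S B))) x = 0 ↔ _
  rw [Submodule.mkQ_apply, Submodule.Quotient.mk_eq_zero, ← range_smulMap]
  rfl

variable (N : Type u) [AddCommGroup N] [Module Q N]

theorem rTensor_smulMap (y : B ⊗[Q] N) :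
    (smulRes Q B c).rTensor N y = c • y := by
  induction y using TensorProduct.induction_on with
  | zero => rw [map_zero, smul_zero]
  | add a b ha hb => rw [map_add, smul_add, ha, hb]
  | tmul s n => rfl

/-- The quotient map from `B ⊗ N` to `(B / c B) ⊗ N`. -/
noncomputable def mkTensor : B ⊗[Q] N →ₗ[S] (QuotSMulTop c B) ⊗[Q] N :=
  AlgebraTensorModule.map (Submodule.mkQ (c • (⊤ : Submodule S B))) LinearMap.id

theorem ker_mkTensor :
    LinearMap.ker (mkTensor (B := B) c N) = c • (⊤ : Submodule S (B ⊗[Q] N)) := by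
  ext x
  refine Iff.trans ?_ (iff_of_eq (congrArg (x ∈ ·) (range_smulMap (B := B ⊗[Q] N) c)))
  refine (rTensor_exact N (exact_smulMap_mkQ c) (mkRes_surjective c) x).trans ?_
  exact exists_congr fun y => by rw [rTensor_smulMap]; rfl

theorem mkTensor_surjective : Function.Surjective (mkTensor (Q := Q) (B := B) c N) :=
  LinearMap.rTensor_surjective (R := Q) N (g := mkRes Q B c) (mkRes_surjective c)

/-- The quotient of `B ⊗ N` by `c B ⊗ N`. -/
noncomputable def quotSMulTopTensor :
    QuotSMulTop c (B ⊗[Q] N) ≃ₗ[S] (QuotSMulTop c B) ⊗[Q] N :=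
  (Submodule.quotEquivOfEq _ _ (ker_mkTensor c N).symm).trans
    ((mkTensor c N).quotKerEquivOfSurjective (mkTensor_surjective (Q := Q) c N))

end

/-- Weakly regular sequences with flat quotients stay weakly regular after tensoring. -/
theorem isWeaklyRegular_tensor (e : List Q) (he : ∀ a ∈ e, algebraMap Q S a ∈ maximalIdeal S)
    (hmax : (Ideal.ofList e).IsMaximal) (hQ : IsWeaklyRegular Q e)
    (N : Type u) [AddCommGroup N] [Module Q N]
    (l : List S) (hl : ∀ a ∈ l, a ∈ maximalIdeal S)
    (B : Type u) [AddCommGroup B] [Module Q B] [Module S B] [IsScalarTower Q S B]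
    [Module.Finite S B] (hB : IsWeaklyRegular B (l ++ e.map (algebraMap Q S))) :
    IsWeaklyRegular (B ⊗[Q] N) l := by
  induction l generalizing B with
  | nil => exact .nil _ _
  | cons c l ih =>
    rw [List.cons_append, isWeaklyRegular_cons_iff] at hB
    have ih' := ih (fun a ha => hl a (List.mem_cons_of_mem _ ha)) (QuotSMulTop c B) hB.2
    have hperm := isWeaklyRegular_of_perm_of_subset_maximalIdeal hB.2
      (List.perm_append_comm) (by
        intro a ha
        rcases List.mem_append.1 ha with ha | ha
        · exact hl a (List.mem_cons_of_mem _ ha)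
        · obtain ⟨b, hb, rfl⟩ := List.mem_map.1 ha
          exact he b hb)
    have hflat : Module.Flat Q (QuotSMulTop c B) :=
      (fl_bot (S := S) e he hmax hQ ((isWeaklyRegular_append_iff ..).1 hperm).1).flat
    refine .cons ?_ (((quotSMulTopTensor c N).isWeaklyRegular_congr l).2 ih')
    have := rTensor_injective_of_flat_coker (smulRes Q B c) (mkRes Q B c) hB.1
      (mkRes_surjective c)
      (exact_smulMap_mkQ c) N
    intro a b hab
    exact this ((rTensor_smulMap c N a).trans (hab.trans (rTensor_smulMap c N b).symm))

end

section PowerSeries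

variable {σ : Type} {V : Type u} [CommRing V]

/-- The power series without monomials prime to the variables in a list. -/
def varIdeal (V : Type u) [CommRing V] (l : List σ) : Ideal (MvPowerSeries σ V) where
  carrier := {f | ∀ d : σ →₀ ℕ, (∀ i ∈ l, d i = 0) → MvPowerSeries.coeff d f = 0}
  add_mem' := by
    intro f g hf hg d hd
    rw [map_add, hf d hd, hg d hd, add_zero]
  zero_mem' := fun d _ => map_zero _
  smul_mem' := by
    classical
    intro g f hf d hd
    rw [smul_eq_mul, MvPowerSeries.coeff_mul]
    refine Finset.sum_eq_zero fun p hp => ?_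
    rw [hf p.2 fun i hi => ?_, mul_zero]
    have := DFunLike.congr_fun (Finset.HasAntidiagonal.mem_antidiagonal.1 hp) i
    rw [Finsupp.add_apply, hd i hi] at this
    omega

theorem ofList_map_X (l : List σ) :
    Ideal.ofList (l.map (MvPowerSeries.X : σ → MvPowerSeries σ V)) = varIdeal V l := by
  classical
  induction l with
  | nil =>
    rw [List.map_nil, Ideal.ofList_nil, eq_comm, eq_bot_iff]
    intro f hf
    rw [Submodule.mem_bot]
    ext d
    exact hf d (by simp)
  | cons i l ih =>
    rw [List.map_cons, Ideal.ofList_cons, ih]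
    apply le_antisymm
    · refine sup_le ((Ideal.span_singleton_le_iff_mem _).2 fun d hd => ?_)
        fun f hf d hd => hf d fun j hj => hd j (List.mem_cons_of_mem _ hj)
      rw [MvPowerSeries.coeff_X, if_neg]
      rintro rfl
      simpa using hd i (List.mem_cons_self ..)
    · intro f hf
      let f₁ : MvPowerSeries σ V := fun d => if d i = 0 then MvPowerSeries.coeff d f else 0
      have h₁ : ∀ d, MvPowerSeries.coeff d f₁ = if d i = 0 then MvPowerSeries.coeff d f else 0 :=
        fun d => rfl
      have e1 : f₁ ∈ varIdeal V l := by
        intro d hd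
        rw [h₁]
        split_ifs with h
        · exact hf d fun j hj => by
            rcases List.mem_cons.1 hj with rfl | hj
            · exact h
            · exact hd j hj
        · rfl
      have e2 : MvPowerSeries.X i ∣ f - f₁ := by
        rw [MvPowerSeries.X_dvd_iff]
        intro d hd
        rw [map_sub, h₁, if_pos hd, sub_self]
      rw [← sub_add_cancel f f₁]
      exact Submodule.add_mem_sup (Ideal.mem_span_singleton.2 e2) e1

theorem isSMulRegular_quotient_ofList {S : Type*} [CommRing S] (l : List S) (a : S)
    (h : ∀ f, a * f ∈ Ideal.ofList l → f ∈ Ideal.ofList l) :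
    IsSMulRegular (S ⧸ (Ideal.ofList l • ⊤ : Submodule S S)) a := by
  rw [isSMulRegular_iff_right_eq_zero_of_smul]
  intro x hx
  obtain ⟨f, rfl⟩ := Submodule.Quotient.mk_surjective _ x
  rw [← Submodule.Quotient.mk_smul, Submodule.Quotient.mk_eq_zero] at hx
  rw [Submodule.Quotient.mk_eq_zero]
  simp only [smul_eq_mul, Ideal.mul_top] at hx ⊢
  exact h f hx

theorem isWeaklyRegular_concat {S : Type*} [CommRing S] (l : List S) (a : S)
    (hl : IsWeaklyRegular S l) (h : ∀ f, a * f ∈ Ideal.ofList l → f ∈ Ideal.ofList l) :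
    IsWeaklyRegular S (l ++ [a]) :=
  (isWeaklyRegular_append_iff ..).2 ⟨hl, (isWeaklyRegular_singleton_iff ..).2
    (isSMulRegular_quotient_ofList l a h)⟩

theorem isWeaklyRegular_X (l : List σ) (hl : l.Nodup) :
    IsWeaklyRegular (MvPowerSeries σ V) (l.map (MvPowerSeries.X : σ → MvPowerSeries σ V)) := by
  classical
  induction l using List.reverseRecOn with
  | nil => exact .nil _ _
  | append_singleton l i ih =>
    rw [List.map_append, List.map_singleton]
    rw [List.nodup_append] at hl
    refine isWeaklyRegular_concat _ _ (ih hl.1) fun f hf => ?_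
    rw [ofList_map_X] at hf ⊢
    intro d hd
    have := hf (Finsupp.single i 1 + d) fun j hj => by
      rw [Finsupp.add_apply, hd j hj, Finsupp.single_apply, if_neg, add_zero]
      exact fun h => hl.2.2 j hj i (by simp) h.symm
    rwa [MvPowerSeries.X, MvPowerSeries.coeff_add_monomial_mul, one_mul] at this

theorem isWeaklyRegular_X_C (l : List σ) (hl : l.Nodup) (π : V) (hπ : IsSMulRegular V π) :
    IsWeaklyRegular (MvPowerSeries σ V)
      (l.map (MvPowerSeries.X : σ → MvPowerSeries σ V) ++ [MvPowerSeries.C π]) := by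
  refine isWeaklyRegular_concat _ _ (isWeaklyRegular_X l hl) fun f hf => ?_
  rw [ofList_map_X] at hf ⊢
  intro d hd
  have := hf d hd
  rw [MvPowerSeries.coeff_C_mul] at this
  exact hπ (this.trans (smul_zero π).symm)

theorem mem_ofList_X_iff (l : List σ) (hl : ∀ i, i ∈ l) (f : MvPowerSeries σ V) :
    f ∈ Ideal.ofList (l.map (MvPowerSeries.X : σ → MvPowerSeries σ V)) ↔
      MvPowerSeries.constantCoeff f = 0 := by
  rw [ofList_map_X]
  constructor
  · intro h
    exact h 0 (by simp)
  · intro h d hd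
    obtain rfl : d = 0 := by
      ext i
      exact hd i (hl i)
    exact h

variable [IsLocalRing V]

theorem mem_maximalIdeal_mvPowerSeries (f : MvPowerSeries σ V) :
    f ∈ maximalIdeal (MvPowerSeries σ V) ↔ MvPowerSeries.constantCoeff f ∈ maximalIdeal V := by
  rw [mem_maximalIdeal, mem_nonunits_iff, MvPowerSeries.isUnit_iff_constantCoeff,
    mem_maximalIdeal, mem_nonunits_iff]

theorem maximalIdeal_mvPowerSeries (l : List σ) (hl : ∀ i, i ∈ l) (π : V)
    (hπ : maximalIdeal V = Ideal.span {π}) :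
    Ideal.ofList (l.map (MvPowerSeries.X : σ → MvPowerSeries σ V) ++ [MvPowerSeries.C π]) =
      maximalIdeal (MvPowerSeries σ V) := by
  ext f
  rw [mem_maximalIdeal_mvPowerSeries, Ideal.ofList_append, Ideal.ofList_singleton]
  constructor
  · intro hf
    obtain ⟨a, ha, b, hb, rfl⟩ := Submodule.mem_sup.1 hf
    rw [mem_ofList_X_iff l hl] at ha
    obtain ⟨c, rfl⟩ := Ideal.mem_span_singleton.1 hb
    rw [map_add, ha, zero_add, map_mul, MvPowerSeries.constantCoeff_C, hπ]
    exact Ideal.mul_mem_right _ _ (Ideal.mem_span_singleton_self π)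
  · intro hf
    rw [hπ] at hf
    obtain ⟨c, hc⟩ := Ideal.mem_span_singleton.1 hf
    rw [← sub_add_cancel f (MvPowerSeries.C (MvPowerSeries.constantCoeff f))]
    refine Submodule.add_mem_sup ?_ ?_
    · rw [mem_ofList_X_iff l hl, map_sub, MvPowerSeries.constantCoeff_C, sub_self]
    · rw [hc, map_mul]
      exact Ideal.mul_mem_right _ _ (Ideal.mem_span_singleton_self _)

end PowerSeries

section Diagonal

variable {m : ℕ} {V : Type u} [CommRing V]

/-- Power series in two sets of variables as an algebra over the power series in the first set. -/
noncomputable instance diagAlgebra :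
    Algebra (MvPowerSeries (Fin m) V) (MvPowerSeries (Fin m ⊕ Fin m) V) :=
  (MvPowerSeries.rename (R := V) (Sum.inl : Fin m → Fin m ⊕ Fin m)).toRingHom.toAlgebra

/-- The embedding of the power series in the second set of variables. -/
noncomputable def diagRight (m : ℕ) (V : Type u) [CommRing V] :
    MvPowerSeries (Fin m) V →+* MvPowerSeries (Fin m ⊕ Fin m) V :=
  (MvPowerSeries.rename (R := V) (Sum.inr : Fin m → Fin m ⊕ Fin m)).toRingHom

/-- The evaluation on the diagonal. -/
noncomputable def diagEval (m : ℕ) (V : Type u) [CommRing V] :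
    MvPowerSeries (Fin m ⊕ Fin m) V →+* MvPowerSeries (Fin m) V :=
  (MvPowerSeries.rename (R := V) (Sum.elim id id : Fin m ⊕ Fin m → Fin m)).toRingHom

theorem diag_algebraMap_apply (f : MvPowerSeries (Fin m) V) :
    algebraMap (MvPowerSeries (Fin m) V) (MvPowerSeries (Fin m ⊕ Fin m) V) f =
      MvPowerSeries.rename Sum.inl f := rfl

theorem diagRight_apply (f : MvPowerSeries (Fin m) V) :
    diagRight m V f = MvPowerSeries.rename Sum.inr f := rfl

theorem diagEval_apply (f : MvPowerSeries (Fin m ⊕ Fin m) V) :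
    diagEval m V f = MvPowerSeries.rename (Sum.elim id id) f := rfl

theorem diagEval_algebraMap (f : MvPowerSeries (Fin m) V) :
    diagEval m V (algebraMap _ _ f) = f := by
  rw [diagEval_apply, diag_algebraMap_apply, MvPowerSeries.rename_rename]
  exact MvPowerSeries.rename_id_apply f

theorem diagEval_diagRight (f : MvPowerSeries (Fin m) V) :
    diagEval m V (diagRight m V f) = f := by
  rw [diagEval_apply, diagRight_apply, MvPowerSeries.rename_rename]
  exact MvPowerSeries.rename_id_apply f

/-- The variables. -/
noncomputable def varX (m : ℕ) (V : Type u) [CommRing V] : List (MvPowerSeries (Fin m) V) :=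
  (List.finRange m).map MvPowerSeries.X

/-- The first set of variables. -/
noncomputable def varL (m : ℕ) (V : Type u) [CommRing V] :
    List (MvPowerSeries (Fin m ⊕ Fin m) V) :=
  ((List.finRange m).map Sum.inl).map MvPowerSeries.X

/-- The second set of variables. -/
noncomputable def varR (m : ℕ) (V : Type u) [CommRing V] :
    List (MvPowerSeries (Fin m ⊕ Fin m) V) :=
  ((List.finRange m).map Sum.inr).map MvPowerSeries.X

/-- The differences of corresponding variables. -/
noncomputable def varD (m : ℕ) (V : Type u) [CommRing V] :
    List (MvPowerSeries (Fin m ⊕ Fin m) V) :=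
  (List.finRange m).map fun i => MvPowerSeries.X (Sum.inr i) - MvPowerSeries.X (Sum.inl i)

theorem map_varX_left : (varX m V).map (algebraMap _ _) = varL m V := by
  rw [varX, varL, List.map_map, List.map_map]
  refine List.map_congr_left fun i _ => ?_
  exact MvPowerSeries.rename_X ..

theorem map_varX_right : (varX m V).map (diagRight m V) = varR m V := by
  rw [varX, varR, List.map_map, List.map_map]
  refine List.map_congr_left fun i _ => ?_
  exact MvPowerSeries.rename_X ..

theorem isWeaklyRegular_right_left (π : V) (hπ : IsSMulRegular V π) :
    IsWeaklyRegular (MvPowerSeries (Fin m ⊕ Fin m) V)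
      (varR m V ++ (varL m V ++ [MvPowerSeries.C π])) := by
  rw [← List.append_assoc, varR, varL, ← List.map_append]
  refine isWeaklyRegular_X_C _ ?_ π hπ
  refine List.Nodup.append ((List.nodup_finRange m).map Sum.inr_injective)
    ((List.nodup_finRange m).map Sum.inl_injective) ?_
  intro a h1 h2
  obtain ⟨i, -, rfl⟩ := List.mem_map.1 h1
  obtain ⟨j, -, hj⟩ := List.mem_map.1 h2
  cases hj

theorem isWeaklyRegular_left_right (π : V) (hπ : IsSMulRegular V π) :
    IsWeaklyRegular (MvPowerSeries (Fin m ⊕ Fin m) V)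
      (varL m V ++ (varR m V ++ [MvPowerSeries.C π])) := by
  rw [← List.append_assoc, varR, varL, ← List.map_append]
  refine isWeaklyRegular_X_C _ ?_ π hπ
  refine List.Nodup.append ((List.nodup_finRange m).map Sum.inl_injective)
    ((List.nodup_finRange m).map Sum.inr_injective) ?_
  intro a h1 h2
  obtain ⟨i, -, rfl⟩ := List.mem_map.1 h1
  obtain ⟨j, -, hj⟩ := List.mem_map.1 h2
  cases hj

theorem isWeaklyRegular_left_diag (π : V) (hπ : IsSMulRegular V π) :
    IsWeaklyRegular (MvPowerSeries (Fin m ⊕ Fin m) V)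
      (varL m V ++ (varD m V ++ [MvPowerSeries.C π])) := by
  have h := isWeaklyRegular_left_right (m := m) π hπ
  rw [isWeaklyRegular_append_iff'] at h ⊢
  refine ⟨h.1, ?_⟩
  convert h.2 using 1
  rw [List.map_append, List.map_append, varD, varR, List.map_map, List.map_map, List.map_map]
  congr 1
  refine List.map_congr_left fun i _ => ?_
  rw [Function.comp_apply, Function.comp_apply, Function.comp_apply, map_sub, sub_eq_self,
    Ideal.Quotient.eq_zero_iff_mem]
  refine Ideal.subset_span ?_
  simp [varL]

variable [IsLocalRing V] [IsNoetherianRing V]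

theorem ofList_varX (π : V) (hm : maximalIdeal V = Ideal.span {π}) :
    Ideal.ofList (varX m V ++ [MvPowerSeries.C π]) = maximalIdeal (MvPowerSeries (Fin m) V) :=
  maximalIdeal_mvPowerSeries _ (fun i => List.mem_finRange i) π hm

theorem algebraMap_mem_maximalIdeal (f : MvPowerSeries (Fin m) V) (hf : f ∈ maximalIdeal _) :
    algebraMap _ (MvPowerSeries (Fin m ⊕ Fin m) V) f ∈ maximalIdeal _ := by
  rw [mem_maximalIdeal_mvPowerSeries] at hf ⊢
  rwa [diag_algebraMap_apply, MvPowerSeries.constantCoeff_rename]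

theorem diagRight_mem_maximalIdeal (f : MvPowerSeries (Fin m) V) (hf : f ∈ maximalIdeal _) :
    diagRight m V f ∈ maximalIdeal _ := by
  rw [mem_maximalIdeal_mvPowerSeries] at hf ⊢
  rwa [diagRight_apply, MvPowerSeries.constantCoeff_rename]

theorem varD_mem (a : MvPowerSeries (Fin m ⊕ Fin m) V) (ha : a ∈ varD m V) :
    a ∈ maximalIdeal _ := by
  obtain ⟨i, -, rfl⟩ := List.mem_map.1 ha
  rw [mem_maximalIdeal_mvPowerSeries, map_sub, MvPowerSeries.constantCoeff_X,
    MvPowerSeries.constantCoeff_X, sub_zero]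
  exact zero_mem _

section

variable (π : V) (hπ : IsSMulRegular V π) (hm : maximalIdeal V = Ideal.span {π})
include hπ hm

theorem isWeaklyRegular_tensor_diag (l : List (MvPowerSeries (Fin m ⊕ Fin m) V))
    (hl : ∀ a ∈ l, a ∈ maximalIdeal (MvPowerSeries (Fin m ⊕ Fin m) V))
    (h : IsWeaklyRegular (MvPowerSeries (Fin m ⊕ Fin m) V)
      (l ++ (varL m V ++ [MvPowerSeries.C π])))
    (N : Type u) [AddCommGroup N] [Module (MvPowerSeries (Fin m) V) N] :
    IsWeaklyRegular (MvPowerSeries (Fin m ⊕ Fin m) V ⊗[MvPowerSeries (Fin m) V] N) l := by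
  have hspan := ofList_varX (m := m) π hm
  refine isWeaklyRegular_tensor (varX m V ++ [MvPowerSeries.C π]) (fun a ha => ?_) ?_ ?_ N l hl
    (MvPowerSeries (Fin m ⊕ Fin m) V) ?_
  · exact algebraMap_mem_maximalIdeal a (hspan ▸ Ideal.subset_span ha)
  · rw [hspan]
    infer_instance
  · exact isWeaklyRegular_X_C _ (List.nodup_finRange m) π hπ
  · rw [List.map_append, map_varX_left, List.map_singleton, diag_algebraMap_apply,
      MvPowerSeries.rename_C]
    exact h

theorem isWeaklyRegular_varD (N : Type u) [AddCommGroup N] [Module (MvPowerSeries (Fin m) V) N] :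
    IsWeaklyRegular (MvPowerSeries (Fin m ⊕ Fin m) V ⊗[MvPowerSeries (Fin m) V] N)
      (varD m V) := by
  refine isWeaklyRegular_tensor_diag π hπ hm _ varD_mem ?_ N
  refine isWeaklyRegular_of_perm_of_subset_maximalIdeal (isWeaklyRegular_left_diag π hπ) ?_ ?_
  · rw [← List.append_assoc, ← List.append_assoc]
    exact List.Perm.append_right _ List.perm_append_comm
  · have hspan := ofList_varX (m := m) π hm
    intro a ha
    rcases List.mem_append.1 ha with ha | ha
    · rw [← map_varX_left] at ha
      obtain ⟨b, hb, rfl⟩ := List.mem_map.1 ha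
      exact algebraMap_mem_maximalIdeal b
        (hspan ▸ Ideal.subset_span (List.mem_append_left _ hb))
    · rcases List.mem_append.1 ha with ha | ha
      · exact varD_mem a ha
      · rw [List.mem_singleton] at ha
        rw [ha, mem_maximalIdeal_mvPowerSeries, MvPowerSeries.constantCoeff_C, hm]
        exact Ideal.mem_span_singleton_self π

theorem diagonalPair :
    DiagonalPair (diagRight m V) (MvPowerSeries.C π) (varX m V) := by
  have hspan := ofList_varX (m := m) π hm
  have hperm : (varX m V ++ [MvPowerSeries.C π]).Perm (MvPowerSeries.C π :: varX m V) :=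
    List.perm_append_singleton _ _
  have hreg : IsWeaklyRegular (MvPowerSeries (Fin m) V) (varX m V ++ [MvPowerSeries.C π]) :=
    isWeaklyRegular_X_C _ (List.nodup_finRange m) π hπ
  have hmem : ∀ a ∈ varX m V ++ [MvPowerSeries.C π], a ∈ maximalIdeal (MvPowerSeries (Fin m) V) :=
    fun a ha => hspan ▸ Ideal.subset_span ha
  have hflat : Module.Flat (MvPowerSeries (Fin m) V) (MvPowerSeries (Fin m ⊕ Fin m) V) := by
    refine Fl.flat (fl_bot (S := MvPowerSeries (Fin m ⊕ Fin m) V) (varX m V ++ [MvPowerSeries.C π])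
      (fun a ha => algebraMap_mem_maximalIdeal a (hmem a ha)) ?_ hreg ?_)
    · rw [hspan]
      infer_instance
    · rw [List.map_append, map_varX_left, List.map_singleton, diag_algebraMap_apply,
        MvPowerSeries.rename_C]
      exact isWeaklyRegular_X_C (V := V) ((List.finRange m).map (Sum.inl : _ → Fin m ⊕ Fin m))
        ((List.nodup_finRange m).map Sum.inl_injective) π hπ
  have hwr : ∀ (N : Type u) [AddCommGroup N] [Module (MvPowerSeries (Fin m) V) N],
      IsWeaklyRegular (MvPowerSeries (Fin m ⊕ Fin m) V ⊗[MvPowerSeries (Fin m) V] N)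
        ((varX m V).map (diagRight m V)) := by
    intro N _ _
    refine isWeaklyRegular_tensor_diag π hπ hm _ (fun a ha => ?_) ?_ N
    · obtain ⟨b, hb, rfl⟩ := List.mem_map.1 ha
      exact diagRight_mem_maximalIdeal b (hmem b (List.mem_append_left _ hb))
    · rw [map_varX_right]
      exact isWeaklyRegular_right_left π hπ
  have hmap : diagRight m V (MvPowerSeries.C π) =
      algebraMap (MvPowerSeries (Fin m) V) _ (MvPowerSeries.C π) := by
    rw [diag_algebraMap_apply, diagRight_apply, MvPowerSeries.rename_C, MvPowerSeries.rename_C]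
  constructor
  · exact hflat
  · exact fun a ha => diagRight_mem_maximalIdeal a (hmem a (hperm.symm.subset ha))
  · rw [← hspan]
    exact congrArg Ideal.span (Set.ext fun a => hperm.symm.mem_iff)
  · exact isWeaklyRegular_of_perm_of_subset_maximalIdeal hreg hperm hmem
  · exact hmap
  · intro N _ _ _
    exact hwr N
  · intro N _ _ _ hN
    rw [List.map_cons, hmap]
    refine .cons ?_ ?_
    · have := hN.lTensor (MvPowerSeries (Fin m ⊕ Fin m) V)
      exact (isSMulRegular_algebraMap_iff _).2 this
    · rw [LinearEquiv.isWeaklyRegular_congr (QuotSMulTop.algebraMapTensorEquivTensorQuotSMulTop ..)]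
      exact hwr _

end

end Diagonal

section Compare

variable {S T : Type*} [CommRing S] [CommRing T] (ψ : S →+* T) {ι : ℕ → Type}
  [∀ j, Fintype (ι j)] (d : ∀ j, Matrix (ι (j + 1)) (ι j) S)
  {B : Type*} [AddCommGroup B] [Module S B] [Module T B]

/-- Change of rings for homology. -/
def hqRes (h : ∀ (s : S) (b : B), s • b = ψ s • b) (j : ℕ) :
    hq d B j →ₛₗ[ψ] hq (fun j => (d j).map ψ) B j :=
  Submodule.liftQ _
    { toFun := fun x => Hm.mk (fun j => mv ((d j).map ψ) B) j x.1
        ((mv_compHom ψ h (d (j + 1)) x.1).trans x.2)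
      map_add' := fun _ _ => rfl
      map_smul' := fun s x => by
        rw [← Hm.mk_smul]
        congr 1
        ext i
        exact h s (x.1 i) }
    (by
      rintro ⟨x, hx⟩ ⟨y, hy⟩
      subst hy
      exact (Hm.mk_eq_zero (d := fun j => mv ((d j).map ψ) B)).2 ⟨y, mv_compHom ψ h (d j) y⟩)

theorem hqRes_bijective (h : ∀ (s : S) (b : B), s • b = ψ s • b) (j : ℕ) :
    Function.Bijective (hqRes ψ d h j) := by
  constructor
  · rw [injective_iff_map_eq_zero]
    intro z hz
    obtain ⟨x, hx, rfl⟩ := Hm.exists_mk z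
    obtain ⟨y, hy⟩ := (Hm.mk_eq_zero (d := fun j => mv ((d j).map ψ) B)).1 hz
    exact (Hm.mk_eq_zero (d := fun j => mv (d j) B)).2 ⟨y, (mv_compHom ψ h (d j) y).symm.trans hy⟩
  · intro z
    obtain ⟨x, hx, rfl⟩ := Hm.exists_mk z
    exact ⟨Hm.mk (fun j => mv (d j) B) j x ((mv_compHom ψ h (d (j + 1)) x).symm.trans hx), rfl⟩

theorem length_hqRes (hψ : Function.Surjective ψ) (h : ∀ (s : S) (b : B), s • b = ψ s • b) (j : ℕ) :
    Module.length T (hq (fun j => (d j).map ψ) B j) = Module.length S (hq d B j) := by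
  have : RingHomSurjective ψ := ⟨hψ⟩
  rw [Module.length, Module.length, WithBot.unbot_inj, eq_comm,
    Order.krullDim_eq_of_orderIso
      (Submodule.orderIsoMapComapOfBijective (hqRes ψ d h j) (hqRes_bijective ψ d h j))]

theorem isFiniteLength_hqRes (hψ : Function.Surjective ψ)
    (h : ∀ (s : S) (b : B), s • b = ψ s • b) (j : ℕ) :
    IsFiniteLength T (hq (fun j => (d j).map ψ) B j) ↔ IsFiniteLength S (hq d B j) := by
  rw [← Module.length_ne_top_iff, ← Module.length_ne_top_iff, length_hqRes ψ d hψ h]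

theorem subsingleton_hqRes
    (h : ∀ (s : S) (b : B), s • b = ψ s • b) (j : ℕ) :
    Subsingleton (hq (fun j => (d j).map ψ) B j) ↔ Subsingleton (hq d B j) :=
  (Equiv.ofBijective _ (hqRes_bijective ψ d h j)).subsingleton_congr.symm

end Compare

section Diagonal

variable {m : ℕ} {V : Type u} [CommRing V] [IsLocalRing V] [IsNoetherianRing V]

theorem diagEval_varD (a : MvPowerSeries (Fin m ⊕ Fin m) V) (ha : a ∈ Ideal.ofList (varD m V)) :
    diagEval m V a = 0 := by
  have : Ideal.ofList (varD m V) ≤ RingHom.ker (diagEval m V) := by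
    refine Ideal.span_le.2 fun a ha => ?_
    obtain ⟨i, -, rfl⟩ := List.mem_map.1 ha
    rw [SetLike.mem_coe, RingHom.mem_ker, diagEval_apply, map_sub, MvPowerSeries.rename_X,
      MvPowerSeries.rename_X, Sum.elim_inl, Sum.elim_inr, sub_self]
  exact this ha

theorem exists_sub_mem_varD (s : MvPowerSeries (Fin m ⊕ Fin m) V) :
    ∃ q : MvPowerSeries (Fin m) V, s - algebraMap _ _ q ∈ Ideal.ofList (varD m V) := by
  set J := Ideal.ofList (varD m V) with hJ
  have hJle : J ≤ maximalIdeal _ := Ideal.span_le.2 varD_mem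
  have hJtop : J ≠ ⊤ := fun h => (maximalIdeal.isMaximal _).ne_top (top_le_iff.1 (h ▸ hJle))
  have : Nontrivial (MvPowerSeries (Fin m ⊕ Fin m) V ⧸ J) := Ideal.Quotient.nontrivial_iff.2 hJtop
  have : IsLocalRing (MvPowerSeries (Fin m ⊕ Fin m) V ⧸ J) :=
    .of_surjective' (Ideal.Quotient.mk J) Ideal.Quotient.mk_surjective
  let g : MvPowerSeries (Fin m) V →+* MvPowerSeries (Fin m ⊕ Fin m) V ⧸ J :=
    (Ideal.Quotient.mk J).comp (algebraMap _ _)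
  set I : Ideal (MvPowerSeries (Fin m) V) := .span (.range MvPowerSeries.X) with hI
  have hgX : ∀ i, g (MvPowerSeries.X i) = Ideal.Quotient.mk J (MvPowerSeries.X (Sum.inl i)) :=
    fun i => congrArg (Ideal.Quotient.mk J) (MvPowerSeries.rename_X ..)
  have hgX' : ∀ i, g (MvPowerSeries.X i) = Ideal.Quotient.mk J (MvPowerSeries.X (Sum.inr i)) := by
    intro i
    rw [hgX, eq_comm, Ideal.Quotient.eq]
    exact Ideal.subset_span (List.mem_map.2 ⟨i, List.mem_finRange i, rfl⟩)
  have hXmem : ∀ k : Fin m ⊕ Fin m, Ideal.Quotient.mk J (MvPowerSeries.X k) ∈ I.map g := by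
    rintro (i | i)
    · rw [← hgX]
      exact Ideal.mem_map_of_mem _ (Ideal.subset_span ⟨i, rfl⟩)
    · rw [← hgX']
      exact Ideal.mem_map_of_mem _ (Ideal.subset_span ⟨i, rfl⟩)
  have hne : I.map g ≠ ⊤ := by
    intro h
    have hle : I.map g ≤ maximalIdeal _ := by
      rw [hI, Ideal.map_span]
      refine Ideal.span_le.2 ?_
      rintro _ ⟨_, ⟨i, rfl⟩, rfl⟩
      rw [hgX]
      intro hu
      have hu' : IsUnit (MvPowerSeries.X (Sum.inl i) : MvPowerSeries (Fin m ⊕ Fin m) V) := by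
        obtain ⟨v, hv⟩ := isUnit_iff_exists_inv.1 hu
        obtain ⟨v, rfl⟩ := Ideal.Quotient.mk_surjective v
        rw [← map_mul, ← map_one (Ideal.Quotient.mk J), Ideal.Quotient.eq] at hv
        by_contra hnu
        have h1 := hJle hv
        have h2 : (MvPowerSeries.X (Sum.inl i) : MvPowerSeries (Fin m ⊕ Fin m) V) * v ∈
            maximalIdeal _ := Ideal.mul_mem_right _ _ hnu
        have h3 := sub_mem h2 h1
        rw [sub_sub_cancel] at h3
        exact h3 isUnit_one
      rw [MvPowerSeries.isUnit_iff_constantCoeff, MvPowerSeries.constantCoeff_X] at hu'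
      exact not_isUnit_zero hu'
    exact (maximalIdeal.isMaximal _).ne_top (top_le_iff.1 (h ▸ hle))
  have : IsHausdorff (I.map g) (MvPowerSeries (Fin m ⊕ Fin m) V ⧸ J) :=
    IsHausdorff.of_isLocalRing _ _ hne
  have hsurj : Function.Surjective g := by
    refine surjective_of_mk_map_comp_surjective (I := I) g ?_
    intro y
    obtain ⟨y, rfl⟩ := Ideal.Quotient.mk_surjective y
    obtain ⟨f, rfl⟩ := Ideal.Quotient.mk_surjective y
    refine ⟨MvPowerSeries.C (MvPowerSeries.constantCoeff f), ?_⟩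
    rw [RingHom.comp_apply, eq_comm, Ideal.Quotient.eq]
    have hgC : g (MvPowerSeries.C (MvPowerSeries.constantCoeff f)) =
        Ideal.Quotient.mk J (MvPowerSeries.C (MvPowerSeries.constantCoeff f)) :=
      congrArg (Ideal.Quotient.mk J) (MvPowerSeries.rename_C ..)
    rw [hgC, ← map_sub]
    have hf : f - MvPowerSeries.C (MvPowerSeries.constantCoeff f) ∈
        Ideal.ofList (((List.finRange m).map Sum.inl ++ (List.finRange m).map Sum.inr).map
          (MvPowerSeries.X : _ → MvPowerSeries (Fin m ⊕ Fin m) V)) := by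
      rw [mem_ofList_X_iff, map_sub, MvPowerSeries.constantCoeff_C, sub_self]
      rintro (i | i) <;> simp
    have hle : Ideal.ofList (((List.finRange m).map Sum.inl ++ (List.finRange m).map Sum.inr).map
          (MvPowerSeries.X : _ → MvPowerSeries (Fin m ⊕ Fin m) V)) ≤
        (I.map g).comap (Ideal.Quotient.mk J) := by
      refine Ideal.span_le.2 fun a ha => ?_
      obtain ⟨k, -, rfl⟩ := List.mem_map.1 ha
      exact hXmem k
    exact hle hf
  obtain ⟨q, hq⟩ := hsurj (Ideal.Quotient.mk J s)
  exact ⟨q, Ideal.Quotient.eq.1 hq.symm⟩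

variable (N : Type u) [AddCommGroup N] [Module (MvPowerSeries (Fin m) V) N]
  [Module (MvPowerSeries (Fin m ⊕ Fin m) V) N]

/-- Restriction to the diagonal recovers a module. -/
theorem exists_diagonal_equiv
    (h : ∀ (s : MvPowerSeries (Fin m ⊕ Fin m) V) (n : N), s • n = diagEval m V s • n) :
    Nonempty (((MvPowerSeries (Fin m ⊕ Fin m) V ⊗[MvPowerSeries (Fin m) V] N) ⧸
      (Ideal.ofList (varD m V) • ⊤ : Submodule (MvPowerSeries (Fin m ⊕ Fin m) V)
        (MvPowerSeries (Fin m ⊕ Fin m) V ⊗[MvPowerSeries (Fin m) V] N)))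
      ≃ₗ[MvPowerSeries (Fin m ⊕ Fin m) V] N) := by
  have : IsScalarTower (MvPowerSeries (Fin m) V) (MvPowerSeries (Fin m ⊕ Fin m) V) N := by
    refine ⟨fun q s n => ?_⟩
    rw [h, h, Algebra.smul_def, map_mul, diagEval_algebraMap, mul_smul]
  let μ : MvPowerSeries (Fin m ⊕ Fin m) V ⊗[MvPowerSeries (Fin m) V] N
      →ₗ[MvPowerSeries (Fin m ⊕ Fin m) V] N :=
    LinearMap.liftBaseChange (MvPowerSeries (Fin m ⊕ Fin m) V) LinearMap.id
  have hμ : ∀ s (n : N), μ (s ⊗ₜ n) = s • n := fun s n => LinearMap.liftBaseChange_tmul ..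
  have hsurj : Function.Surjective μ := fun n => ⟨1 ⊗ₜ n, by rw [hμ, one_smul]⟩
  have hker : LinearMap.ker μ = Ideal.ofList (varD m V) • ⊤ := by
    apply le_antisymm
    · have key : ∀ t, t - 1 ⊗ₜ μ t ∈ (Ideal.ofList (varD m V) •
          (⊤ : Submodule (MvPowerSeries (Fin m ⊕ Fin m) V)
        (MvPowerSeries (Fin m ⊕ Fin m) V ⊗[MvPowerSeries (Fin m) V] N))) := by
        intro t
        induction t using TensorProduct.induction_on with
        | zero => 
          rw [map_zero, TensorProduct.tmul_zero, sub_zero]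
          exact zero_mem _
        | add a b ha hb =>
          rw [map_add, TensorProduct.tmul_add, add_sub_add_comm]
          exact add_mem ha hb
        | tmul s n =>
          obtain ⟨q, hq⟩ := exists_sub_mem_varD s
          have h1 : s • n = q • n := by
            rw [← sub_add_cancel s (algebraMap _ _ q), add_smul, h, diagEval_varD _ hq, zero_smul,
              zero_add, algebraMap_smul]
          rw [hμ, h1, ← TensorProduct.smul_tmul, ← TensorProduct.sub_tmul, Algebra.smul_def,
            mul_one]
          have := Submodule.smul_mem_smul hq (Submodule.mem_top
            (R := MvPowerSeries (Fin m ⊕ Fin m) V) (x := (1 : MvPowerSeries (Fin m ⊕ Fin m) V)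
              ⊗ₜ[MvPowerSeries (Fin m) V] n))
          rwa [TensorProduct.smul_tmul', smul_eq_mul, mul_one] at this
      intro t ht
      have := key t
      rwa [LinearMap.mem_ker.1 ht, TensorProduct.tmul_zero, sub_zero] at this
    · refine Submodule.smul_le.2 fun a ha t _ => ?_
      rw [LinearMap.mem_ker, map_smul, h, diagEval_varD a ha, zero_smul]
  exact ⟨(Submodule.quotEquivOfEq _ _ hker.symm).trans (μ.quotKerEquivOfSurjective hsurj)⟩

end Diagonal

/-- Rigidity over power series rings, for complexes of bounded length. -/
theorem rigid_powerSeries {m : ℕ} {V : Type u} [CommRing V] [IsLocalRing V] [IsNoetherianRing V]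
    (π : V) (hπ : IsSMulRegular V π) (hm : maximalIdeal V = Ideal.span {π})
    {ι : ℕ → Type} [∀ j, Fintype (ι j)] [IsEmpty (ι 0)]
    (d : ∀ j, Matrix (ι (j + 1)) (ι j) (MvPowerSeries (Fin m) V))
    (hd : ∀ j, d (j + 1) * d j = 0) (K : ℕ) (htop : d (K + 2) = 0)
    (hQ : ∀ j ≤ K, Subsingleton (hq d (MvPowerSeries (Fin m) V) j))
    (N : Type u) [AddCommGroup N] [Module (MvPowerSeries (Fin m) V) N]
    [Module.Finite (MvPowerSeries (Fin m) V) N]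
    (hfl : ∀ j ≤ K, IsFiniteLength (MvPowerSeries (Fin m) V) (hq d N j))
    (hsum : altSum (fun j => ell (MvPowerSeries (Fin m) V) (hq d N j)) (K + 1) ≤ 0) :
    ∀ j ≤ K, Subsingleton (hq d N j) := by
  let _ : Module (MvPowerSeries (Fin m ⊕ Fin m) V) N := Module.compHom N (diagEval m V)
  have h : ∀ (s : MvPowerSeries (Fin m ⊕ Fin m) V) (n : N), s • n = diagEval m V s • n :=
    fun _ _ => rfl
  have h' : ∀ (q : MvPowerSeries (Fin m) V) (n : N), q • n = diagRight m V q • n := fun q n => by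
    rw [h, diagEval_diagRight]
  have hsurj : Function.Surjective (diagEval m V) := fun q => ⟨_, diagEval_diagRight q⟩
  obtain ⟨e⟩ := exists_diagonal_equiv N h
  have hlen : ∀ j, Module.length (MvPowerSeries (Fin m ⊕ Fin m) V)
      (hq (fun j => (d j).map (diagRight m V)) N j) =
        Module.length (MvPowerSeries (Fin m) V) (hq d N j) := by
    intro j
    have h1 := length_hqRes (diagEval m V) (fun j => (d j).map (diagRight m V)) hsurj h j
    have h2 : (fun j => ((d j).map (diagRight m V)).map (diagEval m V)) = d := by
      ext j a b
      simp [diagEval_diagRight]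
    rw [h2] at h1
    exact h1.symm
  have hlen' := fun j => (hqCongr (fun j => (d j).map (diagRight m V)) e j).length_eq
  have key := (diagonalPair (m := m) π hπ hm).rigid d hd K htop hQ (varD m V) varD_mem N
    (isWeaklyRegular_varD π hπ hm N) (fun j hj => ?_) ?_
  · intro j hj
    have := key j hj
    have h3 := (hqCongr (fun j => (d j).map (diagRight m V)) e j).symm.toEquiv.subsingleton
    exact (subsingleton_hqRes (diagRight m V) d h' j).1 h3
  · rw [← Module.length_ne_top_iff, hlen' j, hlen j, Module.length_ne_top_iff]
    exact hfl j hj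
  · refine le_of_eq_of_le (altSum_congr fun j _ => ?_) hsum
    rw [ell, hlen' j, hlen j, ell]

section Gysin

theorem ell_range_add_ell_ker {S : Type*} [CommRing S] {A B : Type*}
    [AddCommGroup A] [Module S A] [AddCommGroup B]
    [Module S B] (f : A →ₗ[S] B) (hA : IsFiniteLength S A) :
    ell S A = ell S (LinearMap.ker f) + ell S (LinearMap.range f) :=
  ell_add_of_exact (LinearMap.ker f).subtype f.rangeRestrict (Submodule.injective_subtype _)
    f.surjective_rangeRestrict (by
      rw [LinearMap.exact_iff, LinearMap.ker_rangeRestrict, Submodule.range_subtype]) hA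

variable {S : Type*} [CommRing S] {E P : ℕ → Type*} [∀ j, AddCommGroup (E j)] [∀ j, Module S (E j)]
  [∀ j, AddCommGroup (P j)] [∀ j, Module S (P j)]
  (α : ∀ j, E (j + 1) →ₗ[S] P j) (β : ∀ j, P j →ₗ[S] E j) (δ : ∀ j, E j →ₗ[S] E (j + 2))
  (h1 : ∀ j, Function.Exact (α j) (β j)) (h2 : ∀ j, Function.Exact (β j) (δ j))
  (h3 : ∀ j, Function.Exact (δ j) (α (j + 1))) (h0 : Function.Injective (α 0))
  (hE : Subsingleton (E 0))
include h1 h2 h3 h0 hE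

/-- The alternating sum of lengths in a sequence of Gysin type. -/
theorem altSum_gysin (K : ℕ) (hfl : ∀ j ≤ K + 1, IsFiniteLength S (E j)) :
    altSum (fun j => ell S (P j)) (K + 1) =
      ell S (E (K + 1)) - ell S (LinearMap.range (δ K)) := by
  have hP : ∀ j ≤ K, IsFiniteLength S (P j) := fun j hj =>
    isFiniteLength_of_exact (α j) (β j) (h1 j) (hfl _ (by omega)) (hfl _ (by omega))
  have hstep : ∀ j ≤ K, ell S (P j) + ell S (LinearMap.ker (α j)) + ell S (LinearMap.range (δ j)) =
      ell S (E (j + 1)) + ell S (E j) := by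
    intro j hj
    have e1 := ell_range_add_ell_ker (β j) (hP j hj)
    have e2 := ell_range_add_ell_ker (α j) (hfl (j + 1) (by omega))
    have e3 := ell_range_add_ell_ker (δ j) (hfl j (by omega))
    rw [(h1 j).linearMap_ker_eq] at e1
    rw [(h2 j).linearMap_ker_eq] at e3
    omega
  induction K with
  | zero =>
    have := hstep 0 le_rfl
    have hk : Subsingleton (LinearMap.ker (α 0)) := by
      rw [LinearMap.ker_eq_bot.2 h0]
      infer_instance
    rw [ell_of_subsingleton (LinearMap.ker (α 0)), ell_of_subsingleton (E 0)] at this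
    rw [altSum, altSum]
    change ell S (P 0) - 0 = ell S (E 1) - _
    change ell S (P 0) + 0 + _ = ell S (E 1) + 0 at this
    omega
  | succ K ih =>
    rw [altSum, ih (fun j hj => hfl j (by omega)) (fun j hj => hP j (by omega))
      fun j hj => hstep j (by omega)]
    have := hstep (K + 1) le_rfl
    have hr : ell S (LinearMap.ker (α (K + 1))) = ell S (LinearMap.range (δ K)) := by
      rw [(h3 K).linearMap_ker_eq]
    rw [hr] at this
    change ell S (P (K + 1)) - _ = ell S (E (K + 1 + 1)) - _
    omega

theorem subsingleton_gysin (K : ℕ) (hP : ∀ j ≤ K, Subsingleton (P j)) :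
    ∀ j ≤ K + 1, Subsingleton (E j) := by
  intro j
  induction j using Nat.strong_induction_on with
  | _ j ih =>
    intro hj
    match j with
    | 0 => exact hE
    | 1 =>
      have := hP 0 (by omega)
      exact h0.subsingleton
    | j + 2 =>
      have := hP (j + 1) (by omega)
      have := ih j (by omega) (by omega)
      refine ⟨fun a b => ?_⟩
      obtain ⟨a, rfl⟩ := (h3 j a).1 (Subsingleton.elim _ _)
      obtain ⟨b, rfl⟩ := (h3 j b).1 (Subsingleton.elim _ _)
      rw [Subsingleton.elim a b]

end Gysin

section Truncate

variable {S : Type*} [CommRing S] {ι : ℕ → Type} [∀ j, Fintype (ι j)]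
  {B : Type*} [AddCommGroup B] [Module S B]

theorem exists_hq_equiv {d d' : ∀ j, Matrix (ι (j + 1)) (ι j) S} {j : ℕ} (h1 : d j = d' j)
    (h2 : d (j + 1) = d' (j + 1)) : Nonempty (hq d B j ≃ₗ[S] hq d' B j) := by
  change Nonempty ((↥(LinearMap.ker (mv (d (j + 1)) B)) ⧸
    (LinearMap.range (mv (d j) B)).comap (LinearMap.ker (mv (d (j + 1)) B)).subtype) ≃ₗ[S]
    (↥(LinearMap.ker (mv (d' (j + 1)) B)) ⧸
    (LinearMap.range (mv (d' j) B)).comap (LinearMap.ker (mv (d' (j + 1)) B)).subtype))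
  rw [h1, h2]
  exact ⟨LinearEquiv.refl _ _⟩

end Truncate

/-- Rigidity over power series rings. -/
theorem rigid_powerSeries_of_comp {m : ℕ} {V : Type u} [CommRing V] [IsLocalRing V]
    [IsNoetherianRing V]
    (π : V) (hπ : IsSMulRegular V π) (hm : maximalIdeal V = Ideal.span {π})
    {ι : ℕ → Type} [∀ j, Fintype (ι j)] [IsEmpty (ι 0)]
    (d : ∀ j, Matrix (ι (j + 1)) (ι j) (MvPowerSeries (Fin m) V))
    (hd : ∀ j, d (j + 1) * d j = 0) (K : ℕ)
    (hQ : ∀ j ≤ K, Subsingleton (hq d (MvPowerSeries (Fin m) V) j))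
    (N : Type u) [AddCommGroup N] [Module (MvPowerSeries (Fin m) V) N]
    [Module.Finite (MvPowerSeries (Fin m) V) N]
    (hfl : ∀ j ≤ K, IsFiniteLength (MvPowerSeries (Fin m) V) (hq d N j))
    (hsum : altSum (fun j => ell (MvPowerSeries (Fin m) V) (hq d N j)) (K + 1) ≤ 0) :
    ∀ j ≤ K, Subsingleton (hq d N j) := by
  let d' : ∀ j, Matrix (ι (j + 1)) (ι j) (MvPowerSeries (Fin m) V) :=
    fun j => if j ≤ K + 1 then d j else 0
  have hd' : ∀ j ≤ K + 1, d j = d' j := fun j hj => (if_pos hj).symm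
  have e : ∀ (B : Type u) [AddCommGroup B] [Module (MvPowerSeries (Fin m) V) B], ∀ j ≤ K,
      Nonempty (hq d B j ≃ₗ[MvPowerSeries (Fin m) V] hq d' B j) := fun B _ _ j hj =>
    exists_hq_equiv (hd' j (by omega)) (hd' (j + 1) (by omega))
  have key := rigid_powerSeries π hπ hm d' (fun j => ?_) K (if_neg (by omega)) (fun j hj => ?_) N
    (fun j hj => ?_) ?_
  · intro j hj
    obtain ⟨e⟩ := e N j hj
    have := key j hj
    exact e.toEquiv.subsingleton
  · by_cases h : j + 1 ≤ K + 1
    · rw [← hd' _ h, ← hd' j (by omega), hd]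
    · change (if j + 1 ≤ K + 1 then d (j + 1) else 0) * d' j = 0
      rw [if_neg h, Matrix.zero_mul]
  · obtain ⟨e⟩ := e (MvPowerSeries (Fin m) V) j hj
    have := hQ j hj
    exact e.symm.toEquiv.subsingleton
  · obtain ⟨e⟩ := e N j hj
    exact (hfl j hj).of_injective (f := e.symm.toLinearMap) e.symm.injective
  · refine le_of_eq_of_le (altSum_congr fun j hj => ?_) hsum
    obtain ⟨e⟩ := e N j (by omega)
    exact (ell_congr e).symm

section Fold

variable {Q : Type*} [CommRing Q] {ι : ℕ → Type} [∀ j, Fintype (ι j)] [∀ j, DecidableEq (ι j)]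
  (d : ∀ j, Matrix (ι (j + 1)) (ι j) Q) (f : Q) (h : ∀ j, Matrix (ι (j + 2)) (ι j) Q)

/-- The mapping cone of multiplication with `f` on a sequence of matrices whose consecutive
products are divisible by `f`. -/
def foldMat (j : ℕ) : Matrix (ι (j + 2) ⊕ ι (j + 1)) (ι (j + 1) ⊕ ι j) Q :=
  Matrix.fromBlocks (-d (j + 1)) (-h j) (Matrix.diagonal fun _ => f) (d j)

variable {d f h}

theorem mv_foldMat (B : Type*) [AddCommGroup B] [Module Q B] (j : ℕ) (x : ι (j + 1) ⊕ ι j → B) :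
    mv (foldMat d f h j) B x = Sum.elim
      (-(mv (d (j + 1)) B fun i => x (Sum.inl i)) - mv (h j) B fun i => x (Sum.inr i))
      ((f • fun i => x (Sum.inl i)) + mv (d j) B fun i => x (Sum.inr i)) := by
  ext (k | k)
  · simp [mv_apply, foldMat, sub_eq_add_neg]
  · simp [mv_apply, foldMat, Matrix.diagonal_apply, ite_smul]

theorem foldMat_mul (h1 : ∀ j, d (j + 1) * d j = f • h j)
    (h2 : ∀ j, d (j + 2) * h j = h (j + 1) * d j)
    (j : ℕ) : foldMat d f h (j + 1) * foldMat d f h j = 0 := by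
  have hd : (Matrix.diagonal fun _ => f : Matrix (ι (j + 1)) (ι (j + 1)) Q) = f • 1 := by
    rw [Matrix.smul_one_eq_diagonal]
  have hd' : (Matrix.diagonal fun _ => f : Matrix (ι (j + 2)) (ι (j + 2)) Q) = f • 1 := by
    rw [Matrix.smul_one_eq_diagonal]
  rw [foldMat, foldMat, Matrix.fromBlocks_multiply, hd, hd', ← Matrix.fromBlocks_zero]
  congr 1
  · simp [h1]
  · simp [h2]
  · simp
  · simp [h1]

/-- Exactness of the cone modulo `f` gives exactness of the cone. -/
theorem subsingleton_hq_foldMat [IsDomain Q] (hf : f ≠ 0)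
    (h1 : ∀ j, d (j + 1) * d j = f • h j) (h2 : ∀ j, d (j + 2) * h j = h (j + 1) * d j) (j : ℕ)
    (hA : ∀ x : ι (j + 1) → Q, (∃ y, mv (d (j + 1)) Q x = f • y) →
      ∃ b c, x = mv (d j) Q b + f • c) :
    Subsingleton (hq (ι := fun j => ι (j + 1) ⊕ ι j) (foldMat d f h) Q j) := by
  refine Hm.subsingleton_iff.2 fun x hx => ?_
  have hx' := (mv_foldMat (d := d) (f := f) (h := h) Q (j + 1) x).symm.trans hx
  have hx2 : ((f • fun i => x (Sum.inl i)) + mv (d (j + 1)) Q fun i => x (Sum.inr i)) = 0 := by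
    ext k
    exact congrFun hx' (Sum.inr k)
  obtain ⟨b, c, hbc⟩ := hA (fun i => x (Sum.inr i)) ⟨fun i => -x (Sum.inl i), by
    rw [eq_neg_of_add_eq_zero_right hx2]
    ext k
    simp⟩
  let y : ι (j + 1) ⊕ ι j → Q := Sum.elim c b
  refine ⟨y, ?_⟩
  have hy := mv_foldMat (d := d) (f := f) (h := h) Q j y
  have hinr : ∀ k, mv (foldMat d f h j) Q y (Sum.inr k) = x (Sum.inr k) := by
    intro k
    rw [hy, congrFun hbc k]
    simp [y, add_comm]
  have hz : mv (foldMat d f h (j + 1)) Q (x - mv (foldMat d f h j) Q y) = 0 := by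
    rw [map_sub, ← mv_mul, foldMat_mul h1 h2, mv_zero, sub_zero]
    exact hx
  rw [mv_foldMat] at hz
  have hz2 : (fun i => (x - mv (foldMat d f h j) Q y) (Sum.inr i)) = 0 := by
    ext k
    simp [hinr]
  ext (k | k)
  · have := congrFun hz (Sum.inr k)
    rw [hz2, map_zero] at this
    have h3 : f * (x (Sum.inl k) - mv (foldMat d f h j) Q y (Sum.inl k)) = 0 := by
      simpa using this
    exact (sub_eq_zero.1 ((mul_eq_zero.1 h3).resolve_left hf)).symm
  · exact hinr k

variable {N : Type*} [AddCommGroup N] [Module Q N]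

theorem exists_gysin (h1 : ∀ j, d (j + 1) * d j = f • h j)
    (h2 : ∀ j, d (j + 2) * h j = h (j + 1) * d j) (hN : ∀ n : N, f • n = 0) [IsEmpty (ι 0)]
    [IsEmpty (ι 1)] :
    ∃ (α : ∀ j, hq d N (j + 1) →ₗ[Q] hq (ι := fun j => ι (j + 1) ⊕ ι j) (foldMat d f h) N j)
      (β : ∀ j, hq (ι := fun j => ι (j + 1) ⊕ ι j) (foldMat d f h) N j →ₗ[Q] hq d N j)
      (δ : ∀ j, hq d N j →ₗ[Q] hq d N (j + 2)),
      (∀ j, Function.Exact (α j) (β j)) ∧ (∀ j, Function.Exact (β j) (δ j)) ∧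
      (∀ j, Function.Exact (δ j) (α (j + 1))) ∧ Function.Injective (α 0) := by
  let i : ∀ j, (ι (j + 1) → N) →ₗ[Q] (ι (j + 1) ⊕ ι j → N) := fun j =>
    { toFun := fun a => Sum.elim ((-1 : ℤ) ^ j • a) 0
      map_add' := fun a b => by ext (k | k) <;> simp
      map_smul' := fun s a => by ext (k | k) <;> simp [smul_comm s] }
  let p : ∀ j, (ι (j + 1) ⊕ ι j → N) →ₗ[Q] (ι j → N) := fun j =>
    { toFun := fun a k => a (Sum.inr k)
      map_add' := fun a b => rfl
      map_smul' := fun s a => rfl }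
  have hf0 : ∀ {κ : Type} (x : κ → N), f • x = 0 := fun x => funext fun k => hN (x k)
  have hi : ∀ j x, mv (foldMat d f h j) N (i j x) = i (j + 1) (mv (d (j + 1)) N x) := by
    intro j x
    rw [mv_foldMat]
    ext (k | k)
    · simp only [i, LinearMap.coe_mk, AddHom.coe_mk, Sum.elim_inl, Sum.elim_inr]
      change -(mv (d (j + 1)) N ((-1 : ℤ) ^ j • x)) k - mv (h j) N 0 k = _
      rw [map_zsmul, map_zero, pow_succ]
      simp
    · simp only [i, LinearMap.coe_mk, AddHom.coe_mk, Sum.elim_inl, Sum.elim_inr]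
      rw [hf0, zero_add]
      change mv (d j) N 0 k = 0
      rw [map_zero]
      rfl
  have hp : ∀ j x, mv (d j) N (p j x) = p (j + 1) (mv (foldMat d f h j) N x) := by
    intro j x
    rw [mv_foldMat, hf0, zero_add]
    rfl
  have hinj : ∀ j, Function.Injective (i j) := by
    intro j
    rw [injective_iff_map_eq_zero]
    intro a ha
    ext k
    have := congrFun ha (Sum.inl k)
    rcases neg_one_pow_eq_or ℤ j with h | h <;> simpa [i, h] using this
  have hex : ∀ j, Function.Exact (i j) (p j) := by
    intro j x
    constructor
    · intro hx
      refine ⟨(-1 : ℤ) ^ j • fun k => x (Sum.inl k), ?_⟩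
      ext (k | k)
      · rcases neg_one_pow_eq_or ℤ j with h | h <;> simp [i, h]
      · exact (congrFun hx k).symm
    · rintro ⟨a, rfl⟩
      rfl
  have hsurj : ∀ j, Function.Surjective (p j) := fun j y => ⟨Sum.elim 0 y, rfl⟩
  have key := Hm.exists_connecting (S := Q) (X' := fun j => ι (j + 1) → N)
    (X := fun j => ι (j + 1) ⊕ ι j → N) (X'' := fun j => ι j → N)
    (d' := fun j => mv (d (j + 1)) N) (d := fun j => mv (foldMat d f h j) N)
    (d'' := fun j => mv (d j) N)
    (fun j x => by rw [← mv_mul, foldMat_mul h1 h2, mv_zero]) i hi p hp hinj hex hsurj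
  choose k1 δ k2 k3 using key
  have hinj0 : ∀ z, Hm.map i hi 0 z = 0 → z = 0 := by
    intro z hz
    obtain ⟨x, hx, rfl⟩ := Hm.exists_mk z
    obtain ⟨y, hy⟩ := (Hm.mk_eq_zero (d := fun j => mv (foldMat d f h j) N)).1 hz
    have hy0 : y = 0 := funext fun k => by
      rcases k with k | k <;> exact isEmptyElim k
    rw [hy0, map_zero, eq_comm] at hy
    have hx0 : x = 0 := hinj _ (hy.trans (map_zero _).symm)
    subst hx0
    exact Hm.mk_eq_zero.2 ⟨0, map_zero _⟩
  exact ⟨_, _, δ, k1, k2, k3, (injective_iff_map_eq_zero (Hm.map i hi 0)).2 hinj0⟩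

end Fold

theorem map_mv {S T : Type*} [CommRing S] [CommRing T] (ψ : S →+* T) {κ ι : Type} [Fintype ι]
    (M : Matrix κ ι S) (x : ι → S) (k : κ) :
    ψ (mv M S x k) = mv (M.map ψ) T (fun i => ψ (x i)) k := by
  simp [mv_apply]

/-- Rigidity over hypersurfaces in power series rings. -/
theorem rigid_hypersurface {m : ℕ} {V : Type u} [CommRing V] [IsLocalRing V]
    [IsNoetherianRing V] [IsDomain V]
    (π : V) (hπ : IsSMulRegular V π) (hm : maximalIdeal V = Ideal.span {π})
    {A : Type u} [CommRing A] (ψ : MvPowerSeries (Fin m) V →+* A) (hψ : Function.Surjective ψ)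
    (f : MvPowerSeries (Fin m) V) (hf : f ≠ 0) (hker : RingHom.ker ψ = Ideal.span {f})
    {ι : ℕ → Type} [∀ j, Fintype (ι j)] [IsEmpty (ι 0)] [IsEmpty (ι 1)]
    (d : ∀ j, Matrix (ι (j + 1)) (ι j) A) (hd : ∀ j, d (j + 1) * d j = 0) (K : ℕ)
    (hA : ∀ j ≤ K, Subsingleton (hq d A j))
    (N : Type u) [AddCommGroup N] [Module A N] [Module.Finite A N]
    (hfl : ∀ j ≤ K + 1, IsFiniteLength A (hq d N j)) (hv : Subsingleton (hq d N (K + 1))) :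
    ∀ j ≤ K + 1, Subsingleton (hq d N j) := by
  classical
  have : IsDomain (MvPowerSeries (Fin m) V) := NoZeroDivisors.to_isDomain _
  let _ : Module (MvPowerSeries (Fin m) V) N := Module.compHom N ψ
  have hsm : ∀ (s : MvPowerSeries (Fin m) V) (n : N), s • n = ψ s • n := fun _ _ => rfl
  have : Module.Finite (MvPowerSeries (Fin m) V) N := by
    obtain ⟨s, hs⟩ := Module.Finite.fg_top (R := A) (M := N)
    refine ⟨⟨s, eq_top_iff.2 fun n _ => ?_⟩⟩
    have hn : n ∈ Submodule.span A (s : Set N) := hs ▸ Submodule.mem_top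
    induction hn using Submodule.span_induction with
    | mem x hx => exact Submodule.subset_span hx
    | zero => exact zero_mem _
    | add x y _ _ hx hy => exact add_mem (hx trivial) (hy trivial)
    | smul a x _ hx =>
      obtain ⟨q, rfl⟩ := hψ a
      exact Submodule.smul_mem _ q (hx trivial)
  have hlift : ∀ j, ∃ D : Matrix (ι (j + 1)) (ι j) (MvPowerSeries (Fin m) V), D.map ψ = d j := by
    intro j
    choose D hD using fun a b => hψ (d j a b)
    exact ⟨Matrix.of D, by ext a b; exact hD a b⟩
  choose D hD using hlift
  have hDd : (fun j => (D j).map ψ) = d := funext hD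
  have hdvd : ∀ q, ψ q = 0 → ∃ c, q = f * c := fun q hq =>
    Ideal.mem_span_singleton.1 (hker ▸ (RingHom.mem_ker.2 hq))
  have hψf : ψ f = 0 := RingHom.mem_ker.1 (hker ▸ Ideal.mem_span_singleton_self f)
  have hh : ∀ j, ∃ h : Matrix (ι (j + 2)) (ι j) (MvPowerSeries (Fin m) V),
      D (j + 1) * D j = f • h := by
    intro j
    have h1 : (D (j + 1) * D j).map ψ = 0 := by
      rw [Matrix.map_mul, hD, hD, hd]
    choose h hh using fun a b => hdvd ((D (j + 1) * D j) a b) (congrFun (congrFun h1 a) b)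
    exact ⟨Matrix.of h, Matrix.ext fun a b => hh a b⟩
  choose h h1 using hh
  have h2 : ∀ j, D (j + 2) * h j = h (j + 1) * D j := by
    intro j
    have : f • (D (j + 2) * h j) = f • (h (j + 1) * D j) := by
      rw [← Matrix.mul_smul, ← h1, ← Matrix.smul_mul, ← h1, Matrix.mul_assoc]
    refine Matrix.ext fun a b => ?_
    have := congrFun (congrFun this a) b
    exact mul_left_cancel₀ hf this
  have hN : ∀ n : N, f • n = 0 := fun n => by rw [hsm, hψf, zero_smul]
  have hflQ : ∀ j ≤ K + 1, IsFiniteLength (MvPowerSeries (Fin m) V) (hq D N j) := fun j hj => by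
    rw [← isFiniteLength_hqRes ψ D hψ hsm, hDd]
    exact hfl j hj
  have hvQ : Subsingleton (hq D N (K + 1)) := by
    rw [← subsingleton_hqRes ψ D hsm, hDd]
    exact hv
  obtain ⟨α, β, δ, e1, e2, e3, e0⟩ := exists_gysin (N := N) h1 h2 hN
  have hE0 : Subsingleton (hq D N 0) := Hm.subsingleton_iff.2 fun x _ =>
    ⟨0, Subsingleton.elim _ _⟩
  have hsum := altSum_gysin α β δ e1 e2 e3 e0 hE0 K hflQ
  have : IsEmpty (ι (0 + 1) ⊕ ι 0) := inferInstanceAs (IsEmpty (ι 1 ⊕ ι 0))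
  have key := rigid_powerSeries_of_comp (ι := fun j => ι (j + 1) ⊕ ι j) π hπ hm (foldMat D f h)
    (foldMat_mul h1 h2) K (fun j hj => ?_) N (fun j hj => ?_) ?_
  · intro j hj
    have := subsingleton_gysin α β δ e1 e2 e3 e0 hE0 K key j hj
    rw [← subsingleton_hqRes ψ D hsm, hDd] at this
    exact this
  · refine subsingleton_hq_foldMat hf h1 h2 j ?_
    rintro x ⟨y, hy⟩
    have hx : mv (d (j + 1)) A (fun i => ψ (x i)) = 0 := by
      ext k
      rw [← hD, ← map_mv, hy, Pi.smul_apply, smul_eq_mul, map_mul, hψf, zero_mul]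
      rfl
    obtain ⟨b, hb⟩ := Hm.subsingleton_iff.1 (hA j hj) _ hx
    choose b' hb' using fun i => hψ (b i)
    have hdiff : ∀ k, ψ (x k - mv (D j) _ b' k) = 0 := by
      intro k
      rw [map_sub, map_mv, hD]
      have : (fun i => ψ (b' i)) = b := funext hb'
      rw [this]
      exact sub_eq_zero.2 (congrFun hb k).symm
    choose c hc using fun k => hdvd _ (hdiff k)
    refine ⟨b', c, ?_⟩
    ext1 k
    rw [Pi.add_apply, Pi.smul_apply, smul_eq_mul, ← hc, add_sub_cancel]
  · exact isFiniteLength_of_exact (α j) (β j) (e1 j) (hflQ _ (by omega)) (hflQ _ (by omega))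
  · rw [hsum, ell_of_subsingleton (hq D N (K + 1))]
    have := ell_nonneg (S := MvPowerSeries (Fin m) V) (LinearMap.range (δ K))
    omega

section Regular

theorem maximalIdeal_quotient {Q : Type*} [CommRing Q] [IsLocalRing Q] (I : Ideal Q)
    [IsLocalRing (Q ⧸ I)] :
    maximalIdeal (Q ⧸ I) = (maximalIdeal Q).map (Ideal.Quotient.mk I) := by
  have hI : I ≤ maximalIdeal Q := le_maximalIdeal fun h => by
    have := (Ideal.Quotient.nontrivial_iff (I := I)).1 inferInstance
    exact this h
  refine ((Ideal.map_eq_top_or_isMaximal_of_surjective _ Ideal.Quotient.mk_surjective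
    (maximalIdeal.isMaximal Q)).resolve_left fun h => ?_) |> eq_maximalIdeal |>.symm
  have h2 := congrArg (Ideal.comap (Ideal.Quotient.mk I)) h
  rw [Ideal.comap_map_of_surjective _ Ideal.Quotient.mk_surjective, ← RingHom.ker_eq_comap_bot,
    Ideal.mk_ker, sup_eq_left.2 hI, Ideal.comap_top] at h2
  exact (maximalIdeal.isMaximal Q).ne_top h2

theorem ringKrullDim_le_of_span_range {Q : Type*} [CommRing Q] [IsLocalRing Q]
    [IsNoetherianRing Q] {n : ℕ} (y : Fin n → Q) (hy : Ideal.span (Set.range y) = maximalIdeal Q) :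
    ringKrullDim Q ≤ n := by
  refine (ringKrullDim_le_spanFinrank_maximalIdeal Q).trans ?_
  rw [← hy]
  have h := Submodule.spanFinrank_span_le_ncard_of_finite (R := Q) (Set.finite_range y)
  have h2 : (Set.range y).ncard ≤ n := by
    rw [← Set.image_univ]
    refine (Set.ncard_image_le).trans ?_
    simp
  exact_mod_cast h.trans h2

theorem le_of_add_natCast_le {n k : ℕ} {e : WithBot ℕ∞}
    (h : ((n + k : ℕ) : WithBot ℕ∞) ≤ e + k) : (n : WithBot ℕ∞) ≤ e := by
  induction e using WithBot.recBotCoe with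
  | bot =>
    rw [WithBot.bot_add, le_bot_iff] at h
    exact absurd h (WithBot.coe_ne_bot (a := ((n + k : ℕ) : ℕ∞)))
  | coe e =>
    have h' : ((n + k : ℕ) : ℕ∞) ≤ e + k := by exact_mod_cast h
    have : (n : ℕ∞) ≤ e := by
      rw [Nat.cast_add] at h'
      exact (ENat.add_le_add_iff_right (by simp)).1 h'
    exact_mod_cast this

theorem exists_isUnit_coeff {Q : Type*} [CommRing Q] [IsLocalRing Q] {n : ℕ} {y c : Fin n → Q}
    (hy : Ideal.span (Set.range y) = maximalIdeal Q)
    (ht : ∑ i, c i * y i ∉ maximalIdeal Q ^ 2) : ∃ i, IsUnit (c i) := by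
  by_contra! h
  refine ht (Ideal.sum_mem _ fun i _ => ?_)
  rw [pow_two]
  exact Ideal.mul_mem_mul (h i) (hy ▸ Ideal.subset_span ⟨i, rfl⟩)

/-- Exchanging a minimal generator of the maximal ideal. -/
theorem span_exchange {Q : Type*} [CommRing Q] [IsLocalRing Q] {n : ℕ} {y : Fin (n + 1) → Q}
    (hy : Ideal.span (Set.range y) = maximalIdeal Q) {t : Q} (ht : t ∈ maximalIdeal Q)
    (ht2 : t ∉ maximalIdeal Q ^ 2) :
    ∃ z : Fin n → Q, Ideal.span (insert t (Set.range z)) = maximalIdeal Q := by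
  rw [← hy] at ht
  obtain ⟨c, rfl⟩ := (Ideal.mem_span_range_iff_exists_fun).1 ht
  obtain ⟨i, hi⟩ := exists_isUnit_coeff hy ht2
  refine ⟨fun j => y (i.succAbove j), le_antisymm (Ideal.span_le.2 ?_) ?_⟩
  · rintro _ (rfl | ⟨j, rfl⟩)
    · exact hy ▸ ht
    · exact hy ▸ Ideal.subset_span ⟨_, rfl⟩
  · rw [← hy, Ideal.span_le]
    have hother : ∀ j, y (i.succAbove j) ∈ Ideal.span
        (insert (∑ i, c i * y i) (Set.range fun j => y (i.succAbove j))) := fun j =>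
      Ideal.subset_span (Or.inr ⟨j, rfl⟩)
    rintro _ ⟨k, rfl⟩
    rcases Fin.eq_self_or_eq_succAbove i k with rfl | ⟨j, rfl⟩
    · obtain ⟨v, hv⟩ := hi.exists_left_inv
      have h1 : c k * y k ∈ Ideal.span
          (insert (∑ i, c i * y i) (Set.range fun j => y (k.succAbove j))) := by
        have : c k * y k = ∑ i, c i * y i - ∑ j, c (k.succAbove j) * y (k.succAbove j) := by
          rw [Fin.sum_univ_succAbove _ k]
          ring
        rw [this]
        exact sub_mem (Ideal.subset_span (Or.inl rfl))
          (Ideal.sum_mem _ fun j _ => Ideal.mul_mem_left _ _ (hother j))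
      have := Ideal.mul_mem_left _ v h1
      rwa [← mul_assoc, hv, one_mul] at this
    · exact hother j

theorem isDomain_of_regular : ∀ (n : ℕ) (Q : Type u) [CommRing Q] [IsLocalRing Q]
    [IsNoetherianRing Q] (y : Fin n → Q), Ideal.span (Set.range y) = maximalIdeal Q →
    (n : WithBot ℕ∞) ≤ ringKrullDim Q → IsDomain Q := by
  intro n
  induction n with
  | zero =>
    intro Q _ _ _ y hy _
    have : maximalIdeal Q = ⊥ := by rw [← hy]; simp
    have hf : IsField Q := isField_iff_maximalIdeal_eq.2 this
    exact hf.isDomain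
  | succ n ih =>
    intro Q _ _ _ y hy hdim
    have hpos : ¬ ringKrullDim Q ≤ 0 := fun h => by
      have := hdim.trans h
      have h2 : n + 1 ≤ 0 := by exact_mod_cast this
      omega
    have hbot : maximalIdeal Q ≠ ⊥ := fun h => hpos (by
      have := ringKrullDim_le_of_span_range (Q := Q) (n := 0) Fin.elim0 (by rw [h]; simp)
      simpa using this)
    obtain ⟨t, ht, htP⟩ : ∃ t ∈ maximalIdeal Q,
        ∀ P ∈ insert (maximalIdeal Q ^ 2) (minimalPrimes Q), t ∉ P := by
      by_contra! hcon
      have hsub : ((maximalIdeal Q : Ideal Q) : Set Q) ⊆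
          ⋃ P ∈ insert (maximalIdeal Q ^ 2) (minimalPrimes Q), ((P : Ideal Q) : Set Q) := by
        intro t ht
        obtain ⟨P, hP, htP⟩ := hcon t ht
        exact Set.mem_biUnion hP htP
      rw [Ideal.subset_union_prime_finite ((minimalPrimes.finite_of_isNoetherianRing Q).insert _)
        (maximalIdeal Q ^ 2) (maximalIdeal Q ^ 2)
        (fun P hP h _ => (hP.resolve_left h).1.1)] at hsub
      obtain ⟨P, rfl | hP, hle⟩ := hsub
      · refine hbot (Submodule.eq_bot_of_le_smul_of_le_jacobson_bot (maximalIdeal Q) _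
          (IsNoetherian.noetherian _) ?_ (maximalIdeal_le_jacobson _))
        rwa [smul_eq_mul, ← pow_two]
      · have hPm : P = maximalIdeal Q :=
          le_antisymm (le_maximalIdeal hP.1.1.ne_top) hle
        refine hpos ?_
        rw [← maximalIdeal_height_eq_ringKrullDim, ← hPm]
        have := hP.1.1
        have h0 : P.height = 0 := by
          exact Ideal.height_eq_zero_iff.2 hP
        rw [h0]
        exact le_rfl
    obtain ⟨z, hz⟩ := span_exchange hy ht (htP _ (Or.inl rfl))
    have hne : Ideal.span {t} ≠ ⊤ := fun h =>
      (maximalIdeal.isMaximal Q).ne_top (top_le_iff.1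
        (h ▸ (Ideal.span_singleton_le_iff_mem _).2 ht))
    have : Nontrivial (Q ⧸ Ideal.span {t}) := Ideal.Quotient.nontrivial_iff.2 hne
    have : IsLocalRing (Q ⧸ Ideal.span {t}) :=
      IsLocalRing.of_surjective' (Ideal.Quotient.mk _) Ideal.Quotient.mk_surjective
    have hdom : IsDomain (Q ⧸ Ideal.span {t}) := by
      refine ih _ (fun i => Ideal.Quotient.mk _ (z i)) ?_ ?_
      · rw [maximalIdeal_quotient, ← hz, Ideal.map_span, Set.image_insert_eq, ← Set.range_comp]
        rw [Ideal.Quotient.eq_zero_iff_mem.2 (Ideal.mem_span_singleton_self t),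
          Ideal.span_insert_zero]
        rfl
      · refine le_of_add_natCast_le (k := 1) (hdim.trans ?_)
        have := ringKrullDim_le_ringKrullDim_quotient_add_encard (R := Q) {t} (by
          simpa [IsLocalRing.ringJacobson_eq_maximalIdeal] using ht)
        rw [Set.encard_singleton] at this
        exact_mod_cast this
    have hprime : (Ideal.span {t}).IsPrime := (Ideal.Quotient.isDomain_iff_prime _).1 hdom
    obtain ⟨P, hP, hPle⟩ := Ideal.exists_minimalPrimes_le (I := (⊥ : Ideal Q))
      (J := Ideal.span {t}) bot_le
    have htnP : t ∉ P := htP P (Or.inr hP)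
    have hPprime := hP.1.1
    have hP0 : P = ⊥ := by
      refine Submodule.eq_bot_of_le_smul_of_le_jacobson_bot (maximalIdeal Q) P
        (IsNoetherian.noetherian _) (fun p hp => ?_) (maximalIdeal_le_jacobson _)
      obtain ⟨a, rfl⟩ := Ideal.mem_span_singleton.1 (hPle hp)
      exact Submodule.smul_mem_smul ht ((hPprime.mem_or_mem hp).resolve_left htnP)
    rw [hP0] at hPprime
    exact IsDomain.of_bot_isPrime Q

end Regular

/-- The sequence `y 0, …, y (n - 1)` is weakly regular. -/
def SyzReg {Q : Type*} [CommRing Q] (n : ℕ) (y : ℕ → Q) : Prop :=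
  ∀ i < n, ∀ g, g * y i ∈ Ideal.span (y '' (Finset.range i : Set ℕ)) →
    g ∈ Ideal.span (y '' (Finset.range i : Set ℕ))

theorem mem_span_image_range {Q : Type*} [CommRing Q] {n : ℕ} {y : ℕ → Q} {g : Q} :
    g ∈ Ideal.span (y '' (Finset.range n : Set ℕ)) ↔
      ∃ b : ℕ → Q, ∑ i ∈ Finset.range n, b i * y i = g := by
  constructor
  · intro h
    obtain ⟨b, hb⟩ := (Submodule.mem_span_image_finset_iff_exists_fun Q).1 h
    refine ⟨fun i => if hi : i ∈ Finset.range n then b ⟨i, hi⟩ else 0, ?_⟩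
    rw [← hb, ← Finset.sum_coe_sort]
    refine Finset.sum_congr rfl fun i _ => ?_
    simp only [dif_pos i.2]
    rfl
  · rintro ⟨b, rfl⟩
    exact Ideal.sum_mem _ fun i hi => Ideal.mul_mem_left _ _ (Ideal.subset_span ⟨i, hi, rfl⟩)

theorem SyzReg.exists_lift {Q Q' A : Type*} [CommRing Q] [CommRing Q'] [CommRing A]
    (φ : Q →+* A) (ψ : Q' →+* A) (hψ : Function.Surjective ψ) {y : ℕ → Q} {z : ℕ → Q'} :
    ∀ {n : ℕ}, SyzReg n y → (∀ i < n, φ (y i) = ψ (z i)) → ∀ (G : ℕ → Q),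
      ∑ i ∈ Finset.range n, G i * y i = 0 →
      ∃ g : ℕ → Q', ∑ i ∈ Finset.range n, g i * z i = 0 ∧ ∀ i < n, ψ (g i) = φ (G i) := by
  intro n
  induction n with
  | zero => exact fun _ _ _ _ => ⟨0, by simp, by simp⟩
  | succ n ih =>
    intro hreg hyz G hG
    rw [Finset.sum_range_succ] at hG
    obtain ⟨b, hb⟩ := mem_span_image_range.1 (hreg n (by omega) (G n)
      (mem_span_image_range.2 ⟨fun i => - G i, by
        simp only [neg_mul, Finset.sum_neg_distrib]
        linear_combination -hG⟩))
    obtain ⟨H, hH, hHG⟩ := ih (fun i hi => hreg i (by omega)) (fun i hi => hyz i (by omega))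
      (fun i => G i + b i * y n) (by
        simp only [add_mul, Finset.sum_add_distrib]
        rw [← hG, ← hb, Finset.sum_mul]
        congr 1
        exact Finset.sum_congr rfl fun i _ => by ring)
    choose c hc using fun i => hψ (φ (b i))
    refine ⟨fun i => if i < n then H i - c i * z n else ∑ j ∈ Finset.range n, c j * z j, ?_, ?_⟩
    · simp only
      rw [Finset.sum_range_succ, Finset.sum_congr rfl (g := fun i => H i * z i - c i * z i * z n)
        fun i hi => by
          simp only [if_pos (Finset.mem_range.1 hi)]; ring]
      rw [if_neg (lt_irrefl n), Finset.sum_sub_distrib, hH, ← Finset.sum_mul]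
      ring
    · intro i hi
      by_cases h : i < n
      · simp only [if_pos h]
        rw [map_sub, map_mul, hHG i h, hc, ← hyz n (by omega), map_add, map_mul]
        ring
      · obtain rfl : i = n := by omega
        simp only [if_neg h]
        rw [map_sum, ← hb, map_sum]
        refine Finset.sum_congr rfl fun j hj => ?_
        rw [map_mul, map_mul, hc, hyz j (by have := Finset.mem_range.1 hj; omega)]

theorem SyzReg.of_regular {Q : Type u} [CommRing Q] [IsLocalRing Q] [IsNoetherianRing Q] {n : ℕ}
    (y : ℕ → Q) (hy : Ideal.span (y '' (Finset.range n : Set ℕ)) = maximalIdeal Q)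
    (hdim : (n : WithBot ℕ∞) ≤ ringKrullDim Q) :
    (∀ i ≤ n, (Ideal.span (y '' (Finset.range i : Set ℕ))).IsPrime) ∧ SyzReg n y := by
  have hI : ∀ i ≤ n, y '' (Finset.range i : Set ℕ) ⊆ maximalIdeal Q := fun i hi => by
    rw [← hy]
    exact (Set.image_mono (by simpa using hi)).trans Ideal.subset_span
  have hne : ∀ i ≤ n, Nontrivial (Q ⧸ Ideal.span (y '' (Finset.range i : Set ℕ))) := fun i hi =>
    Ideal.Quotient.nontrivial_iff.2 fun h => (maximalIdeal.isMaximal Q).ne_top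
      (top_le_iff.1 (h ▸ Ideal.span_le.2 (hI i hi)))
  have hloc : ∀ i ≤ n, IsLocalRing (Q ⧸ Ideal.span (y '' (Finset.range i : Set ℕ))) :=
    fun i hi => by
      have := hne i hi
      exact IsLocalRing.of_surjective' (Ideal.Quotient.mk _) Ideal.Quotient.mk_surjective
  have hgen : ∀ i (hi : i ≤ n) (k l : ℕ), k + l = n →
      y '' (Finset.range k : Set ℕ) ⊆ Ideal.span (y '' (Finset.range i : Set ℕ)) →
      have := hloc i hi
      Ideal.span (Set.range fun j : Fin l =>
        Ideal.Quotient.mk (Ideal.span (y '' (Finset.range i : Set ℕ))) (y (k + j))) =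
        maximalIdeal _ := by
    intro i hi k l hkl hsub
    have := hloc i hi
    simp only
    rw [maximalIdeal_quotient, ← hy, Ideal.map_span]
    refine le_antisymm (Ideal.span_mono ?_) (Ideal.span_le.2 ?_)
    · rintro _ ⟨j, rfl⟩
      exact ⟨_, ⟨k + j, by simp; omega, rfl⟩, rfl⟩
    · rintro _ ⟨_, ⟨j, hj, rfl⟩, rfl⟩
      by_cases hjk : j < k
      · rw [Ideal.Quotient.eq_zero_iff_mem.2 (hsub ⟨j, by simpa using hjk, rfl⟩)]
        exact zero_mem _
      · have hj' : j < n := by simpa using hj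
        exact Ideal.subset_span ⟨⟨j - k, by omega⟩, by simp only; congr 2; omega⟩
  have hdimQ : ∀ i ≤ n, ((n - i : ℕ) : WithBot ℕ∞) ≤
      ringKrullDim (Q ⧸ Ideal.span (y '' (Finset.range i : Set ℕ))) := by
    intro i hi
    refine le_of_add_natCast_le (k := i) ?_
    rw [Nat.sub_add_cancel hi]
    refine hdim.trans ((ringKrullDim_le_ringKrullDim_quotient_add_encard
      (y '' (Finset.range i : Set ℕ)) (by
        rw [IsLocalRing.ringJacobson_eq_maximalIdeal]; exact hI i hi)).trans ?_)
    gcongr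
    have : (y '' (Finset.range i : Set ℕ)).encard ≤ (i : ℕ∞) :=
      (Set.encard_image_le _ _).trans (by rw [Set.encard_coe_eq_coe_finsetCard]; simp)
    exact_mod_cast this
  have hprime : ∀ i ≤ n, (Ideal.span (y '' (Finset.range i : Set ℕ))).IsPrime := by
    intro i hi
    have := hloc i hi
    rw [← Ideal.Quotient.isDomain_iff_prime]
    exact isDomain_of_regular (n - i) _ _ (hgen i hi i (n - i) (by omega) Ideal.subset_span)
      (hdimQ i hi)
  refine ⟨hprime, fun i hi g hg => ((hprime i hi.le).mem_or_mem hg).resolve_right fun hyi => ?_⟩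
  have := hloc i hi.le
  have h1 := ringKrullDim_le_of_span_range _ (hgen i hi.le (i + 1) (n - i - 1) (by omega) (by
    rintro _ ⟨j, hj, rfl⟩
    have hj' : j < i + 1 := by simpa using hj
    rcases Nat.lt_succ_iff_lt_or_eq.1 hj' with h | rfl
    · exact Ideal.subset_span ⟨j, by simpa using h, rfl⟩
    · exact hyi))
  have h2 := (hdimQ i hi.le).trans h1
  have h3 : n - i ≤ n - i - 1 := by exact_mod_cast h2
  omega

/-- If `A` is the quotient of `Q` by one element of the maximal ideal, the kernel of
any parallel presentation of `A` is principal and nonzero. -/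
theorem exists_ker_eq_span {Q Q₀ A : Type*} [CommRing Q] [IsLocalRing Q] [CommRing Q₀]
    [IsLocalRing Q₀] [IsNoetherianRing Q₀] [CommRing A] [Nontrivial A] (φ : Q →+* A)
    (hφ : Function.Surjective φ) (x : Q) (hx0 : x ≠ 0) (hker : RingHom.ker φ = Ideal.span {x})
    (ψ : Q₀ →+* A) (hψ : Function.Surjective ψ) {n : ℕ} {y : ℕ → Q} {z : ℕ → Q₀}
    (hy : SyzReg n y) (hz : SyzReg n z)
    (hym : Ideal.span (y '' (Finset.range n : Set ℕ)) = maximalIdeal Q)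
    (hzm : Ideal.span (z '' (Finset.range n : Set ℕ)) = maximalIdeal Q₀)
    (hyz : ∀ i < n, φ (y i) = ψ (z i)) (hx : x ∈ maximalIdeal Q) :
    ∃ f : Q₀, f ≠ 0 ∧ RingHom.ker ψ = Ideal.span {f} := by
  have hdvd : ∀ q, φ q = 0 → ∃ c, q = x * c := fun q hq =>
    Ideal.mem_span_singleton.1 (hker ▸ RingHom.mem_ker.2 hq)
  have hφx : φ x = 0 := RingHom.mem_ker.1 (hker ▸ Ideal.mem_span_singleton_self x)
  obtain ⟨X, hX⟩ : ∃ X : ℕ → Q, ∑ i ∈ Finset.range n, X i * y i = x :=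
    mem_span_image_range.1 (hym ▸ hx)
  choose X' hX' using fun i => hψ (φ (X i))
  have hψf : ψ (∑ i ∈ Finset.range n, X' i * z i) = 0 := by
    rw [← hφx, ← hX, map_sum, map_sum]
    refine Finset.sum_congr rfl fun i hi => ?_
    rw [map_mul, map_mul, hX', hyz i (Finset.mem_range.1 hi)]
  refine ⟨∑ i ∈ Finset.range n, X' i * z i, fun hf => ?_, ?_⟩
  · obtain ⟨g, hg0, hg⟩ := SyzReg.exists_lift ψ φ hφ hz (fun i hi => (hyz i hi).symm) X' hf
    have : ∀ i, ∃ e, i < n → X i = g i + x * e := by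
      intro i
      by_cases hi : i < n
      · obtain ⟨e, he⟩ := hdvd (X i - g i) (by rw [map_sub, hg i hi, hX', sub_self])
        exact ⟨e, fun _ => by rw [← he]; ring⟩
      · exact ⟨0, fun h => absurd h hi⟩
    choose e he using this
    have h1 : x = x * ∑ i ∈ Finset.range n, e i * y i := by
      conv_lhs => rw [← hX]
      rw [Finset.sum_congr rfl (g := fun i => g i * y i + x * (e i * y i)) fun i hi => by
        rw [he i (Finset.mem_range.1 hi)]; ring, Finset.sum_add_distrib, hg0, zero_add,
        Finset.mul_sum]
    have h2 : ∑ i ∈ Finset.range n, e i * y i ∈ maximalIdeal Q := hym ▸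
      mem_span_image_range.2 ⟨e, rfl⟩
    have h3 : IsUnit (1 - ∑ i ∈ Finset.range n, e i * y i) := by
      by_contra h
      exact (maximalIdeal.isMaximal Q).ne_top ((Ideal.eq_top_iff_one _).2
        (by simpa using add_mem (show _ ∈ maximalIdeal Q from h) h2))
    refine hx0 (h3.mul_left_injective ?_)
    simp only [zero_mul]
    rw [mul_sub, mul_one]
    exact sub_eq_zero.2 h1
  · refine le_antisymm ?_ ((Ideal.span_singleton_le_iff_mem _).2 (RingHom.mem_ker.2 hψf))
    refine Submodule.le_of_le_smul_of_le_jacobson_bot (I := maximalIdeal Q₀)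
      (IsNoetherian.noetherian _) (maximalIdeal_le_jacobson _) fun g hg => ?_
    have hgm : g ∈ maximalIdeal Q₀ := fun hu => by
      have := hu.map ψ
      rw [RingHom.mem_ker.1 hg] at this
      exact not_isUnit_zero this
    obtain ⟨G, hG⟩ := mem_span_image_range.1 (hzm ▸ hgm)
    choose H hH using fun i => hφ (ψ (G i))
    obtain ⟨c, hc⟩ := hdvd (∑ i ∈ Finset.range n, H i * y i) (by
      rw [← RingHom.mem_ker.1 hg, ← hG, map_sum, map_sum]
      refine Finset.sum_congr rfl fun i hi => ?_
      rw [map_mul, map_mul, hH, hyz i (Finset.mem_range.1 hi)])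
    obtain ⟨a, ha0, ha⟩ := SyzReg.exists_lift φ ψ hψ hy hyz (fun i => H i - c * X i) (by
      simp only [sub_mul, Finset.sum_sub_distrib]
      rw [hc, ← hX, Finset.sum_mul]
      refine sub_eq_zero.2 (Finset.sum_congr rfl fun i _ => by ring))
    obtain ⟨c', hc'⟩ := hψ (φ c)
    have h1 : g = c' * (∑ i ∈ Finset.range n, X' i * z i) +
        ∑ i ∈ Finset.range n, (G i - c' * X' i - a i) * z i := by
      rw [← hG]
      simp only [sub_mul, Finset.sum_sub_distrib]
      rw [ha0, Finset.mul_sum]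
      simp only [mul_assoc]
      ring
    rw [h1]
    refine Submodule.add_mem_sup (Ideal.mul_mem_left _ _ (Ideal.mem_span_singleton_self _))
      (Submodule.sum_mem _ fun i hi => ?_)
    rw [smul_eq_mul, mul_comm (maximalIdeal Q₀)]
    refine Ideal.mul_mem_mul (RingHom.mem_ker.2 ?_) (by
      rw [← hzm]; exact Ideal.subset_span ⟨i, hi, rfl⟩)
    rw [map_sub, map_sub, map_mul, ha i (Finset.mem_range.1 hi), hc', hX', map_sub, map_mul, hH]
    ring

theorem SyzReg.of_isWeaklyRegular {Q : Type*} [CommRing Q] (l : List Q)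
    (hl : IsWeaklyRegular Q l) :
    SyzReg l.length (fun i => l.getD i 0) ∧
      Ideal.span ((fun i => l.getD i 0) '' (Finset.range l.length : Set ℕ)) = Ideal.ofList l := by
  have key : ∀ i ≤ l.length, Ideal.span ((fun i => l.getD i 0) '' (Finset.range i : Set ℕ)) =
      Ideal.ofList (l.take i) := by
    intro i hi
    rw [Ideal.ofList]
    congr 1
    ext q
    simp only [Set.mem_image, Finset.coe_range, Set.mem_Iio, Set.mem_ofPred_eq,
      List.mem_take_iff_getElem]
    constructor
    · rintro ⟨j, hj, rfl⟩
      exact ⟨j, by omega, by rw [List.getD_eq_getElem]⟩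
    · rintro ⟨j, hj, rfl⟩
      exact ⟨j, by omega, by rw [List.getD_eq_getElem]⟩
  refine ⟨fun i hi g hg => ?_, by rw [key _ le_rfl, List.take_length]⟩
  rw [key i hi.le] at hg ⊢
  have h := hl.regular_mod_prev i hi
  simp only [List.getD_eq_getElem _ _ hi] at hg
  have h2 := (isSMulRegular_quotient_iff_mem_of_smul_mem _ _).1 h g
  simpa [mul_comm] using h2 (by simpa [mul_comm] using hg)

section Smooth
open MvPolynomial Algebra

theorem generators_cotangentComplex_mk_eq_zero_iff {R S : Type*} [CommRing R] [CommRing S]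
    [Algebra R S] {ι : Type*} (P : Generators R S ι) (x : P.toExtension.ker) :
    P.toExtension.cotangentComplex (Extension.Cotangent.mk x) = 0 ↔
      ∀ i, aeval P.val (pderiv i (x.1 : MvPolynomial ι R)) = 0 := by
  rw [Extension.cotangentComplex_mk, ← P.cotangentSpaceBasis.repr.map_eq_zero_iff,
    Finsupp.ext_iff]
  refine forall_congr' fun i => ?_
  rw [← P.cotangentSpaceBasis_repr_one_tmul]
  rfl

theorem subsingleton_h1Cotangent_iff (K L : Type*) [CommRing K] [CommRing L] [Algebra K L] :
    Subsingleton (H1Cotangent K L) ↔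
      ∀ c : MvPolynomial L K, aeval (_root_.id : L → L) c = 0 →
        (∀ i, aeval (_root_.id : L → L) (pderiv i c) = 0) →
        c ∈ (RingHom.ker (aeval (R := K) (_root_.id : L → L))) ^ 2 := by
  have hk : (Generators.self K L).ker = RingHom.ker (aeval (R := K) (_root_.id : L → L)) :=
    Generators.ker_eq_ker_aeval_val _
  rw [← hk]
  change Subsingleton ((Generators.self K L).toExtension.H1Cotangent) ↔ _
  constructor
  · intro h c hc hd
    have hc' : c ∈ (Generators.self K L).toExtension.ker := by
      change c ∈ (Generators.self K L).ker
      rw [hk]; exact hc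
    have hz := (generators_cotangentComplex_mk_eq_zero_iff (Generators.self K L) ⟨c, hc'⟩).2 hd
    have := Subsingleton.elim (α := (Generators.self K L).toExtension.H1Cotangent)
      ⟨_, LinearMap.mem_ker.2 hz⟩ 0
    have h2 := congrArg Subtype.val this
    exact (Extension.Cotangent.mk_eq_zero_iff _).1 h2
  · intro h
    refine ⟨fun a b => ?_⟩
    suffices H : ∀ a : (Generators.self K L).toExtension.H1Cotangent, a = 0 by rw [H a, H b]
    rintro ⟨x, hx⟩
    obtain ⟨c, rfl⟩ := Extension.Cotangent.mk_surjective x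
    apply Subtype.ext
    refine (Extension.Cotangent.mk_eq_zero_iff _).2 (h c.1 ?_ ?_)
    · have : c.1 ∈ (Generators.self K L).ker := c.2
      rw [hk] at this
      exact this
    · exact (generators_cotangentComplex_mk_eq_zero_iff (Generators.self K L) c).1
        (LinearMap.mem_ker.1 hx)

theorem formallySmooth_of_perfectField (K : Type u) (L : Type v) [Field K] [Field L] [Algebra K L]
    [PerfectField K] : FormallySmooth K L := by
  refine ⟨inferInstance, (subsingleton_h1Cotangent_iff K L).2 fun c hc hd => ?_⟩
  obtain ⟨s, q, rfl⟩ := exists_finset_rename c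
  let L₀ : IntermediateField K L := IntermediateField.adjoin K (s : Set L)
  have hfg : EssFiniteType K L₀ := by
    rw [IntermediateField.essFiniteType_iff]
    exact ⟨s, rfl⟩
  have h0 : FormallySmooth K L₀ := FormallySmooth.of_perfectField
  have h1 := (subsingleton_h1Cotangent_iff K L₀).1 h0.2
  let g : {x // x ∈ s} → L₀ := fun x => ⟨x.1, IntermediateField.subset_adjoin K _ x.2⟩
  have key : ∀ p : MvPolynomial L₀ K,
      aeval (_root_.id : L → L) (rename (fun x : L₀ => (x : L)) p) =
        ((aeval (_root_.id : L₀ → L₀) p : L₀) : L) := by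
    intro p
    rw [aeval_rename]
    change _ = L₀.val (aeval (_root_.id : L₀ → L₀) p)
    exact (MvPolynomial.comp_aeval_apply (_root_.id : L₀ → L₀) L₀.val p).symm
  have hr : rename (fun x : {x // x ∈ s} => (x : L)) q
      = rename (fun x : L₀ => (x : L)) (rename g q) := by
    rw [rename_rename]; rfl
  rw [hr] at hc hd ⊢
  have h2 := h1 (rename g q) (by rw [key] at hc; exact_mod_cast hc) (fun i => by
    have := hd (i : L)
    rw [pderiv_rename (f := fun x : L₀ => (x : L)) Subtype.val_injective, key] at this
    exact_mod_cast this)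
  have h3 := Ideal.mem_map_of_mem (rename (R := K) (fun x : L₀ => (x : L))) h2
  rw [Ideal.map_pow] at h3
  refine Ideal.pow_right_mono (Ideal.map_le_iff_le_comap.2 fun p hp => ?_) 2 h3
  rw [Ideal.mem_comap, RingHom.mem_ker, key, (RingHom.mem_ker).1 hp]
  rfl

end Smooth

/-- Lifting along square-zero extensions from a local ring whose maximal ideal is generated by the
prime number `p`. -/
theorem exists_lift_of_sq_zero {V B B' : Type u} [CommRing V] [CommRing B] [CommRing B']
    [IsLocalRing V] (p : ℕ) [Fact p.Prime] (hp : IsSMulRegular V (p : V))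
    (hm : maximalIdeal V = Ideal.span {(p : V)}) (g : B' →+* B) (hg : Function.Surjective g)
    (hsq : ∀ a b, g a = 0 → g b = 0 → a * b = 0) (hpk : ∀ a, g a = 0 → (p : B') * a = 0)
    (f : V →+* B) : ∃ f' : V →+* B', g.comp f' = f := by
  let E : Subring (V × B') := RingHom.eqLocus (f.comp (RingHom.fst V B'))
    (g.comp (RingHom.snd V B'))
  have hE : ∀ x : V × B', x ∈ E ↔ f x.1 = g x.2 := fun x => Iff.rfl
  let q : E →+* V := (RingHom.fst V B').comp E.subtype
  have hq : Function.Surjective q := fun v => by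
    obtain ⟨b, hb⟩ := hg (f v)
    exact ⟨⟨(v, b), hb.symm⟩, rfl⟩
  let J : Ideal E := Ideal.span {(p : E)}
  let F : E ⧸ J →+* ResidueField V := Ideal.Quotient.lift J ((residue V).comp q) (by
    have : J ≤ RingHom.ker ((residue V).comp q) := by
      rw [Ideal.span_singleton_le_iff_mem, RingHom.mem_ker]
      have : (residue V) (p : V) = 0 := by
        rw [residue_eq_zero_iff, hm]; exact Ideal.mem_span_singleton_self _
      simpa using this
    exact fun a ha => this ha)
  have hF : Function.Surjective F :=
    Ideal.Quotient.lift_surjective_of_surjective _ _ (residue_surjective.comp hq)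
  have hFmk : ∀ e : E, F (Ideal.Quotient.mk J e) = residue V e.1.1 := fun e => rfl
  have hker : ∀ a, F a = 0 → ∃ c, ∃ hc : g c = 0,
      a = Ideal.Quotient.mk J ⟨(0, c), by rw [hE]; simp [hc]⟩ := by
    intro a ha
    obtain ⟨e, rfl⟩ := Ideal.Quotient.mk_surjective a
    rw [hFmk, residue_eq_zero_iff, hm, Ideal.mem_span_singleton'] at ha
    obtain ⟨w, hw⟩ := ha
    obtain ⟨e', he'⟩ := hq w
    have he'1 : e'.1.1 = w := he'
    have hz : (e - p * e').1.1 = 0 := by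
      have : (e - p * e').1.1 = e.1.1 - p * e'.1.1 := by simp
      rw [this, he'1, ← hw, mul_comm, sub_self]
    have hz2 : g (e - p * e').1.2 = 0 := by
      rw [← (hE _).1 (e - p * e').2, hz, map_zero]
    refine ⟨(e - p * e').1.2, hz2, ?_⟩
    rw [Ideal.Quotient.eq, Ideal.mem_span_singleton']
    refine ⟨e', ?_⟩
    apply Subtype.ext
    refine Prod.ext ?_ ?_
    · have h1 : (p : V) * e'.1.1 = e.1.1 := by rw [he'1, mul_comm, hw]
      simp [← h1, mul_comm]
    · simp [mul_comm]
  have hchar : (p : E ⧸ J) = 0 := by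
    have : Ideal.Quotient.mk J (p : E) = 0 :=
      Ideal.Quotient.eq_zero_iff_mem.2 (Ideal.mem_span_singleton_self _)
    simpa using this
  have hnt : Nontrivial (E ⧸ J) := F.domain_nontrivial
  have hc1 : CharP (E ⧸ J) p := (CharP.charP_iff_prime_eq_zero Fact.out).2 hchar
  have hc2 : CharP (ResidueField V) p := by
    refine (CharP.charP_iff_prime_eq_zero Fact.out).2 ?_
    rw [← map_natCast F, hchar, map_zero]
  let _ := ZMod.algebra (E ⧸ J) p
  let _ := ZMod.algebra (ResidueField V) p
  let Fa : E ⧸ J →ₐ[ZMod p] ResidueField V :=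
    { F with commutes' := fun r => RingHom.congr_fun (Subsingleton.elim
        (F.comp (algebraMap (ZMod p) (E ⧸ J))) (algebraMap (ZMod p) (ResidueField V))) r }
  have hsm : Algebra.FormallySmooth (ZMod p) (ResidueField V) := formallySmooth_of_perfectField _ _
  let s := Algebra.FormallySmooth.liftOfSurjective (AlgHom.id (ZMod p) (ResidueField V)) Fa hF
    (by
      refine ⟨2, ?_⟩
      rw [Ideal.zero_eq_bot, eq_bot_iff, pow_two, Ideal.mul_le]
      intro a ha b hb
      obtain ⟨c, hc, rfl⟩ := hker a ha
      obtain ⟨d, hd, rfl⟩ := hker b hb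
      rw [Ideal.mem_bot, ← map_mul]
      refine (congrArg (Ideal.Quotient.mk J) ?_).trans (map_zero (Ideal.Quotient.mk J))
      apply Subtype.ext
      exact Prod.ext (mul_zero _) (hsq c d hc hd))
  have hs : ∀ x, F (s x) = x := fun x =>
    Algebra.FormallySmooth.liftOfSurjective_apply (AlgHom.id (ZMod p) (ResidueField V)) Fa hF _ x
  let T : Subring E := RingHom.eqLocus (Ideal.Quotient.mk J)
    ((s : ResidueField V →+* E ⧸ J).comp ((residue V).comp q))
  have hT : ∀ e : E, e ∈ T ↔ Ideal.Quotient.mk J e = s (residue V e.1.1) := fun e => Iff.rfl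
  have hb : Function.Bijective (q.comp T.subtype) := by
    constructor
    · rw [injective_iff_map_eq_zero]
      rintro ⟨e, he⟩ h0
      have h1 : e.1.1 = 0 := h0
      rw [hT, h1, map_zero, map_zero, Ideal.Quotient.eq_zero_iff_mem,
        Ideal.mem_span_singleton'] at he
      obtain ⟨w, hw⟩ := he
      have hw1 : w.1.1 * p = 0 := by
        rw [← h1, ← hw]; simp
      have hw2 : w.1.1 = 0 := by
        apply hp
        simpa [mul_comm] using hw1
      have hw3 : g w.1.2 = 0 := by rw [← (hE _).1 w.2, hw2, map_zero]
      apply Subtype.ext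
      apply Subtype.ext
      refine Prod.ext h1 ?_
      change e.1.2 = 0
      rw [← hw]
      have := hpk _ hw3
      simpa [mul_comm] using this
    · intro v
      obtain ⟨e, he⟩ := hq v
      have he1 : e.1.1 = v := he
      obtain ⟨c, hc, h⟩ := hker (s (residue V v) - Ideal.Quotient.mk J e) (by
        rw [map_sub, hs, hFmk, he1, sub_self])
      refine ⟨⟨e + ⟨(0, c), by rw [hE]; simp [hc]⟩, ?_⟩, ?_⟩
      · rw [hT, map_add, ← h]
        simp [he1]
      · change e.1.1 + 0 = v
        rw [add_zero, he1]
  let eqv := RingEquiv.ofBijective _ hb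
  refine ⟨((RingHom.snd V B').comp (E.subtype.comp T.subtype)).comp eqv.symm.toRingHom, ?_⟩
  ext v
  obtain ⟨t, rfl⟩ := eqv.surjective v
  simp only [RingHom.comp_apply, RingEquiv.toRingHom_eq_coe, RingHom.coe_coe,
    RingEquiv.symm_apply_apply]
  exact ((hE _).1 t.1.2).symm

/-- Lifting to an adically complete ring from a local ring whose maximal ideal is generated by the
prime number `p`. -/
theorem exists_lift_of_isAdicComplete {V A : Type u} [CommRing V] [CommRing A]
    [IsLocalRing V] (p : ℕ) [Fact p.Prime] (hp : IsSMulRegular V (p : V))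
    (hm : maximalIdeal V = Ideal.span {(p : V)}) (I : Ideal A) [IsAdicComplete I A]
    (hpI : (p : A) ∈ I) (t : V →+* A ⧸ I) :
    ∃ s : V →+* A, (Ideal.Quotient.mk I).comp s = t := by
  let a : ℕ → ℕ := fun n => n + 1
  have ha : StrictMono a := fun m n h => Nat.succ_lt_succ h
  have step : ∀ n (f : V →+* A ⧸ I ^ (a n)), ∃ f' : V →+* A ⧸ I ^ (a (n + 1)),
      (Ideal.Quotient.factorPow I (ha.monotone n.le_succ)).comp f' = f := by
    intro n f
    have hz : ∀ x : A, Ideal.Quotient.factorPow I (ha.monotone n.le_succ)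
        (Ideal.Quotient.mk (I ^ (a (n + 1))) x) = 0 ↔ x ∈ I ^ (n + 1) := fun x => by
      rw [Ideal.Quotient.factor_mk, Ideal.Quotient.eq_zero_iff_mem]
    refine exists_lift_of_sq_zero p hp hm _ (Ideal.Quotient.factor_surjective _) ?_ ?_ f
    · intro x y hx hy
      obtain ⟨x, rfl⟩ := Ideal.Quotient.mk_surjective x
      obtain ⟨y, rfl⟩ := Ideal.Quotient.mk_surjective y
      rw [hz] at hx hy
      rw [← map_mul, Ideal.Quotient.eq_zero_iff_mem]
      have := Ideal.mul_mem_mul hx hy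
      rw [← pow_add] at this
      exact Ideal.pow_le_pow_right (by simp only [a]; omega) this
    · intro x hx
      obtain ⟨x, rfl⟩ := Ideal.Quotient.mk_surjective x
      rw [hz] at hx
      rw [← map_natCast (Ideal.Quotient.mk (I ^ a (n + 1))), ← map_mul,
        Ideal.Quotient.eq_zero_iff_mem]
      have := Ideal.mul_mem_mul hpI hx
      rwa [← pow_succ'] at this
  choose g hg using step
  have h1 : I ^ a 0 = I := by simp [a]
  let f0 : V →+* A ⧸ I ^ (a 0) := (Ideal.Quotient.factor h1.ge).comp t
  let f : ∀ n, V →+* A ⧸ I ^ (a n) := fun n => Nat.rec f0 (fun n h => g n h) n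
  have hf : ∀ {n}, (Ideal.Quotient.factorPow I (ha.monotone n.le_succ)).comp (f (n + 1)) = f n :=
    fun {n} => hg n (f n)
  refine ⟨IsAdicComplete.StrictMono.liftRingHom I ha f hf, ?_⟩
  have := IsAdicComplete.StrictMono.mk_comp_liftRingHom I ha f hf (n := 0)
  have h2 := congrArg ((Ideal.Quotient.factor h1.le).comp) this
  rw [← RingHom.comp_assoc] at h2
  ext v
  obtain ⟨w, hw⟩ := Ideal.Quotient.mk_surjective (t v)
  have h3 := RingHom.congr_fun h2 v
  simp only [RingHom.comp_apply, Ideal.Quotient.factor_mk] at h3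
  rw [RingHom.comp_apply, h3, ← hw]
  change Ideal.Quotient.factor h1.le (Ideal.Quotient.factor h1.ge (t v)) = _
  rw [← hw, Ideal.Quotient.factor_mk, Ideal.Quotient.factor_mk]

theorem exists_mvPowerSeries_hom {V A : Type*} [CommRing V] [CommRing A] {σ : Type*} [Finite σ]
    (I : Ideal A) [IsAdicComplete I A] (s : V →+* A) (a : σ → A) (ha : ∀ i, a i ∈ I) :
    ∃ ψ : MvPowerSeries σ V →+* A, (∀ v, ψ (MvPowerSeries.C v) = s v) ∧
      ∀ i, ψ (MvPowerSeries.X i) = a i := by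
  let _ : WithIdeal A := ⟨I⟩
  let _ : UniformSpace V := ⊥
  have : DiscreteUniformity V := ⟨rfl⟩
  obtain ⟨hc, ht⟩ := (IsAdic.isAdicComplete_iff (R := A) (I := I) rfl).1 inferInstance
  have hs : Continuous s := continuous_of_discreteTopology
  have hev : MvPowerSeries.HasEval a := by
    refine ⟨fun i => ?_, ?_⟩
    · have hI : IsAdic I := rfl
      refine (hI.hasBasis_nhds_zero.tendsto_right_iff).2 fun n _ => ?_
      filter_upwards [Filter.eventually_ge_atTop n] with k hk
      exact Ideal.pow_le_pow_right hk (Ideal.pow_mem_pow (ha i) k)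
    · rw [Filter.cofinite_eq_bot]; exact Filter.tendsto_bot
  refine ⟨MvPowerSeries.eval₂Hom hs hev, fun v => ?_, fun i => ?_⟩
  · rw [MvPowerSeries.coe_eval₂Hom, MvPowerSeries.eval₂_C]
  · rw [MvPowerSeries.coe_eval₂Hom, MvPowerSeries.eval₂_X]

theorem map_span_singleton {R S : Type*} [CommRing R] [CommRing S] (g : R →+* S) (x : R) :
    (Ideal.span {x}).map g = Ideal.span {g x} := by
  rw [Ideal.map_span, Set.image_singleton]

theorem surjective_of_mvPowerSeries {V A : Type*} [CommRing V] [CommRing A] {σ : Type*} [Finite σ]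
    [IsLocalRing A] [IsNoetherianRing A] (π : V) [IsAdicComplete (Ideal.span {π}) V]
    (ψ : MvPowerSeries σ V →+* A)
    (hm : maximalIdeal A = Ideal.span (Set.range fun i => ψ (MvPowerSeries.X i)) ⊔
      Ideal.span {ψ (MvPowerSeries.C π)})
    (hres : ∀ a : A, ∃ v : V, a - ψ (MvPowerSeries.C v) ∈ maximalIdeal A) :
    Function.Surjective ψ := by
  let J : Ideal (MvPowerSeries σ V) := .span (.range MvPowerSeries.X)
  have hJ : J.map ψ = Ideal.span (Set.range fun i => ψ (MvPowerSeries.X i)) := by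
    rw [Ideal.map_span, ← Set.range_comp]; rfl
  have hJm : J.map ψ ≤ maximalIdeal A := by rw [hJ, hm]; exact le_sup_left
  have hJt : J.map ψ ≠ ⊤ := fun h => (maximalIdeal.isMaximal A).ne_top (top_le_iff.1 (h ▸ hJm))
  have : IsHausdorff (J.map ψ) A := IsHausdorff.of_isLocalRing _ _ hJt
  refine surjective_of_mk_map_comp_surjective (I := J) ψ ?_
  have hnt : Nontrivial (A ⧸ J.map ψ) := Ideal.Quotient.nontrivial_iff.2 hJt
  have hloc : IsLocalRing (A ⧸ J.map ψ) :=
    IsLocalRing.of_surjective' (Ideal.Quotient.mk _) Ideal.Quotient.mk_surjective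
  let g : V →+* A ⧸ J.map ψ :=
    ((Ideal.Quotient.mk (J.map ψ)).comp ψ).comp MvPowerSeries.C
  suffices hg : Function.Surjective g by
    intro b
    obtain ⟨v, hv⟩ := hg b
    exact ⟨MvPowerSeries.C v, hv⟩
  have hmap : (Ideal.span {π}).map g = maximalIdeal (A ⧸ J.map ψ) := by
    rw [maximalIdeal_quotient, hm, Ideal.map_sup, ← hJ, Ideal.map_quotient_self, bot_sup_eq]
    exact (map_span_singleton g π).trans (map_span_singleton (Ideal.Quotient.mk (J.map ψ)) _).symm
  have : IsHausdorff ((Ideal.span {π}).map g) (A ⧸ J.map ψ) := by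
    rw [hmap]; infer_instance
  refine surjective_of_mk_map_comp_surjective (I := Ideal.span {π}) g ?_
  intro b
  obtain ⟨b, rfl⟩ := Ideal.Quotient.mk_surjective b
  obtain ⟨a, rfl⟩ := Ideal.Quotient.mk_surjective b
  obtain ⟨v, hv⟩ := hres a
  refine ⟨v, ?_⟩
  rw [RingHom.comp_apply, eq_comm, Ideal.Quotient.eq, hmap, maximalIdeal_quotient]
  exact Ideal.mem_map_of_mem (Ideal.Quotient.mk (J.map ψ)) hv

theorem exists_mvPowerSeries_presentation {Q A V : Type u} [CommRing Q] [IsLocalRing Q]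
    [IsNoetherianRing Q] [CommRing A] [IsLocalRing A] [IsNoetherianRing A]
    [IsAdicComplete (maximalIdeal A) A] [CommRing V] [IsLocalRing V] [IsNoetherianRing V]
    (φ : Q →+* A) (hφ : Function.Surjective φ) (x : Q) (hx0 : x ≠ 0) (hx : x ∈ maximalIdeal Q)
    (hker : RingHom.ker φ = Ideal.span {x}) {m : ℕ} (y : ℕ → Q)
    (hy : Ideal.span (y '' (Finset.range (m + 1) : Set ℕ)) = maximalIdeal Q)
    (hdim : ((m + 1 : ℕ) : WithBot ℕ∞) ≤ ringKrullDim Q)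
    (π : V) (hπ : IsSMulRegular V π) (hm : maximalIdeal V = Ideal.span {π})
    [IsAdicComplete (Ideal.span {π}) V] (s : V →+* A) (hs : s π = φ (y m))
    (hres : ∀ a : A, ∃ v : V, a - s v ∈ maximalIdeal A) :
    ∃ ψ : MvPowerSeries (Fin m) V →+* A, Function.Surjective ψ ∧
      ∃ f, f ≠ 0 ∧ RingHom.ker ψ = Ideal.span {f} := by
  have hmA : maximalIdeal A = (maximalIdeal Q).map φ :=
    (IsLocalRing.map_maximalIdeal_of_surjective φ hφ).symm
  have hyA : ∀ i < m + 1, φ (y i) ∈ maximalIdeal A := fun i hi => by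
    rw [hmA, ← hy]
    exact Ideal.mem_map_of_mem _ (Ideal.subset_span ⟨i, by simpa using hi, rfl⟩)
  obtain ⟨ψ, hψC, hψX⟩ := exists_mvPowerSeries_hom (maximalIdeal A) s
    (fun i : Fin m => φ (y i)) (fun i => hyA i (by omega))
  have hz : ∀ i < m + 1, φ (y i) = ψ ((varX m V ++ [MvPowerSeries.C π]).getD i 0) := by
    intro i hi
    rcases Nat.lt_succ_iff_lt_or_eq.1 hi with h | rfl
    · rw [List.getD_append _ _ _ _ (by simpa [varX] using h)]
      have : (varX m V).getD i 0 = MvPowerSeries.X ⟨i, h⟩ := by simp [varX, h]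
      rw [this, hψX]
    · rw [List.getD_append_right _ _ _ _ (by simp [varX])]
      simp [varX, hψC, hs]
  have hψ : Function.Surjective ψ := by
    refine surjective_of_mvPowerSeries π ψ ?_ fun a => ?_
    · rw [hmA, ← hy, Ideal.map_span, ← Ideal.span_union]
      congr 1
      ext a
      simp only [hψX, hψC, hs]
      constructor
      · rintro ⟨_, ⟨i, hi, rfl⟩, rfl⟩
        have hi' : i < m + 1 := by simpa using hi
        rcases Nat.lt_succ_iff_lt_or_eq.1 hi' with h | rfl
        · exact Or.inl ⟨⟨i, h⟩, rfl⟩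
        · exact Or.inr rfl
      · rintro (⟨i, rfl⟩ | rfl)
        · exact ⟨_, ⟨i, by simp, rfl⟩, rfl⟩
        · exact ⟨_, ⟨m, by simp, rfl⟩, rfl⟩
    · obtain ⟨v, hv⟩ := hres a
      exact ⟨v, by rwa [hψC]⟩
  refine ⟨ψ, hψ, ?_⟩
  have hl : (varX m V ++ [MvPowerSeries.C π]).length = m + 1 := by simp [varX]
  obtain ⟨h1, h2⟩ := SyzReg.of_isWeaklyRegular (varX m V ++ [MvPowerSeries.C π])
    (isWeaklyRegular_X_C _ (List.nodup_finRange m) π hπ)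
  rw [ofList_varX π hm] at h2
  rw [hl] at h1 h2
  exact exists_ker_eq_span φ hφ x hx0 hker ψ hψ (SyzReg.of_regular y hy hdim).2 h1 hy h2 hz hx

theorem exists_coefficient_field_of_algebra {F A : Type*} [Field F] [PerfectField F] [CommRing A]
    [IsLocalRing A] [IsAdicComplete (maximalIdeal A) A] [Algebra F A] :
    ∃ s : ResidueField A →+* A, ∀ x, residue A (s x) = x := by
  have := formallySmooth_of_perfectField F (ResidueField A)
  obtain ⟨g, hg⟩ := Algebra.FormallySmooth.exists_mkₐ_comp_eq_of_isAdicComplete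
    (I := maximalIdeal A) (AlgHom.id F (ResidueField A))
  exact ⟨g, fun x => AlgHom.congr_fun hg x⟩

theorem exists_coefficient_field {A : Type*} [CommRing A]
    [IsLocalRing A] [IsAdicComplete (maximalIdeal A) A]
    (h : (ringChar (ResidueField A) : A) = 0) :
    ∃ s : ResidueField A →+* A, ∀ x, residue A (s x) = x := by
  rcases CharP.char_is_prime_or_zero (ResidueField A) (ringChar (ResidueField A)) with hp | h0
  · have := Fact.mk hp
    have : CharP A (ringChar (ResidueField A)) := (CharP.charP_iff_prime_eq_zero hp).2 h
    let _ := ZMod.algebra A (ringChar (ResidueField A))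
    exact exists_coefficient_field_of_algebra (F := ZMod (ringChar (ResidueField A)))
  · have hc : CharZero (ResidueField A) := by
      have : CharP (ResidueField A) 0 := h0 ▸ ringChar.charP _
      exact CharP.charP_to_charZero _
    obtain ⟨_⟩ := (EqualCharZero.nonempty_algebraRat_iff A).2 fun I hI =>
      (show A ⧸ I →+* ResidueField A from
        Ideal.Quotient.factor (le_maximalIdeal hI)).charZero
    exact exists_coefficient_field_of_algebra (F := ℚ)

theorem exists_eq_unit_mul_pow {V : Type*} [CommRing V] [IsLocalRing V] (π : V)
    (hm : maximalIdeal V = Ideal.span {π}) [IsHausdorff (Ideal.span {π}) V] (x : V) (hx : x ≠ 0) :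
    ∃ (n : ℕ) (u : Vˣ), x = u * π ^ n := by
  by_contra! hc
  apply hx
  apply IsHausdorff.haus (I := Ideal.span {π}) inferInstance
  intro n
  rw [SModEq.zero, smul_eq_mul, Ideal.mul_top, Ideal.span_singleton_pow,
    Ideal.mem_span_singleton]
  induction n with
  | zero => simp
  | succ n ih =>
    obtain ⟨c, hc'⟩ := ih
    by_cases hu : IsUnit c
    · exact absurd (by rw [hc', hu.unit_spec, mul_comm]) (hc n hu.unit)
    · have : c ∈ maximalIdeal V := hu
      rw [hm, Ideal.mem_span_singleton] at this
      obtain ⟨d, rfl⟩ := this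
      exact ⟨d, by rw [hc', pow_succ, mul_assoc]⟩

theorem isDomain_of_isHausdorff {V : Type*} [CommRing V] [IsLocalRing V] (π : V)
    (hm : maximalIdeal V = Ideal.span {π}) (hπ : IsSMulRegular V π)
    [IsHausdorff (Ideal.span {π}) V] : IsDomain V := by
  have : NoZeroDivisors V := by
    refine ⟨fun {a b} hab => ?_⟩
    by_contra! h
    obtain ⟨m, u, rfl⟩ := exists_eq_unit_mul_pow π hm a h.1
    obtain ⟨n, w, rfl⟩ := exists_eq_unit_mul_pow π hm b h.2
    have h1 : π ^ (m + n) * ((u * w : Vˣ) : V) = 0 := by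
      rw [← hab, Units.val_mul]; ring
    have h2 := (hπ.pow (m + n)) (h1.trans (smul_zero (π ^ (m + n))).symm)
    exact (u * w).ne_zero h2
  exact NoZeroDivisors.to_isDomain _

theorem isNoetherianRing_of_isHausdorff {V : Type*} [CommRing V] [IsLocalRing V] (π : V)
    (hm : maximalIdeal V = Ideal.span {π}) 
    [IsHausdorff (Ideal.span {π}) V] : IsNoetherianRing V := by
  refine IsNoetherianRing.of_prime fun P hP => ?_
  by_cases h : P = ⊥
  · rw [h]; exact Submodule.fg_bot
  · obtain ⟨x, hx, hx0⟩ := Submodule.exists_mem_ne_zero_of_ne_bot h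
    obtain ⟨n, u, rfl⟩ := exists_eq_unit_mul_pow π hm x hx0
    have h1 : π ^ n ∈ P := (Ideal.unit_mul_mem_iff_mem P u.isUnit).1 hx
    have h2 := hP.mem_of_pow_mem n h1
    have : P = Ideal.span {π} := le_antisymm (hm ▸ le_maximalIdeal hP.ne_top)
      (by rwa [Ideal.span_singleton_le_iff_mem])
    exact ⟨{π}, by rw [this]; simp⟩

theorem ringChar_residueField_mem {A : Type*} [CommRing A] [IsLocalRing A] :
    (ringChar (ResidueField A) : A) ∈ maximalIdeal A := by
  rw [← residue_eq_zero_iff, map_natCast]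
  exact ringChar.Nat.cast_ringChar

theorem exists_mvPowerSeries_presentation_of_eq_zero {Q A : Type u} [CommRing Q] [IsLocalRing Q]
    [IsNoetherianRing Q] [CommRing A] [IsLocalRing A] [IsNoetherianRing A]
    [IsAdicComplete (maximalIdeal A) A]
    (φ : Q →+* A) (hφ : Function.Surjective φ) (x : Q) (hx0 : x ≠ 0) (hx : x ∈ maximalIdeal Q)
    (hker : RingHom.ker φ = Ideal.span {x}) {m : ℕ} (y : ℕ → Q)
    (hy : Ideal.span (y '' (Finset.range (m + 1) : Set ℕ)) = maximalIdeal Q)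
    (hdim : ((m + 1 : ℕ) : WithBot ℕ∞) ≤ ringKrullDim Q)
    (h0 : (ringChar (ResidueField A) : A) = 0) :
    ∃ ψ : MvPowerSeries (Fin m) (PowerSeries (ResidueField A)) →+* A, Function.Surjective ψ ∧
      ∃ f, f ≠ 0 ∧ RingHom.ker ψ = Ideal.span {f} := by
  obtain ⟨s, hs⟩ := exists_coefficient_field h0
  have hyA : φ (y m) ∈ maximalIdeal A := by
    rw [← IsLocalRing.map_maximalIdeal_of_surjective φ hφ, ← hy]
    exact Ideal.mem_map_of_mem _ (Ideal.subset_span ⟨m, by simp, rfl⟩)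
  obtain ⟨t, htC, htX⟩ := exists_mvPowerSeries_hom (maximalIdeal A) s
    (fun _ : Unit => φ (y m)) (fun _ => hyA)
  exact exists_mvPowerSeries_presentation φ hφ x hx0 hx hker y hy hdim
    (PowerSeries.X : PowerSeries (ResidueField A))
    (fun a b h => mul_left_cancel₀ PowerSeries.X_ne_zero h)
    PowerSeries.maximalIdeal_eq_span_X t (htX ()) (fun a => ⟨PowerSeries.C (residue A a), by
      rw [← residue_eq_zero_iff, map_sub]
      have : t (PowerSeries.C (residue A a)) = s (residue A a) := htC _
      rw [this, hs, sub_self]⟩)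

theorem exists_complete_of_regular {Q k : Type u} [CommRing Q] [IsLocalRing Q]
    [IsNoetherianRing Q] [Field k] (f : Q →+* k) (hf : Function.Surjective f) {m : ℕ} (p : ℕ)
    (y : ℕ → Q) (hym : y m = p)
    (hy : Ideal.span (y '' (Finset.range (m + 1) : Set ℕ)) = maximalIdeal Q)
    (hdim : ((m + 1 : ℕ) : WithBot ℕ∞) ≤ ringKrullDim Q) :
    ∃ (V : Type u) (_ : CommRing V) (_ : IsLocalRing V), maximalIdeal V = Ideal.span {(p : V)} ∧
      IsSMulRegular V (p : V) ∧ IsAdicComplete (Ideal.span {(p : V)}) V ∧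
      ∃ t : V →+* k, Function.Surjective t := by
  obtain ⟨hprime, hsyz⟩ := SyzReg.of_regular y hy hdim
  let I := Ideal.span (y '' (Finset.range m : Set ℕ))
  have hI : I.IsPrime := hprime m (by omega)
  have hloc : IsLocalRing (Q ⧸ I) :=
    IsLocalRing.of_surjective' (Ideal.Quotient.mk _) Ideal.Quotient.mk_surjective
  have hmax : maximalIdeal (Q ⧸ I) = Ideal.span {(p : Q ⧸ I)} := by
    have h1 : y '' (Finset.range (m + 1) : Set ℕ) = y '' (Finset.range m : Set ℕ) ∪ {(p : Q)} := by
      rw [Finset.range_add_one, Finset.coe_insert, Set.image_insert_eq, hym, Set.insert_eq,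
        Set.union_comm]
    rw [maximalIdeal_quotient, ← hy, h1, Ideal.span_union, Ideal.map_sup, Ideal.map_quotient_self,
      bot_sup_eq, map_span_singleton, map_natCast]
  have hreg : IsSMulRegular (Q ⧸ I) (p : Q ⧸ I) := by
    rw [isSMulRegular_iff_right_eq_zero_of_smul]
    intro a ha
    obtain ⟨a, rfl⟩ := Ideal.Quotient.mk_surjective a
    rw [smul_eq_mul, ← map_natCast (Ideal.Quotient.mk I), ← map_mul, Ideal.Quotient.eq_zero_iff_mem,
      mul_comm, ← hym] at ha
    exact Ideal.Quotient.eq_zero_iff_mem.2 (hsyz m (by omega) a ha)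
  let V := AdicCompletion (maximalIdeal (Q ⧸ I)) (Q ⧸ I)
  have hV : maximalIdeal V = Ideal.span {(p : V)} := by
    have h2 : (maximalIdeal (Q ⧸ I)).map (algebraMap (Q ⧸ I) V) = Ideal.span {(p : V)} :=
      (congrArg (Ideal.map _) hmax).trans (by rw [map_span_singleton, map_natCast])
    exact AdicCompletion.maximalIdeal_eq_map.trans h2
  have hc : IsAdicComplete (maximalIdeal V) V := inferInstance
  refine ⟨V, inferInstance, inferInstance, hV, ?_, hV ▸ hc, ?_⟩
  · have h1 : IsSMulRegular V (p : Q ⧸ I) := Module.Flat.isSMulRegular_of_nonZeroDivisors (by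
      rw [mem_nonZeroDivisors_iff_right]
      exact fun a ha => hreg (by simpa [mul_comm] using ha))
    intro a b h
    refine h1 ?_
    simpa only [Algebra.smul_def, map_natCast, smul_eq_mul] using h
  · have hker : RingHom.ker f = maximalIdeal Q :=
      eq_maximalIdeal (RingHom.ker_isMaximal_of_surjective f hf)
    have hIm : I ≤ maximalIdeal Q := le_maximalIdeal hI.ne_top
    let f1 : Q ⧸ I →+* k := Ideal.Quotient.lift I f fun a ha => by
      have := hIm ha
      rwa [← hker] at this
    have hf1 : Function.Surjective f1 := Ideal.Quotient.lift_surjective_of_surjective _ _ hf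
    have hker1 : RingHom.ker f1 = maximalIdeal (Q ⧸ I) :=
      eq_maximalIdeal (RingHom.ker_isMaximal_of_surjective f1 hf1)
    let f2 : (Q ⧸ I) ⧸ maximalIdeal (Q ⧸ I) →+* k := Ideal.Quotient.lift _ f1 fun a ha => by
      rwa [← hker1] at ha
    have hf2 : Function.Surjective f2 := Ideal.Quotient.lift_surjective_of_surjective _ _ hf1
    exact ⟨f2.comp (AdicCompletion.evalOneₐ (maximalIdeal (Q ⧸ I))).toRingHom,
      hf2.comp (AdicCompletion.evalOneₐ_surjective _)⟩

theorem exists_mvPowerSeries_presentation_of_notMem {Q A : Type u} [CommRing Q] [IsLocalRing Q]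
    [IsNoetherianRing Q] [CommRing A] [IsLocalRing A] [IsNoetherianRing A]
    [IsAdicComplete (maximalIdeal A) A]
    (φ : Q →+* A) (hφ : Function.Surjective φ) (x : Q) (hx0 : x ≠ 0) (hx : x ∈ maximalIdeal Q)
    (hker : RingHom.ker φ = Ideal.span {x}) {m : ℕ} (y : ℕ → Q) (p : ℕ) [Fact p.Prime]
    (hp : p = ringChar (ResidueField A)) (hym : y m = p)
    (hy : Ideal.span (y '' (Finset.range (m + 1) : Set ℕ)) = maximalIdeal Q)
    (hdim : ((m + 1 : ℕ) : WithBot ℕ∞) ≤ ringKrullDim Q) :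
    ∃ (V : Type u) (_ : CommRing V) (_ : IsDomain V) (_ : IsLocalRing V) (_ : IsNoetherianRing V)
      (π : V), maximalIdeal V = Ideal.span {π} ∧ IsSMulRegular V π ∧
      ∃ ψ : MvPowerSeries (Fin m) V →+* A, Function.Surjective ψ ∧
        ∃ f, f ≠ 0 ∧ RingHom.ker ψ = Ideal.span {f} := by
  obtain ⟨V, _, _, hV, hreg, hcomp, t, ht⟩ := exists_complete_of_regular
    ((residue A).comp φ) (residue_surjective.comp hφ) p y hym hy hdim
  obtain ⟨s, hs⟩ := exists_lift_of_isAdicComplete p hreg hV (maximalIdeal A)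
    (by rw [hp]; exact ringChar_residueField_mem) t
  have : IsNoetherianRing V := isNoetherianRing_of_isHausdorff _ hV
  refine ⟨V, inferInstance, isDomain_of_isHausdorff _ hV hreg, inferInstance, this, (p : V), hV,
    hreg, ?_⟩
  exact exists_mvPowerSeries_presentation φ hφ x hx0 hx hker y hy hdim
    (p : V) hreg hV s (by rw [hym, map_natCast, map_natCast]) (fun a => by
      obtain ⟨v, hv⟩ := ht (residue A a)
      refine ⟨v, ?_⟩
      rw [← residue_eq_zero_iff, map_sub, ← hv, ← hs]
      exact sub_self _)

theorem image_range_extend {Q : Type*} {n : ℕ} (z : Fin n → Q) (t : Q) :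
    (fun j : ℕ => if h : j < n then z ⟨j, h⟩ else t) '' (Finset.range (n + 1) : Set ℕ) =
      insert t (Set.range z) := by
  apply Set.Subset.antisymm
  · rintro _ ⟨j, -, rfl⟩
    by_cases h : j < n
    · simp only [dif_pos h]
      exact Or.inr ⟨_, rfl⟩
    · simp only [dif_neg h]
      exact Or.inl rfl
  · rintro _ (rfl | ⟨j, rfl⟩)
    · exact ⟨n, by simp, by simp⟩
    · exact ⟨j, by have := j.2; simp, by simp⟩

theorem natCast_mem_of_completion {R : Type*} [CommRing R] [IsLocalRing R] [IsNoetherianRing R]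
    {p : ℕ} (h : (p : AdicCompletion (maximalIdeal R) R) ∈
      maximalIdeal (AdicCompletion (maximalIdeal R) R) ^ 2) : (p : R) ∈ maximalIdeal R ^ 2 := by
  have h1 : maximalIdeal (AdicCompletion (maximalIdeal R) R) ^ 2 ≤
      RingHom.ker (AdicCompletion.evalₐ (maximalIdeal R) 2).toRingHom := by
    rw [AdicCompletion.maximalIdeal_eq_map, ← Ideal.map_pow, Ideal.map_le_iff_le_comap]
    intro r hr
    change AdicCompletion.evalₐ (maximalIdeal R) 2 (algebraMap R _ r) = 0
    rw [AlgHom.commutes]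
    exact Ideal.Quotient.eq_zero_iff_mem.2 hr
  have h2 : AdicCompletion.evalₐ (maximalIdeal R) 2 (p : AdicCompletion (maximalIdeal R) R) = 0 :=
    h1 h
  rw [map_natCast, ← map_natCast (Ideal.Quotient.mk _)] at h2
  exact Ideal.Quotient.eq_zero_iff_mem.1 h2

theorem ringChar_residueField_eq {R A : Type*} [CommRing R] [IsLocalRing R] [CommRing A]
    [IsLocalRing A] (f : R →+* A) [IsLocalHom f] :
    ringChar (ResidueField R) = ringChar (ResidueField A) := by
  have := charP_of_injective_ringHom (ResidueField.map f).injective (ringChar (ResidueField R))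
  exact (ringChar.eq (ResidueField A) (ringChar (ResidueField R))).symm

theorem exists_mvPowerSeries_presentation_completion {R : Type u} [CommRing R] [IsLocalRing R]
    [IsNoetherianRing R] {Q : Type u} [CommRing Q] [IsLocalRing Q] [IsNoetherianRing Q]
    (hunr : (ringChar (ResidueField R) : R) = 0 ∨
      (ringChar (ResidueField R) : R) ∉ maximalIdeal R ^ 2)
    {n : ℕ} (y : Fin n → Q) (hy : Ideal.span (Set.range y) = maximalIdeal Q)
    (hdim : (n : WithBot ℕ∞) ≤ ringKrullDim Q)
    (x : Q) (hx0 : x ≠ 0) (hx : x ∈ maximalIdeal Q ^ 2)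
    (e : AdicCompletion (maximalIdeal R) R ≃+* Q ⧸ Ideal.span {x}) :
    IsNoetherianRing (AdicCompletion (maximalIdeal R) R) ∧
    ∃ (V : Type u) (_ : CommRing V) (_ : IsDomain V) (_ : IsLocalRing V) (_ : IsNoetherianRing V)
      (π : V) (m : ℕ), maximalIdeal V = Ideal.span {π} ∧ IsSMulRegular V π ∧
      ∃ ψ : MvPowerSeries (Fin m) V →+* AdicCompletion (maximalIdeal R) R,
        Function.Surjective ψ ∧ ∃ f, f ≠ 0 ∧ RingHom.ker ψ = Ideal.span {f} := by
  have hN : IsNoetherianRing (AdicCompletion (maximalIdeal R) R) :=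
    isNoetherianRing_of_ringEquiv _ e.symm
  refine ⟨hN, ?_⟩
  have hxm : x ∈ maximalIdeal Q := Ideal.pow_le_self two_ne_zero hx
  cases n with
  | zero =>
    rw [Set.range_eq_empty, Ideal.span_empty] at hy
    rw [← hy] at hxm
    exact absurd hxm hx0
  | succ m =>
    let φ : Q →+* AdicCompletion (maximalIdeal R) R :=
      e.symm.toRingHom.comp (Ideal.Quotient.mk (Ideal.span {x}))
    have hφ : Function.Surjective φ := e.symm.surjective.comp Ideal.Quotient.mk_surjective
    have hker : RingHom.ker φ = Ideal.span {x} := by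
      ext a
      rw [RingHom.mem_ker]
      change e.symm (Ideal.Quotient.mk _ a) = 0 ↔ _
      rw [EmbeddingLike.map_eq_zero_iff, Ideal.Quotient.eq_zero_iff_mem]
    have hchar := ringChar_residueField_eq
      (algebraMap R (AdicCompletion (maximalIdeal R) R))
    rcases hunr with h0 | h2
    · have h0' : (ringChar (ResidueField (AdicCompletion (maximalIdeal R) R)) :
          AdicCompletion (maximalIdeal R) R) = 0 := by
        rw [← hchar, ← map_natCast (algebraMap R _), h0, map_zero]
      have hp := exists_mvPowerSeries_presentation_of_eq_zero φ hφ x hx0 hxm hker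
        (fun j : ℕ => if h : j < m then y (Fin.castSucc ⟨j, h⟩) else y (Fin.last m)) (m := m)
        (by
          rw [image_range_extend (fun j => y (Fin.castSucc j)), ← hy]
          congr 1
          apply Set.Subset.antisymm
          · rintro _ (rfl | ⟨j, rfl⟩) <;> exact ⟨_, rfl⟩
          · rintro _ ⟨j, rfl⟩
            induction j using Fin.lastCases with
            | last => exact Or.inl rfl
            | cast j => exact Or.inr ⟨j, rfl⟩) hdim h0'
      refine ⟨PowerSeries (ResidueField (AdicCompletion (maximalIdeal R) R)), inferInstance,
        inferInstance, inferInstance, inferInstance, PowerSeries.X, m,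
        PowerSeries.maximalIdeal_eq_span_X, fun a b h => mul_left_cancel₀ PowerSeries.X_ne_zero h,
        hp⟩
    · have hpne : ringChar (ResidueField R) ≠ 0 := by
        intro h
        rw [h, Nat.cast_zero] at h2
        exact h2 (zero_mem _)
      have hprime : Fact (ringChar (ResidueField R)).Prime :=
        ⟨(CharP.char_is_prime_or_zero (ResidueField R) _).resolve_right hpne⟩
      have hpQ : ((ringChar (ResidueField R) : ℕ) : Q) ∈ maximalIdeal Q := by
        have h3 : (maximalIdeal (AdicCompletion (maximalIdeal R) R)).comap φ = maximalIdeal Q :=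
          eq_maximalIdeal (Ideal.comap_isMaximal_of_surjective φ hφ)
        rw [← h3, Ideal.mem_comap, map_natCast, hchar]
        exact ringChar_residueField_mem
      obtain ⟨z, hz⟩ := span_exchange hy hpQ (fun h => h2 (natCast_mem_of_completion (by
        rw [← map_natCast φ, ← IsLocalRing.map_maximalIdeal_of_surjective φ hφ, ← Ideal.map_pow]
        exact Ideal.mem_map_of_mem _ h)))
      obtain ⟨V, i1, i2, i3, i4, π, h4⟩ := exists_mvPowerSeries_presentation_of_notMem φ hφ x hx0
        hxm hker (fun j : ℕ => if h : j < m then z ⟨j, h⟩ else (ringChar (ResidueField R) : Q))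
        (m := m) (ringChar (ResidueField R)) hchar (by simp)
        (by rw [image_range_extend z, hz]) hdim
      exact ⟨V, i1, i2, i3, i4, π, m, h4⟩

theorem exists_finite_free_cover {R : Type u} [CommRing R] [IsNoetherianRing R]
    {Z : Type*} [AddCommGroup Z] [Module R Z] [Module.Finite R Z] (K : Submodule R Z) :
    ∃ (n : ℕ) (g : (Fin n → R) →ₗ[R] Z), LinearMap.range g = K := by
  have : Module.Finite R K := Module.Finite.iff_fg.2 (IsNoetherian.noetherian K)
  obtain ⟨n, g, hg⟩ := Module.Finite.exists_fin' R K
  exact ⟨n, K.subtype.comp g, by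
    rw [LinearMap.range_comp, LinearMap.range_eq_top.2 hg, Submodule.map_top,
      Submodule.range_subtype]⟩

/-- The resolution by finite free modules, starting from a submodule of a finite free module. -/
theorem exists_free_resolution (R : Type u) [CommRing R] [IsNoetherianRing R]
    (M : Type u) [AddCommGroup M] [Module R M] [Module.Finite R M] :
    ∃ (n : ℕ → ℕ) (ε : (Fin (n 0) → R) →ₗ[R] M)
      (δ : ∀ j, (Fin (n (j + 1)) → R) →ₗ[R] (Fin (n j) → R)),
      Function.Surjective ε ∧ LinearMap.range (δ 0) = LinearMap.ker ε ∧
        ∀ j, LinearMap.range (δ (j + 1)) = LinearMap.ker (δ j) := by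
  obtain ⟨n₀, ε, hε⟩ := Module.Finite.exists_fin' R M
  choose r g hg using fun s : (n : ℕ) × Submodule R (Fin n → R) =>
    exists_finite_free_cover (R := R) s.2
  let σ : ℕ → (n : ℕ) × Submodule R (Fin n → R) := fun j =>
    Nat.rec ⟨n₀, LinearMap.ker ε⟩ (fun _ s => ⟨r s, LinearMap.ker (g s)⟩) j
  exact ⟨fun j => (σ j).1, ε, fun j => g (σ j), hε, hg (σ 0), fun j => hg (σ (j + 1))⟩

section Resolution

variable {R : Type u} [CommRing R] {M : Type u} [AddCommGroup M] [Module R M]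
  {n : ℕ → ℕ} (ε : (Fin (n 0) → R) →ₗ[R] M)
  (δ : ∀ j, (Fin (n (j + 1)) → R) →ₗ[R] (Fin (n j) → R))

/-- The chain complex of modules given by a sequence of maps between finite free modules. -/
noncomputable def freeComplex (hδ : ∀ j, LinearMap.range (δ (j + 1)) = LinearMap.ker (δ j)) :
    ChainComplex (ModuleCat.{u} R) ℕ :=
  ChainComplex.of (fun j => ModuleCat.of R (Fin (n j) → R)) (fun j => ModuleCat.ofHom (δ j))
    (fun j => ModuleCat.hom_ext (LinearMap.range_le_ker_iff.1 (hδ j).le))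

theorem freeComplex_d (hδ : ∀ j, LinearMap.range (δ (j + 1)) = LinearMap.ker (δ j)) (j : ℕ) :
    (freeComplex δ hδ).d (j + 1) j = ModuleCat.ofHom (δ j) :=
  ChainComplex.of_d (fun j => ModuleCat.of R (Fin (n j) → R)) (fun j => ModuleCat.ofHom (δ j)) j

/-- The projective resolution given by an exact sequence of finite free modules. -/
noncomputable def freeResolution (hε : Function.Surjective ε)
    (h0 : LinearMap.range (δ 0) = LinearMap.ker ε)
    (hδ : ∀ j, LinearMap.range (δ (j + 1)) = LinearMap.ker (δ j)) :
    ProjectiveResolution (ModuleCat.of R M) where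
  complex := freeComplex δ hδ
  projective j :=
    ModuleCat.projective_of_free (M := ModuleCat.of R (Fin (n j) → R)) (Pi.basisFun R _)
  π := (ChainComplex.toSingle₀Equiv _ _).symm ⟨ModuleCat.ofHom ε, by
    rw [freeComplex_d]
    exact ModuleCat.hom_ext (LinearMap.range_le_ker_iff.1 h0.le)⟩
  quasiIso := ⟨fun j => by
    cases j with
    | zero =>
      rw [ChainComplex.quasiIsoAt₀_iff, ShortComplex.quasiIso_iff_of_zeros']
      · refine (ShortComplex.exact_and_epi_g_iff_of_iso
          (S₂ := ShortComplex.mk (ModuleCat.ofHom (δ 0)) (ModuleCat.ofHom ε)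
            (ModuleCat.hom_ext (LinearMap.range_le_ker_iff.1 h0.le))) ?_).2
          ⟨(ShortComplex.moduleCat_exact_iff_range_eq_ker _).2 h0,
            (ModuleCat.epi_iff_surjective _).2 hε⟩
        exact ShortComplex.isoMk (Iso.refl _) (Iso.refl _) (Iso.refl _)
          (by simp [freeComplex]; rfl) (by simp; rfl)
      all_goals rfl
    | succ j =>
      rw [quasiIsoAt_iff_exactAt']
      · rw [HomologicalComplex.exactAt_iff' _ (j + 1 + 1) (j + 1) j (by simp) (by simp)]
        rw [ShortComplex.moduleCat_exact_iff_range_eq_ker]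
        simp only [HomologicalComplex.sc', HomologicalComplex.shortComplexFunctor', freeComplex_d]
        exact hδ j
      · apply ChainComplex.exactAt_succ_single_obj⟩

end Resolution

theorem nonempty_homology_equiv {R : Type u} [CommRing R] (S : ShortComplex (ModuleCat.{u} R))
    {X : ℕ → Type u} [∀ j, AddCommGroup (X j)] [∀ j, Module R (X j)]
    (D : ∀ j, X j →ₗ[R] X (j + 1)) (j : ℕ) (e : S.X₂ ≃ₗ[R] X (j + 1))
    (hg : ∀ x, S.g.hom x = 0 ↔ D (j + 1) (e x) = 0)
    (hf : ∀ x, (∃ y, S.f.hom y = x) ↔ ∃ y, D j y = e x) :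
    Nonempty (S.homology ≃ₗ[R] Hm D j) := by
  refine ⟨S.moduleCatHomologyIso.toLinearEquiv.trans (Submodule.Quotient.equiv _ _
    (e.ofSubmodules (LinearMap.ker S.g.hom) (LinearMap.ker (D (j + 1))) ?_) ?_)⟩
  · ext y
    rw [Submodule.mem_map]
    constructor
    · rintro ⟨x, hx, rfl⟩
      exact (hg x).1 hx
    · intro hy
      exact ⟨e.symm y, (hg _).2 (by rwa [e.apply_symm_apply]), e.apply_symm_apply y⟩
  · ext ⟨y, hy⟩
    rw [Submodule.mem_map]
    constructor
    · rintro ⟨_, ⟨z, rfl⟩, h⟩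
      have h2 : e (S.f.hom z) = y := congrArg Subtype.val h
      obtain ⟨w, hw⟩ := (hf _).1 ⟨z, rfl⟩
      exact ⟨w, hw.trans h2⟩
    · rintro ⟨w, hw⟩
      obtain ⟨z, hz⟩ := (hf (e.symm y)).2 ⟨w, by rw [e.apply_symm_apply]; exact hw⟩
      refine ⟨_, ⟨z, rfl⟩, Subtype.ext ?_⟩
      change e (S.f.hom z) = y
      rw [hz, e.apply_symm_apply]

/-- The ranks of a free resolution, shifted by two places. -/
def shiftIdx (n : ℕ → ℕ) : ℕ → Type
  | 0 => Empty
  | 1 => Empty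
  | j + 2 => Fin (n j)

instance (n : ℕ → ℕ) : ∀ j, Fintype (shiftIdx n j)
  | 0 => inferInstanceAs (Fintype Empty)
  | 1 => inferInstanceAs (Fintype Empty)
  | j + 2 => inferInstanceAs (Fintype (Fin (n j)))

instance (n : ℕ → ℕ) : IsEmpty (shiftIdx n 0) := inferInstanceAs (IsEmpty Empty)

instance (n : ℕ → ℕ) : IsEmpty (shiftIdx n 1) := inferInstanceAs (IsEmpty Empty)

section Dual

variable {R : Type u} [CommRing R] {n : ℕ → ℕ}
  (δ : ∀ j, (Fin (n (j + 1)) → R) →ₗ[R] (Fin (n j) → R))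

/-- The transposed matrices of a sequence of maps between finite free modules. -/
def dualMatrix : ∀ j, Matrix (shiftIdx n (j + 1)) (shiftIdx n j) R
  | 0 => 0
  | 1 => 0
  | j + 2 => fun k i => δ j (Pi.single (M := fun _ => R) (show Fin (n (j + 1)) from k) 1)
      (show Fin (n j) from i)

theorem mv_dualMatrix (N : Type*) [AddCommGroup N] [Module R N] (j : ℕ)
    (φ : (Fin (n j) → R) →ₗ[R] N) (k : Fin (n (j + 1))) :
    mv (dualMatrix δ (j + 2)) N (fun i : Fin (n j) => φ (Pi.single i 1)) k =
      φ (δ j (Pi.single k 1)) := by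
  rw [LinearMap.pi_apply_eq_sum_univ φ (δ j (Pi.single k 1))]
  have h : ∀ i : Fin (n j), (Pi.single i 1 : Fin (n j) → R) = fun l => if i = l then 1 else 0 := by
    intro i
    funext l
    simp only [Pi.single_apply, eq_comm]
  simp only [← h]
  rfl

theorem dualMatrix_mul (hδ : ∀ j, LinearMap.range (δ (j + 1)) = LinearMap.ker (δ j)) (j : ℕ) :
    dualMatrix δ (j + 1) * dualMatrix δ j = 0 := by
  match j with
  | 0 => exact Matrix.mul_zero _
  | 1 => exact Matrix.mul_zero _
  | j + 2 =>
    ext k i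
    have h1 := mv_dualMatrix δ R (j + 1)
      ((LinearMap.proj (show Fin (n j) from i)).comp (δ j)) k
    have h2 : δ j (δ (j + 1) (Pi.single (M := fun _ => R) (show Fin (n (j + 2)) from k) 1)) = 0 :=
      (hδ j).le ⟨_, rfl⟩
    rw [LinearMap.comp_apply, h2, map_zero] at h1
    exact h1

theorem nonempty_ext_equiv {M : Type u} [AddCommGroup M] [Module R M]
    (ε : (Fin (n 0) → R) →ₗ[R] M) (hε : Function.Surjective ε)
    (h0 : LinearMap.range (δ 0) = LinearMap.ker ε)
    (hδ : ∀ j, LinearMap.range (δ (j + 1)) = LinearMap.ker (δ j))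
    (N : Type u) [AddCommGroup N] [Module R N] (j : ℕ) :
    Nonempty (((Ext R (ModuleCat.{u} R) j).obj (Opposite.op (ModuleCat.of R M))).obj
      (ModuleCat.of R N) ≃ₗ[R] hq (dualMatrix δ) N (j + 1)) := by
  let C := (freeComplex δ hδ).linearYonedaObj R (ModuleCat.of R N)
  let E : ∀ j, C.X j ≃ₗ[R] (Fin (n j) → N) := fun j =>
    (ModuleCat.homLinearEquiv (S := R)).trans ((Pi.basisFun R (Fin (n j))).constr R).symm
  have hE : ∀ j (φ : C.X j) i, E j φ i =
      ModuleCat.Hom.hom (show ModuleCat.of R (Fin (n j) → R) ⟶ ModuleCat.of R N from φ)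
        (Pi.single i 1) := by
    intro j φ i
    exact congrArg (ModuleCat.Hom.hom
      (show ModuleCat.of R (Fin (n j) → R) ⟶ ModuleCat.of R N from φ)) (Pi.basisFun_apply R _ i)
  have hd : ∀ j (φ : C.X j), E (j + 1) ((C.d j (j + 1)).hom φ) =
      mv (dualMatrix δ (j + 2)) N (E j φ) := by
    intro j φ
    funext k
    rw [hE]
    have h1 := mv_dualMatrix δ N j
      (ModuleCat.Hom.hom (show ModuleCat.of R (Fin (n j) → R) ⟶ ModuleCat.of R N from φ)) k
    refine Eq.trans ?_ (h1.symm.trans (congrFun (congrArg (mv (dualMatrix δ (j + 2)) N)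
      (funext fun i => (hE j φ i).symm)) k))
    have h2 : (C.d j (j + 1)).hom φ = (freeComplex δ hδ).d (j + 1) j ≫
      (show ModuleCat.of R (Fin (n j) → R) ⟶ ModuleCat.of R N from φ) := rfl
    rw [h2, freeComplex_d]
    rfl
  obtain ⟨e⟩ := nonempty_homology_equiv (C.sc j) (fun j => mv (dualMatrix δ j) N) (j + 1) (E j)
    (by
      intro x
      have : ∀ k, k = j + 1 → ((C.d j k).hom x = 0 ↔ mv (dualMatrix δ (j + 2)) N (E j x) = 0) := by
        rintro _ rfl
        exact ⟨fun h => (hd j x).symm.trans ((congrArg (E (j + 1)) h).trans (map_zero _)),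
          fun h => (E (j + 1)).map_eq_zero_iff.1 ((hd j x).trans h)⟩
      exact this _ (CochainComplex.next ℕ j))
    (by
      intro x
      cases j with
      | zero =>
        have : ∀ k, k = 0 → ((∃ y, (C.d k 0).hom y = x) ↔
            ∃ y, mv (dualMatrix δ 1) N y = E 0 x) := by
          rintro _ rfl
          have h1 : C.d 0 0 = 0 := C.shape _ _ (by simp)
          rw [h1]
          constructor
          · rintro ⟨y, rfl⟩
            exact ⟨0, by rw [map_zero]; exact (map_zero (E 0)).symm⟩
          · rintro ⟨y, hy⟩
            have h2 : mv (dualMatrix δ 1) N y = 0 := mv_zero y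
            exact ⟨0, ((E 0).map_eq_zero_iff.1 (hy.symm.trans h2)).symm⟩
        exact this _ CochainComplex.prev_nat_zero
      | succ j =>
        have : ∀ k, k = j → ((∃ y, (C.d k (j + 1)).hom y = x) ↔
            ∃ y, mv (dualMatrix δ (j + 2)) N y = E (j + 1) x) := by
          rintro k rfl
          constructor
          · rintro ⟨y, rfl⟩
            exact ⟨E k y, (hd k y).symm⟩
          · rintro ⟨y, hy⟩
            refine ⟨(E k).symm y, (E (k + 1)).injective ?_⟩
            exact (hd k _).trans ((congrArg (mv (dualMatrix δ (k + 2)) N)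
              ((E k).apply_symm_apply y)).trans hy)
        exact this _ (CochainComplex.prev_nat_succ j))
  exact ⟨((freeResolution ε δ hε h0 hδ).isoExt j (ModuleCat.of R N)).toLinearEquiv.trans e⟩

end Dual

section BaseChange

variable {R A : Type u} [CommRing R] [CommRing A] [Algebra R A]

theorem piRight_lTensor_mv {κ ι : Type} [Fintype ι] [DecidableEq ι] [Fintype κ] [DecidableEq κ]
    (M : Matrix κ ι R) (N : Type u) [AddCommGroup N] [Module R N] (t : A ⊗[R] (ι → N)) :
    TensorProduct.piRight R A A (fun _ : κ => N) ((mv M N).lTensor A t) =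
      mv (M.map (algebraMap R A)) (A ⊗[R] N) (TensorProduct.piRight R A A (fun _ : ι => N) t) := by
  induction t with
  | zero => simp
  | add x y hx hy => simp only [map_add, hx, hy]
  | tmul a x =>
    funext k
    simp only [LinearMap.lTensor_tmul, TensorProduct.piRight_apply,
      TensorProduct.piRightHom_tmul, mv_apply, Matrix.map_apply, TensorProduct.tmul_sum]
    refine Finset.sum_congr rfl fun i _ => ?_
    rw [TensorProduct.tmul_smul, algebraMap_smul]

variable {ι : ℕ → Type} [∀ j, Fintype (ι j)] (d : ∀ j, Matrix (ι (j + 1)) (ι j) R)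

/-- Cycles of the base change are combinations of cycles. -/
theorem smul_mem_range_baseChange [Module.Flat R A] (N : Type u) [AddCommGroup N] [Module R N]
    (j : ℕ) (r : R) (hr : ∀ z : hq d N j, r • z = 0)
    (x : ι (j + 1) → A ⊗[R] N)
    (hx : mv ((d (j + 1)).map (algebraMap R A)) (A ⊗[R] N) x = 0) :
    ∃ y, mv ((d j).map (algebraMap R A)) (A ⊗[R] N) y = r • x := by
  classical
  obtain ⟨t, rfl⟩ := (TensorProduct.piRight R A A (fun _ : ι (j + 1) => N)).surjective x
  rw [← piRight_lTensor_mv, LinearEquiv.map_eq_zero_iff] at hx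
  have hex : Function.Exact (LinearMap.ker (mv (d (j + 1)) N)).subtype (mv (d (j + 1)) N) := by
    rw [LinearMap.exact_iff, Submodule.range_subtype]
  obtain ⟨s, rfl⟩ := (Module.Flat.lTensor_exact A hex t).1 hx
  clear hx
  suffices h : ∃ w, (mv (d j) N).lTensor A w =
      r • (LinearMap.ker (mv (d (j + 1)) N)).subtype.lTensor A s by
    obtain ⟨w, hw⟩ := h
    refine ⟨TensorProduct.piRight R A A (fun _ : ι j => N) w, ?_⟩
    rw [← piRight_lTensor_mv, hw, ← algebraMap_smul A r, map_smul, algebraMap_smul]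
  induction s with
  | zero => exact ⟨0, by simp⟩
  | add x y hx hy =>
    obtain ⟨w, hw⟩ := hx
    obtain ⟨w', hw'⟩ := hy
    exact ⟨w + w', by simp only [map_add, hw, hw', smul_add]⟩
  | tmul a z =>
    obtain ⟨z, hz⟩ := z
    have h1 := hr (Hm.mk (fun j => mv (d j) N) j z hz)
    obtain ⟨w, hw⟩ := (Hm.mk_eq_zero (d := fun j => mv (d j) N)).1
      ((Hm.mk_smul (d := fun j => mv (d j) N) r hz).trans h1)
    refine ⟨a ⊗ₜ w, ?_⟩
    rw [LinearMap.lTensor_tmul, LinearMap.lTensor_tmul, hw, Submodule.subtype_apply,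
      TensorProduct.tmul_smul]

theorem smul_hq_baseChange [Module.Flat R A] (N : Type u) [AddCommGroup N] [Module R N]
    (j : ℕ) (r : R) (hr : ∀ z : hq d N j, r • z = 0)
    (z : hq (fun j => (d j).map (algebraMap R A)) (A ⊗[R] N) j) : algebraMap R A r • z = 0 := by
  obtain ⟨x, hx, rfl⟩ := Hm.exists_mk z
  obtain ⟨y, hy⟩ := smul_mem_range_baseChange d N j r hr x hx
  rw [← Hm.mk_smul]
  refine (Hm.mk_eq_zero (d := fun j => mv ((d j).map (algebraMap R A)) (A ⊗[R] N))).2 ⟨y, ?_⟩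
  rw [hy, algebraMap_smul]

theorem subsingleton_hq_baseChange [Module.Flat R A] (N : Type u) [AddCommGroup N] [Module R N]
    (j : ℕ) (h : Subsingleton (hq d N j)) :
    Subsingleton (hq (fun j => (d j).map (algebraMap R A)) (A ⊗[R] N) j) := by
  refine ⟨fun a b => ?_⟩
  have h1 := fun z => smul_hq_baseChange (A := A) d N j 1 (fun z => Subsingleton.elim _ _) z
  simp only [map_one, one_smul] at h1
  rw [h1 a, h1 b]

theorem subsingleton_hq_of_baseChange [Module.FaithfullyFlat R A] (hd : ∀ j, d (j + 1) * d j = 0)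
    (N : Type u) [AddCommGroup N] [Module R N]
    (j : ℕ) (h : Subsingleton (hq (fun j => (d j).map (algebraMap R A)) (A ⊗[R] N) j)) :
    Subsingleton (hq d N j) := by
  classical
  rw [Hm.subsingleton_iff] at h ⊢
  have key : Function.Exact (mv (d j) N) (mv (d (j + 1)) N) := by
    rw [← Module.FaithfullyFlat.lTensor_exact_iff_exact R A]
    intro t
    constructor
    · intro ht
      obtain ⟨y, hy⟩ := h (TensorProduct.piRight R A A (fun _ : ι (j + 1) => N) t)
        (by rw [← piRight_lTensor_mv, ht, map_zero])
      obtain ⟨w, rfl⟩ := (TensorProduct.piRight R A A (fun _ : ι j => N)).surjective y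
      rw [← piRight_lTensor_mv] at hy
      exact ⟨w, (TensorProduct.piRight R A A (fun _ : ι (j + 1) => N)).injective hy⟩
    · rintro ⟨w, rfl⟩
      have h0 : mv (d (j + 1)) N ∘ₗ mv (d j) N = 0 := by
        refine LinearMap.ext fun x => ?_
        rw [LinearMap.comp_apply, ← mv_mul, hd, mv_zero, LinearMap.zero_apply]
      rw [← LinearMap.comp_apply, ← LinearMap.lTensor_comp, h0, LinearMap.lTensor_zero,
        LinearMap.zero_apply]
  exact fun x hx => (key x).1 hx

theorem isFiniteLength_hq_baseChange [Module.Flat R A] [IsLocalRing R] [IsLocalRing A]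
    [IsNoetherianRing A] (hm : maximalIdeal A = (maximalIdeal R).map (algebraMap R A))
    (N : Type u) [AddCommGroup N] [Module R N] [Module.Finite R N]
    (j : ℕ) (h : IsFiniteLength R (hq d N j)) :
    IsFiniteLength A (hq (fun j => (d j).map (algebraMap R A)) (A ⊗[R] N) j) := by
  obtain ⟨k, hk⟩ := exists_pow_smul_of_isFiniteLength h
  refine isFiniteLength_of_pow k fun a ha z => ?_
  rw [hm, ← Ideal.map_pow] at ha
  have : Ideal.map (algebraMap R A) (maximalIdeal R ^ k) ≤
      Module.annihilator A (hq (fun j => (d j).map (algebraMap R A)) (A ⊗[R] N) j) := by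
    rw [Ideal.map_le_iff_le_comap]
    intro r hr
    rw [Ideal.mem_comap, Module.mem_annihilator]
    exact fun z => smul_hq_baseChange d N j r (hk r hr) z
  exact Module.mem_annihilator.1 (this ha) z

end BaseChange

instance {S : Type*} [CommRing S] {ι : ℕ → Type} [∀ j, Fintype (ι j)] [IsEmpty (ι 1)]
    (d : ∀ j, Matrix (ι (j + 1)) (ι j) S) (B : Type*) [AddCommGroup B] [Module S B] :
    Subsingleton (hq d B 0) :=
  Hm.subsingleton_iff.2 fun _ _ => ⟨0, Subsingleton.elim (α := ι 1 → B) _ _⟩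

theorem rigid_of_completion {R : Type u} [CommRing R] [IsLocalRing R] [IsNoetherianRing R]
    [IsNoetherianRing (AdicCompletion (maximalIdeal R) R)]
    {m : ℕ} {V : Type u} [CommRing V] [IsLocalRing V] [IsNoetherianRing V] [IsDomain V]
    (π : V) (hπ : IsSMulRegular V π) (hm : maximalIdeal V = Ideal.span {π})
    (ψ : MvPowerSeries (Fin m) V →+* AdicCompletion (maximalIdeal R) R)
    (hψ : Function.Surjective ψ) (f : MvPowerSeries (Fin m) V) (hf : f ≠ 0)
    (hker : RingHom.ker ψ = Ideal.span {f})
    {ι : ℕ → Type} [∀ j, Fintype (ι j)] [IsEmpty (ι 0)] [IsEmpty (ι 1)]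
    (d : ∀ j, Matrix (ι (j + 1)) (ι j) R) (hd : ∀ j, d (j + 1) * d j = 0) (K : ℕ)
    (hR : ∀ j ≤ K, Subsingleton (hq d R j))
    (N : Type u) [AddCommGroup N] [Module R N] [Module.Finite R N]
    (hfl : ∀ j ≤ K + 1, IsFiniteLength R (hq d N j)) (hv : Subsingleton (hq d N (K + 1))) :
    ∀ j ≤ K + 1, Subsingleton (hq d N j) := by
  have hff : Module.FaithfullyFlat R (AdicCompletion (maximalIdeal R) R) :=
    Module.FaithfullyFlat.of_flat_of_isLocalHom
  intro j hj
  refine subsingleton_hq_of_baseChange (A := AdicCompletion (maximalIdeal R) R) d hd N j ?_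
  refine rigid_hypersurface π hπ hm ψ hψ f hf hker
    (fun j => (d j).map (algebraMap R (AdicCompletion (maximalIdeal R) R))) (fun j => ?_) K
    (fun j hj => ?_) _ (fun j hj => ?_) ?_ j hj
  · rw [← Matrix.map_mul, hd, Matrix.map_zero _ (map_zero _)]
  · have := subsingleton_hq_baseChange (A := AdicCompletion (maximalIdeal R) R) d R j (hR j hj)
    exact (hqCongr _ (TensorProduct.AlgebraTensorModule.rid R
      (AdicCompletion (maximalIdeal R) R) (AdicCompletion (maximalIdeal R) R))
        j).symm.toEquiv.subsingleton
  · exact isFiniteLength_hq_baseChange d AdicCompletion.maximalIdeal_eq_map N j (hfl j hj)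
  · exact subsingleton_hq_baseChange d N _ hv

end ExtRigid

/-- Over an unramified hypersurface `R`, if `M`, `N` are finitely generated with `M`
nonzero, `i ≤ grade M`, `Ext^j(M, N)` has finite length for all `j ≤ i`, and
`Ext^i(M, N) = 0`, then `Ext^j(M, N) = 0` for all `j ≤ i`. -/
theorem ext_rigid_of_finite_length
    (R : Type u) [CommRing R] [IsLocalRing R] [IsNoetherianRing R]
    (hunr : IsUnramifiedLocal R) (hhyp : IsHypersurface R)
    (M : Type u) [AddCommGroup M] [Module R M] [Module.Finite R M] (hM : Nontrivial M)
    (N : Type u) [AddCommGroup N] [Module R N] [Module.Finite R N]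
    (i : ℕ) (hi : i ≤ moduleGrade R M)
    (hfl : ∀ j ≤ i, IsFiniteLength R (extMod R j M N))
    (hvanish : Subsingleton (extMod R i M N)) :
    ∀ j ≤ i, Subsingleton (extMod R j M N) := by
  have hchar : (ringChar (ResidueField R) : R) = 0 ∨
      (ringChar (ResidueField R) : R) ∉ maximalIdeal R ^ 2 := by
    rcases hunr with h | ⟨-, h⟩
    · exact Or.inl (h ▸ ringChar.Nat.cast_ringChar)
    · exact Or.inr h
  obtain ⟨-, ⟨Q, hreg, x, hx, hx0, e⟩⟩ := hhyp
  obtain ⟨hQ, s, hs, hdim⟩ := hreg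
  obtain ⟨hN, V, _, _, _, _, π, m, hπm, hπ, ψ, hψ, f, hf, hker⟩ :=
    ExtRigid.exists_mvPowerSeries_presentation_completion hchar
      (fun k : Fin s.card => (s.equivFin.symm k : Q))
      (by
        rw [← hs]
        congr 1
        ext a
        constructor
        · rintro ⟨k, rfl⟩
          exact (s.equivFin.symm k).2
        · exact fun ha => ⟨s.equivFin ⟨a, ha⟩, by simp⟩)
      hdim.le x (nonZeroDivisors.ne_zero hx0) hx e
  obtain ⟨n, ε, δ, hε, h0, hδ⟩ := ExtRigid.exists_free_resolution R M
  have equiv : ∀ (B : Type u) [AddCommGroup B] [Module R B] (j : ℕ),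
      Nonempty (extMod R j M B ≃ₗ[R] ExtRigid.hq (ExtRigid.dualMatrix δ) B (j + 1)) :=
    fun B _ _ j => ExtRigid.nonempty_ext_equiv δ ε hε h0 hδ B j
  intro j hj
  obtain ⟨ej⟩ := equiv N j
  have key := ExtRigid.rigid_of_completion π hπ hπm ψ hψ f hf hker (ExtRigid.dualMatrix δ)
    (ExtRigid.dualMatrix_mul δ hδ) i
    (fun j hj => by
      cases j with
      | zero => infer_instance
      | succ j =>
        obtain ⟨e⟩ := equiv R j
        have : Subsingleton (extMod R j M R) := by
          by_contra h
          exact absurd (Nat.sInf_le (s := {n : ℕ | ¬ Subsingleton (extMod R n M R)}) h)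
            (not_le.2 (lt_of_lt_of_le hj hi))
        exact e.symm.toEquiv.subsingleton)
    N (fun j hj => by
      cases j with
      | zero => exact IsFiniteLength.of_subsingleton
      | succ j =>
        obtain ⟨e⟩ := equiv N j
        exact e.isFiniteLength (hfl j (by omega)))
    (by
      obtain ⟨e⟩ := equiv N i
      exact e.symm.toEquiv.subsingleton) (j + 1) (by omega)
  exact ej.toEquiv.subsingleton
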